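/- arXiv:1705.09979 — 3 statements merged into one kernel-verified Lean document; each statement's English description precedes it below -/
import Mathlib

section
/- Let k ≥ 2 and let t be an integer with 1 ≤ t ≤ (k-2)(k+1)/2 - 1. Then every finite simple graph on n ≥ k-1 vertices with at least (k-1)n - t edges contains a non-empty subgraph on at most (1 - 1/max(10^4·k^2, 100·k·t))·n vertices in which every vertex has degree at least k. -/
namespace CoreProof
open Finset

/-- Greedy colouring along a rank function with backward propagation of demands. -/
theorem colour_aux {α : Type*} [DecidableEq α] (r : α → ℕ) (hr : Function.Injective r)
    (isW isA : α → Prop) (hWA : ∀ u, isW u → ¬ isA u)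
    (In : α → Finset α) (hIn : ∀ u, isW u → ∀ v ∈ In u, r v < r u)
    (hIn2 : ∀ u, isW u → ∀ z, ∃ v ∈ In u, v ≠ z)
    (x : α → α) (hx : ∀ u, isA u → r (x u) < r u ∧ ¬ isA (x u))
    (K : ℕ) (av : α → Finset α) (hav : ∀ u, isA u → (∀ v ∈ av u, r v < r u) ∧ (av u).card ≤ K)
    (N : ℕ) : ∀ P : Finset (α × α), (∀ p ∈ P, r p.1 < r p.2 ∧ r p.2 < N) →
    ∃ (O : Finset α) (col : α → Option (Fin (K + 2))), O.card ≤ P.card ∧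
      (∀ u ∈ O, isA u ∧ r u < N ∧ col u = none ∧ col (x u) = none) ∧
      (∀ u, r u < N →
        (¬ isW u → ¬ isA u → col u = none) ∧
        (isW u → ∀ c, col u = some c ↔ ∀ v ∈ In u, col v = some c) ∧
        (isA u → u ∉ O → ∃ c, col u = some c ∧ (col (x u) = some c ∨
          (col (x u) = none ∧ ∀ v ∈ av u, col v ≠ some c)))) ∧
      (∀ p ∈ P, ∀ c, ¬ (col p.1 = some c ∧ col p.2 = some c)) := by
  classical
  -- ordered pair
  let od : α → α → α × α := fun a b => if r a < r b then (a, b) else (b, a)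
  have od_lt : ∀ a b M, a ≠ b → r a < M → r b < M → r (od a b).1 < r (od a b).2 ∧ r (od a b).2 < M := by
    intro a b M hab ha hb
    have : r a ≠ r b := fun h => hab (hr h)
    simp only [od]
    split_ifs with h
    · exact ⟨h, hb⟩
    · exact ⟨by simp only; omega, ha⟩
  have od_col : ∀ (col : α → Option (Fin (K + 2))) a b,
      (∀ c, ¬ (col (od a b).1 = some c ∧ col (od a b).2 = some c)) →
      ∀ c, ¬ (col a = some c ∧ col b = some c) := by
    intro col a b h c hc
    apply h c
    simp only [od]
    split_ifs
    · exact hc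
    · exact ⟨hc.2, hc.1⟩
  choose! pk hpk1 hpk2 using hIn2
  -- demand that a vertex is uncoloured
  let UD : α → Finset (α × α) := fun y =>
    if isW y then {od (pk y y) (pk y (pk y y))} else ∅
  have UD_card : ∀ y, (UD y).card ≤ 1 := by
    intro y; simp only [UD]; split_ifs <;> simp
  have UD_lt : ∀ y M, r y < M → ∀ p ∈ UD y, r p.1 < r p.2 ∧ r p.2 < M := by
    intro y M hy p hp
    simp only [UD] at hp
    split_ifs at hp with h
    · rw [mem_singleton] at hp
      subst hp
      have h1 := hIn y h _ (hpk1 y h y)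
      have h2 := hIn y h _ (hpk1 y h (pk y y))
      exact od_lt _ _ M (hpk2 y h _).symm (by omega) (by omega)
    · simp at hp
  have UD_col : ∀ (col : α → Option (Fin (K + 2))) y, ¬ isA y →
      (¬ isW y → ¬ isA y → col y = none) →
      (isW y → ∀ c, col y = some c ↔ ∀ v ∈ In y, col v = some c) →
      (∀ p ∈ UD y, ∀ c, ¬ (col p.1 = some c ∧ col p.2 = some c)) → col y = none := by
    intro col y hA h1 h2 h3
    by_cases hW : isW y
    · by_contra hne
      obtain ⟨c, hc⟩ := Option.ne_none_iff_exists'.1 hne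
      have h4 := (h2 hW c).1 hc
      refine od_col col _ _ (h3 (od (pk y y) (pk y (pk y y))) (by simp [UD, hW])) c ⟨h4 _ (hpk1 y hW _), h4 _ (hpk1 y hW _)⟩
    · exact h1 hW hA
  induction N with
  | zero =>
    intro P hP
    refine ⟨∅, fun _ => none, by simp, by simp, fun u hu => by omega, ?_⟩
    intro p hp
    have := hP p hp
    omega
  | succ N ih =>
    intro P hP
    by_cases hu : ∃ u, r u = N
    swap
    · push Not at hu
      obtain ⟨O, col, h1, h2, h3, h4⟩ := ih P (fun p hp => by
        have := hP p hp
        have := hu p.2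
        omega)
      refine ⟨O, col, h1, fun u hu => ?_, fun u hu' => h3 u (by have := hu u; omega), h4⟩
      have := h2 u hu
      exact ⟨this.1, by omega, this.2.2⟩
    obtain ⟨u, hu⟩ := hu
    have hlt : ∀ v, r v < N → v ≠ u := by rintro v hv rfl; omega
    have hle : ∀ v, r v < N + 1 → v ≠ u → r v < N := by
      intro v hv hne
      have : r v ≠ N := fun h => hne (hr (h.trans hu.symm))
      omega
    set P1 := P.filter (fun p => p.2 ≠ u) with hP1
    set P2 := P.filter (fun p => p.2 = u) with hP2
    have hcard : P1.card + P2.card = P.card := by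
      rw [add_comm]; exact card_filter_add_card_filter_not _
    have hP1lt : ∀ p ∈ P1, r p.1 < r p.2 ∧ r p.2 < N := by
      intro p hp
      rw [hP1, mem_filter] at hp
      exact ⟨(hP p hp.1).1, hle _ (hP p hp.1).2 hp.2⟩
    have hP2lt : ∀ p ∈ P2, r p.1 < N ∧ p.2 = u := by
      intro p hp
      rw [hP2, mem_filter] at hp
      have := hP p hp.1
      rw [hp.2] at this
      exact ⟨by omega, hp.2⟩
    -- general extension step
    have ext : ∀ (O : Finset α) (col : α → Option (Fin (K + 2))) (cu : Option (Fin (K + 2))),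
        (∀ w, r w < N → (Function.update col u cu) w = col w) := by
      intro O col cu w hw
      rw [Function.update_of_ne (hlt w hw)]
    have step : ∀ (P' : Finset (α × α)) (O O' : Finset α) (col : α → Option (Fin (K + 2)))
        (cu : Option (Fin (K + 2))), P1 ⊆ P' →
        O'.card ≤ P.card → (O' = O ∨ (O' = insert u O ∧ isA u ∧ cu = none ∧ col (x u) = none)) →
        (∀ u ∈ O, isA u ∧ r u < N ∧ col u = none ∧ col (x u) = none) →
        (∀ u, r u < N →
        (¬ isW u → ¬ isA u → col u = none) ∧
        (isW u → ∀ c, col u = some c ↔ ∀ v ∈ In u, col v = some c) ∧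
        (isA u → u ∉ O → ∃ c, col u = some c ∧ (col (x u) = some c ∨
          (col (x u) = none ∧ ∀ v ∈ av u, col v ≠ some c)))) →
        (∀ p ∈ P', ∀ c, ¬ (col p.1 = some c ∧ col p.2 = some c)) →
        ((¬ isW u → ¬ isA u → cu = none) ∧
        (isW u → ∀ c, cu = some c ↔ ∀ v ∈ In u, col v = some c) ∧
        (isA u → u ∉ O' → ∃ c, cu = some c ∧ (col (x u) = some c ∨
          (col (x u) = none ∧ ∀ v ∈ av u, col v ≠ some c)))) →
        (∀ p ∈ P2, ∀ c, ¬ (col p.1 = some c ∧ cu = some c)) →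
        ∃ (O : Finset α) (col : α → Option (Fin (K + 2))), O.card ≤ P.card ∧
      (∀ u ∈ O, isA u ∧ r u < N + 1 ∧ col u = none ∧ col (x u) = none) ∧
      (∀ u, r u < N + 1 →
        (¬ isW u → ¬ isA u → col u = none) ∧
        (isW u → ∀ c, col u = some c ↔ ∀ v ∈ In u, col v = some c) ∧
        (isA u → u ∉ O → ∃ c, col u = some c ∧ (col (x u) = some c ∨
          (col (x u) = none ∧ ∀ v ∈ av u, col v ≠ some c)))) ∧
      (∀ p ∈ P, ∀ c, ¬ (col p.1 = some c ∧ col p.2 = some c)) := by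
      intro P' O O' col cu hPP hOc hO h2 h3 h4 h5 h6
      have e := ext O col cu
      have eu : (Function.update col u cu) u = cu := by simp
      refine ⟨O', Function.update col u cu, hOc, ?_, ?_, ?_⟩
      · have hold : ∀ w ∈ O, isA w ∧ r w < N + 1 ∧ (Function.update col u cu) w = none ∧
            (Function.update col u cu) (x w) = none := by
          intro w hw
          obtain ⟨a1, a2, a3, a4⟩ := h2 w hw
          have := (hx w a1).1
          refine ⟨a1, by omega, ?_, ?_⟩
          · rw [e w a2, a3]
          · rw [e _ (by omega), a4]
        rcases hO with rfl | ⟨rfl, b1, b2, b3⟩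
        · exact hold
        · intro w hw
          rw [mem_insert] at hw
          rcases hw with rfl | hw
          · refine ⟨b1, by omega, by rw [eu, b2], ?_⟩
            rw [e _ (by have := (hx w b1).1; omega), b3]
          · exact hold w hw
      · intro w hw
        by_cases hwu : w = u
        · subst hwu
          rw [eu]
          refine ⟨h5.1, ?_, ?_⟩
          · intro hW c
            rw [h5.2.1 hW c]
            refine forall₂_congr fun v hv => ?_
            rw [e v (by have := hIn w hW v hv; omega)]
          · intro hA hO'
            obtain ⟨c, hc, hc2⟩ := h5.2.2 hA hO'
            refine ⟨c, hc, ?_⟩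
            rw [e _ (by have := (hx w hA).1; omega)]
            rcases hc2 with hc2 | ⟨hc2, hc3⟩
            · exact Or.inl hc2
            · refine Or.inr ⟨hc2, fun v hv => ?_⟩
              rw [e v (by have := (hav w hA).1 v hv; omega)]
              exact hc3 v hv
        · have hwN := hle w hw hwu
          rw [e w hwN]
          obtain ⟨g1, g2, g3⟩ := h3 w hwN
          refine ⟨g1, ?_, ?_⟩
          · intro hW c
            rw [g2 hW c]
            refine forall₂_congr fun v hv => ?_
            rw [e v (by have := hIn w hW v hv; omega)]
          · intro hA hO'
            have hwO : w ∉ O := by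
              rcases hO with rfl | ⟨rfl, b1, b2, b3⟩
              · exact hO'
              · exact fun h => hO' (mem_insert_of_mem h)
            obtain ⟨c, hc, hc2⟩ := g3 hA hwO
            refine ⟨c, hc, ?_⟩
            rw [e _ (by have := (hx w hA).1; omega)]
            rcases hc2 with hc2 | ⟨hc2, hc3⟩
            · exact Or.inl hc2
            · refine Or.inr ⟨hc2, fun v hv => ?_⟩
              rw [e v (by have := (hav w hA).1 v hv; omega)]
              exact hc3 v hv
      · intro p hp c
        by_cases hpu : p.2 = u
        · have hp2 : p ∈ P2 := by rw [hP2, mem_filter]; exact ⟨hp, hpu⟩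
          rw [hpu, eu, e _ (hP2lt p hp2).1]
          exact h6 p hp2 c
        · have hp1 : p ∈ P1 := by rw [hP1, mem_filter]; exact ⟨hp, hpu⟩
          have := hP1lt p hp1
          rw [e _ (by omega), e _ this.2]
          exact h4 p (hPP hp1) c
    by_cases hW : isW u
    · -- W case
      obtain ⟨O, col, h1, h2, h3, h4⟩ := ih (P1 ∪ P2.image (fun p => od p.1 (pk u p.1))) (by
        intro p hp
        rw [mem_union] at hp
        rcases hp with hp | hp
        · exact hP1lt p hp
        · obtain ⟨q, hq, rfl⟩ := mem_image.1 hp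
          have h1 := hIn u hW _ (hpk1 u hW q.1)
          exact od_lt _ _ N (hpk2 u hW _).symm (hP2lt q hq).1 (by omega))
      have hc : O.card ≤ P.card := by
        have a1 := card_union_le P1 (P2.image (fun p => od p.1 (pk u p.1)))
        have a2 : (P2.image (fun p => od p.1 (pk u p.1))).card ≤ P2.card := card_image_le
        omega
      have key : ∃ cu : Option (Fin (K + 2)), ∀ c, cu = some c ↔ ∀ v ∈ In u, col v = some c := by
        by_cases hex : ∃ c, ∀ v ∈ In u, col v = some c
        · obtain ⟨c, hc⟩ := hex
          refine ⟨some c, fun d => ⟨fun h => by cases h; exact hc, fun h => ?_⟩⟩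
          have a1 := h _ (hpk1 u hW u)
          have a2 := hc _ (hpk1 u hW u)
          rw [← a1, ← a2]
        · refine ⟨none, fun d => ⟨fun h => by simp at h, fun h => absurd ⟨d, h⟩ hex⟩⟩
      obtain ⟨cu, hcu⟩ := key
      refine step _ O O col cu subset_union_left hc (Or.inl rfl) h2 h3 h4
        ⟨fun h => absurd hW h, fun _ => hcu, fun h => absurd h (hWA u hW)⟩ ?_
      intro p hp c hh
      have := (hcu c).1 hh.2 _ (hpk1 u hW p.1)
      exact od_col col _ _ (h4 (od p.1 (pk u p.1))
        (mem_union_right _ (mem_image_of_mem _ hp))) c ⟨hh.1, this⟩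
    by_cases hA : isA u
    swap
    · obtain ⟨O, col, h1, h2, h3, h4⟩ := ih P1 hP1lt
      refine step P1 O O col none subset_rfl (by omega) (Or.inl rfl) h2 h3 h4
        ⟨fun _ _ => rfl, fun h => absurd h hW, fun h => absurd h hA⟩ ?_
      intro p hp c hh
      simp at hh
    have hxu := hx u hA
    have hxN : r (x u) < N := by omega
    by_cases h2c : 2 ≤ P2.card
    · obtain ⟨O, col, h1, h2, h3, h4⟩ := ih (P1 ∪ UD (x u)) (by
        intro p hp
        rw [mem_union] at hp
        rcases hp with hp | hp
        · exact hP1lt p hp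
        · exact UD_lt _ _ hxN p hp)
      have hc : O.card ≤ P1.card + 1 := by
        have a1 := card_union_le P1 (UD (x u))
        have a2 := UD_card (x u)
        omega
      have hcx : col (x u) = none := UD_col col (x u) hxu.2 (h3 _ hxN).1 (h3 _ hxN).2.1
        (fun p hp => h4 p (mem_union_right _ hp))
      refine step _ O (insert u O) col none subset_union_left ?_
        (Or.inr ⟨rfl, hA, rfl, hcx⟩) h2 h3 h4
        ⟨fun _ _ => rfl, fun h => absurd h hW, fun _ h => absurd (mem_insert_self _ _) h⟩ ?_
      · have := card_insert_le u O
        omega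
      · intro p hp c hh
        simp at hh
    · -- at most one demand
      have hz : ∃ z : Option α, (∀ p ∈ P2, some p.1 = z) ∧ (∀ a, z = some a → r a < N) ∧ (z = none ∨ P2.card = 1) := by
        rcases P2.eq_empty_or_nonempty with h | ⟨q, hq⟩
        · exact ⟨none, by simp [h], by simp, Or.inl rfl⟩
        · refine ⟨some q.1, ?_, ?_, Or.inr ?_⟩
          · intro p hp
            have := card_le_one.1 (by omega : P2.card ≤ 1) p hp q hq
            rw [this]
          · intro a ha
            cases ha
            exact (hP2lt q hq).1
          · have := card_pos.2 ⟨q, hq⟩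
            omega
      obtain ⟨z, hz1, hz2, hz3⟩ := hz
      let Q : Finset (α × α) := match z with
        | none => ∅
        | some a => if a = x u then UD (x u) else {od a (x u)}
      have hQ1 : Q.card ≤ P2.card := by
        rcases z with _ | a
        · simp [Q]
        · have : P2.card = 1 := by simpa using hz3
          simp only [Q, this]
          split_ifs
          · exact UD_card _
          · simp
      have hQ2 : ∀ p ∈ Q, r p.1 < r p.2 ∧ r p.2 < N := by
        rcases z with _ | a
        · simp [Q]
        · intro p hp
          simp only [Q] at hp
          split_ifs at hp with h
          · exact UD_lt _ _ hxN p hp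
          · rw [mem_singleton] at hp
            subst hp
            exact od_lt _ _ _ h (hz2 a rfl) hxN
      obtain ⟨O, col, h1, h2, h3, h4⟩ := ih (P1 ∪ Q) (by
        intro p hp
        rw [mem_union] at hp
        rcases hp with hp | hp
        · exact hP1lt p hp
        · exact hQ2 p hp)
      have hc : O.card ≤ P.card := by
        have a1 := card_union_le P1 Q
        omega
      have hzx : ∀ a c, z = some a → ¬ (col a = some c ∧ col (x u) = some c) := by
        intro a c ha hh
        subst ha
        by_cases h : a = x u
        · have : col (x u) = none := UD_col col (x u) hxu.2 (h3 _ hxN).1 (h3 _ hxN).2.1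
            (fun p hp => h4 p (mem_union_right _ (by simpa [Q, h] using hp)))
          rw [this] at hh
          simp at hh
        · exact od_col col a (x u) (h4 _ (mem_union_right _ (by simp [Q, h]))) c hh
      rcases hcx : col (x u) with _ | c
      · -- fresh colour
        let bad : Finset (Option (Fin (K + 2))) := (av u ∪ z.toFinset).image col
        have hb : bad.card ≤ K + 1 := by
          have a1 : bad.card ≤ (av u ∪ z.toFinset).card := card_image_le
          have a2 := card_union_le (av u) z.toFinset
          have a3 : z.toFinset.card ≤ 1 := by
            rcases z with _ | a <;> simp
          have a4 := (hav u hA).2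
          omega
        have : ∃ c : Fin (K + 2), some c ∉ bad := by
          by_contra hcon
          push Not at hcon
          have : (univ.image (some : Fin (K + 2) → Option (Fin (K + 2)))).card ≤ bad.card := by
            apply card_le_card
            intro y hy
            obtain ⟨c, _, rfl⟩ := mem_image.1 hy
            exact hcon c
          rw [card_image_of_injective _ (Option.some_injective _)] at this
          simp at this
          omega
        obtain ⟨c, hcb⟩ := this
        refine step _ O O col (some c) subset_union_left hc (Or.inl rfl) h2 h3 h4
          ⟨fun _ h => absurd hA h, fun h => absurd h hW, fun _ _ => ⟨c, rfl, Or.inr ⟨hcx, ?_⟩⟩⟩ ?_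
        · intro v hv hvc
          exact hcb (mem_image.2 ⟨v, mem_union_left _ hv, hvc⟩)
        · intro p hp d hh
          have hpz := hz1 p hp
          have : some c = some d := hh.2
          refine hcb (mem_image.2 ⟨p.1, mem_union_right _ ?_, by rw [this]; exact hh.1⟩)
          rw [← hpz]; simp
      · refine step _ O O col (some c) subset_union_left hc (Or.inl rfl) h2 h3 h4
          ⟨fun _ h => absurd hA h, fun h => absurd h hW, fun _ _ => ⟨c, rfl, Or.inl hcx⟩⟩ ?_
        intro p hp d hh
        have hpz := hz1 p hp
        have hd : some c = some d := hh.2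
        exact hzx p.1 d hpz.symm ⟨hh.1, by rw [hcx, hd]⟩



set_option linter.unusedSectionVars false

variable {V : Type*} [Fintype V] [DecidableEq V]

/-- number of ordered adjacent pairs -/
def ee (N : V → Finset V) (A B : Finset V) : ℕ := ∑ a ∈ A, (N a ∩ B).card

/-- nonempty set inducing min degree at least q+1 -/
def IsCore (N : V → Finset V) (q : ℕ) (K : Finset V) : Prop :=
  K.Nonempty ∧ ∀ v ∈ K, q + 1 ≤ (N v ∩ K).card

def Exc (N : V → Finset V) (q : ℕ) (A : Finset V) : Prop :=
  ee N A A + 2 * ee N A Aᶜ ≤ 2 * q * A.card + 2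

structure Sym (N : V → Finset V) : Prop where
  symm : ∀ u v, u ∈ N v → v ∈ N u
  irr : ∀ v, v ∉ N v

theorem ee_comm {N : V → Finset V} (hN : Sym N) (A B : Finset V) : ee N A B = ee N B A := by
  have h : ∀ A B : Finset V, ee N A B = ∑ a ∈ A, ∑ b ∈ B, if b ∈ N a then 1 else 0 := by
    intro A B
    unfold ee
    refine sum_congr rfl fun a _ => ?_
    rw [← sum_filter, sum_const, smul_eq_mul, mul_one]
    congr 1
    ext b; simp [and_comm]
  rw [h, h, sum_comm]
  refine sum_congr rfl fun a _ => sum_congr rfl fun b _ => ?_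
  have : a ∈ N b ↔ b ∈ N a := ⟨hN.symm _ _, hN.symm _ _⟩
  simp [this]

theorem ee_union_left (N : V → Finset V) {A B : Finset V} (C : Finset V) (h : Disjoint A B) :
    ee N (A ∪ B) C = ee N A C + ee N B C := sum_union h

theorem card_inter_union (S : Finset V) {B C : Finset V} (h : Disjoint B C) :
    (S ∩ (B ∪ C)).card = (S ∩ B).card + (S ∩ C).card := by
  rw [inter_union_distrib_left, card_union_of_disjoint]
  exact h.mono inter_subset_right inter_subset_right

theorem ee_union_right (N : V → Finset V) (A : Finset V) {B C : Finset V} (h : Disjoint B C) :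
    ee N A (B ∪ C) = ee N A B + ee N A C := by
  unfold ee
  rw [← sum_add_distrib]
  exact sum_congr rfl fun a _ => card_inter_union _ h

theorem ee_erase {N : V → Finset V} (hN : Sym N) (K : Finset V) (v : V) (hv : v ∈ K) :
    ee N K K = ee N (K.erase v) (K.erase v) + 2 * (N v ∩ K).card := by
  have hd : Disjoint {v} (K.erase v) := by simp
  have hK : K = {v} ∪ K.erase v := by rw [← insert_eq, insert_erase hv]
  have h1 : ee N K K = ee N ({v} ∪ K.erase v) ({v} ∪ K.erase v) := by rw [← hK]
  have h0 : ee N {v} {v} = 0 := by simp [ee, hN.irr]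
  have h3 : (N v ∩ K).card = ee N {v} (K.erase v) := by
    have : (N v ∩ K) = N v ∩ K.erase v := by
      ext x; simp only [mem_inter, mem_erase]
      constructor
      · rintro ⟨a, b⟩; exact ⟨a, fun h => hN.irr v (h ▸ a), b⟩
      · rintro ⟨a, b⟩; exact ⟨a, b.2⟩
    rw [this]; simp [ee]
  rw [h1, ee_union_left _ _ hd, ee_union_right _ _ hd, ee_union_right _ _ hd, h0, h3,
    ee_comm hN (K.erase v) {v}]
  ring

theorem noCore_bound {N : V → Finset V} (hN : Sym N) (q : ℕ) : ∀ (m : ℕ) (K : Finset V),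
    K.card = q + m →
    (∀ K' ⊆ K, ¬ IsCore N q K') → ee N K K + q * (q + 1) ≤ 2 * q * K.card := by
  intro m
  induction m with
  | zero =>
    intro K hK _
    have : ee N K K + K.card ≤ K.card * K.card := by
      have : ∀ a ∈ K, (N a ∩ K).card + 1 ≤ K.card := by
        intro a ha
        have : N a ∩ K ⊆ K.erase a := by
          intro x hx
          rw [mem_inter] at hx
          exact mem_erase.2 ⟨fun h => hN.irr a (h ▸ hx.1), hx.2⟩
        have := card_le_card this
        rw [card_erase_of_mem ha] at this
        have := card_pos.2 ⟨a, ha⟩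
        omega
      have h := sum_le_sum this
      rw [sum_add_distrib] at h
      simpa [ee] using h
    simp only [add_zero] at hK
    rw [hK] at this ⊢
    nlinarith
  | succ m ih =>
    intro K hK hno
    have hne : K.Nonempty := card_pos.1 (by omega)
    have h1 := hno K subset_rfl
    unfold IsCore at h1
    push Not at h1
    obtain ⟨v, hv, hvd⟩ := h1 hne
    have h2 := ih (K.erase v) (by rw [card_erase_of_mem hv]; omega)
      (fun K' h => hno K' (h.trans (erase_subset _ _)))
    rw [ee_erase hN K v hv]
    have h3 : K.card = (K.erase v).card + 1 := by
      rw [card_erase_of_mem hv]; omega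
    rw [h3]
    nlinarith

def HasCore (N : V → Finset V) (q : ℕ) (Y : Finset V) : Prop :=
  ∃ K, IsCore N q K ∧ K ⊆ Yᶜ

theorem ee_univ {N : V → Finset V} (hN : Sym N) (A : Finset V) :
    ee N univ univ = ee N A A + 2 * ee N A Aᶜ + ee N Aᶜ Aᶜ := by
  have hd : Disjoint A Aᶜ := disjoint_compl_right
  have h : (univ : Finset V) = A ∪ Aᶜ := by simp
  rw [h, ee_union_left _ _ hd, ee_union_right _ _ hd, ee_union_right _ _ hd, ee_comm hN Aᶜ A]
  ring

theorem exc_hasCore {N : V → Finset V} (hN : Sym N) (q t : ℕ) (ht : 2 * t + 4 ≤ q * (q + 1))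
    (he : 2 * q * Fintype.card V ≤ ee N univ univ + 2 * t)
    (A : Finset V) (hA : Exc N q A) (hc : A.card + q ≤ Fintype.card V) : HasCore N q A := by
  by_contra hno
  unfold HasCore at hno
  push Not at hno
  have hcc : Aᶜ.card + A.card = Fintype.card V := by rw [add_comm]; exact card_add_card_compl A
  have h1 := noCore_bound hN q (Aᶜ.card - q) Aᶜ (by omega) (fun K' h hc => hno K' hc h)
  rw [ee_univ hN A] at he
  unfold Exc at hA
  rw [← hcc] at he
  nlinarith

theorem ordering {N : V → Finset V} (q : ℕ) : ∀ (m : ℕ) (Z : Finset V), Z.card = m →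
    (∀ K ⊆ Z, ¬ IsCore N q K) → ∃ f : V → ℕ, Function.Injective f ∧
      (∀ y ∉ Z, ∀ z ∈ Z, f y < f z) ∧
      ∀ v ∈ Z, ((N v).filter (fun u => f v < f u)).card ≤ q := by
  intro m
  induction m with
  | zero =>
    intro Z hZ _
    rw [card_eq_zero] at hZ
    subst hZ
    refine ⟨fun v => Fintype.equivFin V v, ?_, by simp, by simp⟩
    intro a b h
    exact (Fintype.equivFin V).injective (Fin.ext h)
  | succ m ih =>
    intro Z hZ hno
    have hne : Z.Nonempty := card_pos.1 (by omega)
    have h1 := hno Z subset_rfl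
    unfold IsCore at h1
    push Not at h1
    obtain ⟨v, hv, hvd⟩ := h1 hne
    obtain ⟨f, hf, hf1, hf2⟩ := ih (Z.erase v) (by rw [card_erase_of_mem hv]; omega)
      (fun K' h => hno K' (h.trans (erase_subset _ _)))
    let B := univ.sup f + 1
    have hB : ∀ u, f u < B := fun u => Nat.lt_succ_of_le (le_sup (f := f) (mem_univ u))
    let g : V → ℕ := fun u => if u = v then B else if u ∈ Z then f u + B + 1 else f u
    have gv : g v = B := by simp [g]
    have gZ : ∀ u, u ≠ v → u ∈ Z → g u = f u + B + 1 := by intro u h h'; simp [g, h, h']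
    have gY : ∀ u, u ∉ Z → g u = f u := by
      intro u h
      have : u ≠ v := fun h' => h (h' ▸ hv)
      simp [g, h, this]
    refine ⟨g, ?_, ?_, ?_⟩
    · intro a b hab
      by_contra hne
      have hfab : f a ≠ f b := fun h => hne (hf h)
      have := hB a
      have := hB b
      simp only [g] at hab
      split_ifs at hab <;> first | omega | simp_all
    · intro y hy z hz
      rw [gY y hy]
      have := hB y
      by_cases h : z = v
      · subst h; omega
      · rw [gZ z h hz]; omega
    · intro z hz
      by_cases h : z = v
      · subst h
        refine le_trans (card_le_card ?_) (Nat.lt_succ_iff.1 hvd)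
        intro u hu
        rw [mem_filter, gv] at hu
        refine mem_inter.2 ⟨hu.1, ?_⟩
        by_contra hc
        rw [gY u hc] at hu
        have := hB u
        omega
      · refine le_trans (card_le_card ?_) (hf2 z (mem_erase.2 ⟨h, hz⟩))
        intro u hu
        rw [mem_filter, gZ z h hz] at hu
        refine mem_filter.2 ⟨hu.1, ?_⟩
        have := hB u
        have h2 := hu.2
        simp only [g] at h2
        split_ifs at h2 <;> omega


structure Ctx (N : V → Finset V) (q t M : ℕ) : Prop where
  sym : Sym N
  hq : 2 ≤ q
  ht1 : 1 ≤ t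
  ht : 2 * t + 4 ≤ q * (q + 1)
  he : 2 * q * Fintype.card V ≤ ee N univ univ + 2 * t
  hmin : ∀ v, q + 1 ≤ (N v).card
  hn : q + 2 ≤ Fintype.card V
  hM1 : 10000 * (q + 1) ^ 2 ≤ M
  hM2 : 100 * (q + 1) * t ≤ M
  hno : ∀ K, IsCore N q K → M * Kᶜ.card < Fintype.card V

theorem Ctx.hasCore_small {N : V → Finset V} {q t M : ℕ} (h : Ctx N q t M) {Y : Finset V}
    (hY : HasCore N q Y) : M * Y.card < Fintype.card V := by
  obtain ⟨K, hK, hKY⟩ := hY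
  refine lt_of_le_of_lt (Nat.mul_le_mul_left M (card_le_card ?_)) (h.hno K hK)
  rwa [subset_compl_comm] at hKY

theorem Ctx.closed_small {N : V → Finset V} {q t M : ℕ} (h : Ctx N q t M) {R : Finset V}
    (hR : ∀ v ∉ R, q + 1 ≤ (N v \ R).card) (hne : ∃ v, v ∉ R) :
    M * R.card < Fintype.card V := by
  apply h.hasCore_small
  obtain ⟨v, hv⟩ := hne
  refine ⟨Rᶜ, ⟨⟨v, by simpa using hv⟩, ?_⟩, subset_rfl⟩
  intro v hv
  rw [mem_compl] at hv
  have := hR v hv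
  rwa [sdiff_eq_inter_compl] at this

theorem Ctx.exc_small {N : V → Finset V} {q t M : ℕ} (h : Ctx N q t M) {A : Finset V}
    (hA : Exc N q A) (hc : A.card + q ≤ Fintype.card V) :
    M * A.card < Fintype.card V :=
  h.hasCore_small (exc_hasCore h.sym q t h.ht h.he A hA hc)

theorem exc_union {N : V → Finset V} (hN : Sym N) {A B : Finset V} (hd : Disjoint A B) :
    ee N (A ∪ B) (A ∪ B) + 2 * ee N (A ∪ B) (A ∪ B)ᶜ + 2 * ee N A B =
      (ee N A A + 2 * ee N A Aᶜ) + (ee N B B + 2 * ee N B Bᶜ) := by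
  have hA : Aᶜ = B ∪ (A ∪ B)ᶜ := by
    ext x
    have : x ∈ A → x ∉ B := fun h => disjoint_left.1 hd h
    simp only [mem_compl, mem_union]; tauto
  have hB : Bᶜ = A ∪ (A ∪ B)ᶜ := by
    ext x
    have : x ∈ A → x ∉ B := fun h => disjoint_left.1 hd h
    simp only [mem_compl, mem_union]; tauto
  have d1 : Disjoint B (A ∪ B)ᶜ := by
    rw [disjoint_left]; intro x hx; simp [hx]
  have d2 : Disjoint A (A ∪ B)ᶜ := by
    rw [disjoint_left]; intro x hx; simp [hx]
  have e1 : ee N A Aᶜ = ee N A B + ee N A (A ∪ B)ᶜ := by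
    rw [← ee_union_right N A d1, ← hA]
  have e2 : ee N B Bᶜ = ee N B A + ee N B (A ∪ B)ᶜ := by
    rw [← ee_union_right N B d2, ← hB]
  rw [e1, e2, ee_union_left _ _ hd, ee_union_left _ _ hd, ee_union_right _ _ hd,
    ee_union_right _ _ hd, ee_comm hN B A]
  ring

theorem eb_singleton {N : V → Finset V} (hN : Sym N) (v : V) :
    ee N {v} {v} + 2 * ee N {v} {v}ᶜ = 2 * (N v).card := by
  have h0 : ee N {v} {v} = 0 := by simp [ee, hN.irr]
  have h1 : ee N {v} {v}ᶜ = (N v).card := by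
    simp only [ee, sum_singleton]
    congr 1
    ext x; simp only [mem_inter, mem_compl, mem_singleton]
    exact ⟨fun h => h.1, fun h => ⟨h, fun h' => hN.irr v (h' ▸ h)⟩⟩
  omega

theorem ee_pos {N : V → Finset V} {A B : Finset V} {a b : V} (ha : a ∈ A) (hb : b ∈ B)
    (hab : b ∈ N a) : 1 ≤ ee N A B := by
  have : (N a ∩ B).card ≤ ee N A B :=
    single_le_sum (f := fun a => (N a ∩ B).card) (fun _ _ => Nat.zero_le _) ha
  have : 0 < (N a ∩ B).card := card_pos.2 ⟨b, mem_inter.2 ⟨hab, hb⟩⟩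
  omega

structure Fam (N : V → Finset V) (q : ℕ) (F : Finset (Finset V)) : Prop where
  disj : ∀ A ∈ F, ∀ B ∈ F, A ≠ B → Disjoint A B
  ne : ∀ A ∈ F, A.Nonempty
  exc : ∀ A ∈ F, Exc N q A
  sz : ∀ A ∈ F, A.card + q ≤ Fintype.card V
  cov : ∀ v, (N v).card = q + 1 → ∃ A ∈ F, v ∈ A

theorem Ctx.exists_family {N : V → Finset V} {q t M : ℕ} (h : Ctx N q t M) :
    ∃ F : Finset (Finset V), Fam N q F ∧
      (∀ A ∈ F, ∀ B ∈ F, A ≠ B → ∀ a ∈ A, ∀ b ∈ B, b ∉ N a) ∧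
      (∀ A ∈ F, ∀ w ∉ A, q + 1 ≤ (N w \ A).card) := by
  classical
  let mu : Finset (Finset V) → ℕ := fun F =>
    F.card * (Fintype.card V + 1) + (Fintype.card V - (F.biUnion id).card)
  have hex : (univ.filter (fun F => Fam N q F)).Nonempty := by
    refine ⟨(univ.filter (fun v => (N v).card = q + 1)).image (fun v => {v}), ?_⟩
    rw [mem_filter]
    refine ⟨mem_univ _, ?_, ?_, ?_, ?_, ?_⟩
    · intro A hA B hB hAB
      obtain ⟨a, _, rfl⟩ := mem_image.1 hA
      obtain ⟨b, _, rfl⟩ := mem_image.1 hB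
      rw [disjoint_singleton]
      rintro rfl; exact hAB rfl
    · intro A hA
      obtain ⟨a, _, rfl⟩ := mem_image.1 hA
      simp
    · intro A hA
      obtain ⟨a, ha, rfl⟩ := mem_image.1 hA
      unfold Exc
      rw [eb_singleton h.sym, (mem_filter.1 ha).2]
      simp; omega
    · intro A hA
      obtain ⟨a, ha, rfl⟩ := mem_image.1 hA
      have := h.hn
      simp; omega
    · intro v hv
      exact ⟨{v}, mem_image.2 ⟨v, by simp [hv], rfl⟩, by simp⟩
  obtain ⟨F, hF, hmin⟩ := exists_min_image _ mu hex
  replace hF := (mem_filter.1 hF).2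
  replace hmin : ∀ F', Fam N q F' → mu F ≤ mu F' := fun F' h' => hmin F' (by simp [h'])
  have hsm : ∀ A ∈ F, 4 * (q + 1) * A.card < Fintype.card V := by
    intro A hA
    have h1 := h.exc_small (hF.exc A hA) (hF.sz A hA)
    refine lt_of_le_of_lt (Nat.mul_le_mul_right _ ?_) h1
    have := h.hM1
    nlinarith
  have hpos : ∀ A ∈ F, 1 ≤ A.card := fun A hA => card_pos.2 (hF.ne A hA)
  have hno : ∀ A ∈ F, ∀ B ∈ F, A ≠ B → ∀ a ∈ A, ∀ b ∈ B, b ∉ N a := by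
    intro A hA B hB hAB a ha b hb hab
    have hd := hF.disj A hA B hB hAB
    have hu := exc_union h.sym hd
    have hp := ee_pos ha hb hab
    have hcu : (A ∪ B).card = A.card + B.card := card_union_of_disjoint hd
    have hBe : B ∈ F.erase A := mem_erase.2 ⟨hAB.symm, hB⟩
    set F' := insert (A ∪ B) ((F.erase A).erase B) with hF'
    have hsub : ∀ C ∈ (F.erase A).erase B, C ∈ F ∧ C ≠ A ∧ C ≠ B := by
      intro C hC
      rw [mem_erase, mem_erase] at hC
      exact ⟨hC.2.2, hC.2.1, hC.1⟩
    have hnew : Fam N q F' := by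
      constructor
      · have key : ∀ C ∈ (F.erase A).erase B, Disjoint (A ∪ B) C := by
          intro C hC
          obtain ⟨c1, c2, c3⟩ := hsub C hC
          rw [disjoint_union_left]
          exact ⟨hF.disj A hA C c1 c2.symm, hF.disj B hB C c1 c3.symm⟩
        intro C hC D hD hCD
        rw [hF', mem_insert] at hC hD
        rcases hC with rfl | hC <;> rcases hD with rfl | hD
        · exact absurd rfl hCD
        · exact key D hD
        · exact (key C hC).symm
        · exact hF.disj C (hsub C hC).1 D (hsub D hD).1 hCD
      · intro C hC
        rw [hF', mem_insert] at hC
        rcases hC with rfl | hC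
        · exact (hF.ne A hA).mono subset_union_left
        · exact hF.ne C (hsub C hC).1
      · intro C hC
        rw [hF', mem_insert] at hC
        rcases hC with rfl | hC
        · have e1 := hF.exc A hA
          have e2 := hF.exc B hB
          unfold Exc at e1 e2 ⊢
          rw [hcu]
          nlinarith
        · exact hF.exc C (hsub C hC).1
      · intro C hC
        rw [hF', mem_insert] at hC
        rcases hC with rfl | hC
        · rw [hcu]
          have a1 := hsm A hA
          have a2 := hsm B hB
          have a3 := hpos A hA
          have a4 := hpos B hB
          nlinarith
        · exact hF.sz C (hsub C hC).1
      · intro v hv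
        obtain ⟨C, hC, hvC⟩ := hF.cov v hv
        by_cases h1 : C = A
        · exact ⟨A ∪ B, mem_insert_self _ _, mem_union_left _ (h1 ▸ hvC)⟩
        by_cases h2 : C = B
        · exact ⟨A ∪ B, mem_insert_self _ _, mem_union_right _ (h2 ▸ hvC)⟩
        exact ⟨C, mem_insert_of_mem (mem_erase.2 ⟨h2, mem_erase.2 ⟨h1, hC⟩⟩), hvC⟩
    have hm := hmin F' hnew
    simp only [mu] at hm
    have hc1 : F'.card + 1 ≤ F.card := by
      rw [hF']
      have := card_insert_le (A ∪ B) ((F.erase A).erase B)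
      rw [card_erase_of_mem hBe, card_erase_of_mem hA] at this
      have h3 := card_pos.2 ⟨B, hBe⟩
      rw [card_erase_of_mem hA] at h3
      omega
    have := Nat.mul_le_mul_right (Fintype.card V + 1) hc1
    rw [add_mul] at this
    omega
  refine ⟨F, hF, hno, ?_⟩
  intro A hA w hw
  by_contra hcon
  push Not at hcon
  have hdw := h.hmin w
  have hsd : (N w \ A).card + (N w ∩ A).card = (N w).card := card_sdiff_add_card_inter _ _
  by_cases hwU : ∃ B ∈ F, w ∈ B
  · obtain ⟨B, hB, hwB⟩ := hwU
    obtain ⟨a, ha⟩ := card_pos.1 (by omega : 0 < (N w ∩ A).card)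
    rw [mem_inter] at ha
    exact hno B hB A hA (fun h => hw (h ▸ hwB)) w hwB a ha.2 ha.1
  · push Not at hwU
    have hd : Disjoint A {w} := by simpa using hw
    have hu := exc_union h.sym hd
    rw [eb_singleton h.sym] at hu
    have hcu : (A ∪ {w}).card = A.card + 1 := by rw [card_union_of_disjoint hd]; simp
    have heA : ee N A {w} = (N w ∩ A).card := by
      rw [ee_comm h.sym]; simp [ee]
    set F' := insert (A ∪ {w}) (F.erase A) with hF'
    have hnew : Fam N q F' := by
      constructor
      · have key : ∀ C ∈ F.erase A, Disjoint (A ∪ {w}) C := by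
          intro C hC
          rw [mem_erase] at hC
          rw [disjoint_union_left]
          exact ⟨hF.disj A hA C hC.2 hC.1.symm, by simpa using hwU C hC.2⟩
        intro C hC D hD hCD
        rw [hF', mem_insert] at hC hD
        rcases hC with rfl | hC <;> rcases hD with rfl | hD
        · exact absurd rfl hCD
        · exact key D hD
        · exact (key C hC).symm
        · exact hF.disj C (mem_of_mem_erase hC) D (mem_of_mem_erase hD) hCD
      · intro C hC
        rw [hF', mem_insert] at hC
        rcases hC with rfl | hC
        · exact (hF.ne A hA).mono subset_union_left
        · exact hF.ne C (mem_of_mem_erase hC)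
      · intro C hC
        rw [hF', mem_insert] at hC
        rcases hC with rfl | hC
        · have e1 := hF.exc A hA
          unfold Exc at e1 ⊢
          rw [hcu]
          nlinarith
        · exact hF.exc C (mem_of_mem_erase hC)
      · intro C hC
        rw [hF', mem_insert] at hC
        rcases hC with rfl | hC
        · rw [hcu]
          have a1 := hsm A hA
          have a3 := hpos A hA
          nlinarith
        · exact hF.sz C (mem_of_mem_erase hC)
      · intro v hv
        obtain ⟨C, hC, hvC⟩ := hF.cov v hv
        by_cases h1 : C = A
        · exact ⟨A ∪ {w}, mem_insert_self _ _, mem_union_left _ (h1 ▸ hvC)⟩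
        exact ⟨C, mem_insert_of_mem (mem_erase.2 ⟨h1, hC⟩), hvC⟩
    have hm := hmin F' hnew
    simp only [mu] at hm
    have hc1 : F'.card ≤ F.card := by
      rw [hF']
      have := card_insert_le (A ∪ {w}) (F.erase A)
      rw [card_erase_of_mem hA] at this
      have h3 := card_pos.2 ⟨A, hA⟩
      omega
    have hc2 : (F.biUnion id).card + 1 ≤ (F'.biUnion id).card := by
      have : insert w (F.biUnion id) ⊆ F'.biUnion id := by
        intro x hx
        rw [mem_insert] at hx
        rw [mem_biUnion]
        rcases hx with rfl | hx
        · exact ⟨A ∪ {x}, mem_insert_self _ _, by simp⟩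
        · obtain ⟨C, hC, hxC⟩ := mem_biUnion.1 hx
          by_cases h1 : C = A
          · exact ⟨A ∪ {w}, mem_insert_self _ _, mem_union_left _ (h1 ▸ hxC)⟩
          exact ⟨C, mem_insert_of_mem (mem_erase.2 ⟨h1, hC⟩), hxC⟩
      have := card_le_card this
      rwa [card_insert_of_notMem] at this
      intro hw'
      obtain ⟨C, hC, hxC⟩ := mem_biUnion.1 hw'
      exact hwU C hC hxC
    have hc3 : (F'.biUnion id).card ≤ Fintype.card V := card_le_univ _
    have := Nat.mul_le_mul_right (Fintype.card V + 1) hc1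
    omega

theorem Ctx.case_one {N : V → Finset V} {q t M : ℕ} (h : Ctx N q t M) {F : Finset (Finset V)}
    (hF : Fam N q F) (hsmall : 3 * (q + 1) * (F.biUnion id).card < Fintype.card V) : False := by
  classical
  set U := F.biUnion id with hU
  have hUc : U.card = ∑ A ∈ F, A.card := by
    rw [hU, card_biUnion]
    · rfl
    · intro A hA B hB hAB; exact hF.disj A hA B hB hAB
  let B := F.biUnion (fun A => A.biUnion (fun a => N a ∩ Aᶜ))
  have hB : B.card ≤ (q + 1) * U.card := by
    rw [hUc, mul_sum]
    refine card_biUnion_le.trans (sum_le_sum fun A hA => ?_)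
    refine card_biUnion_le.trans ?_
    have e1 := hF.exc A hA
    have e2 := card_pos.2 (hF.ne A hA)
    unfold Exc at e1
    change ee N A Aᶜ ≤ _
    nlinarith
  let Z := (U ∪ B)ᶜ
  have hZ : Fintype.card V ≤ 2 * Z.card := by
    have h1 : Z.card + (U ∪ B).card = Fintype.card V := by
      rw [add_comm]; exact card_add_card_compl _
    have h2 := card_union_le U B
    have := h.hq
    nlinarith
  have hZU : ∀ z ∈ Z, z ∉ U := by
    intro z hz hzU
    simp [Z, hzU] at hz
  have hZN : ∀ z ∈ Z, ∀ u ∈ U, z ∉ N u := by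
    intro z hz u hu hzu
    have h1 := hZU z hz
    obtain ⟨A, hA, huA⟩ := mem_biUnion.1 hu
    have : z ∈ B := mem_biUnion.2 ⟨A, hA, mem_biUnion.2 ⟨u, huA, mem_inter.2 ⟨hzu, by
      rw [mem_compl]; exact fun hzA => h1 (mem_biUnion.2 ⟨A, hA, hzA⟩)⟩⟩⟩
    simp [Z, this] at hz
  have hT : ∀ v, ∃ T ⊆ N v, v ∉ U → T.card = q + 2 := by
    intro v
    by_cases hv : v ∈ U
    · exact ⟨∅, by simp, fun h => absurd hv h⟩
    · have h1 : q + 2 ≤ (N v).card := by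
        have := h.hmin v
        have : (N v).card ≠ q + 1 := by
          intro h'
          obtain ⟨A, hA, hvA⟩ := hF.cov v h'
          exact hv (mem_biUnion.2 ⟨A, hA, hvA⟩)
        omega
      obtain ⟨T, hT1, hT2⟩ := exists_subset_card_eq h1
      exact ⟨T, hT1, fun _ => hT2⟩
  choose T hTN hTc using hT
  let cnt : V → ℕ := fun z => (Uᶜ.filter (fun v => z ∈ T v)).card
  have hsum : ∑ z, cnt z ≤ (q + 2) * Fintype.card V := by
    have h1 : ∑ z, cnt z = ∑ v ∈ Uᶜ, (T v).card := by
      simp only [cnt, card_filter]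
      rw [sum_comm]
      refine sum_congr rfl fun v _ => ?_
      simp
    rw [h1]
    have h2 : ∑ v ∈ Uᶜ, (T v).card = ∑ v ∈ Uᶜ, (q + 2) :=
      sum_congr rfl fun v hv => hTc v (by simpa using hv)
    rw [h2, sum_const, smul_eq_mul, mul_comm]
    exact Nat.mul_le_mul_left _ (card_le_univ _)
  let Z' := Z.filter (fun z => cnt z ≤ 4 * (q + 2))
  have hZ' : Fintype.card V ≤ 4 * Z'.card := by
    let Zb := Z.filter (fun z => ¬ cnt z ≤ 4 * (q + 2))
    have h1 : Z'.card + Zb.card = Z.card := card_filter_add_card_filter_not _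
    have h2 : Zb.card * (4 * (q + 2)) ≤ ∑ z, cnt z := by
      have : ∑ z ∈ Zb, 4 * (q + 2) ≤ ∑ z ∈ Zb, cnt z :=
        sum_le_sum fun z hz => by
          have := (mem_filter.1 hz).2
          omega
      rw [sum_const, smul_eq_mul] at this
      exact this.trans (sum_le_sum_of_subset (subset_univ _))
    have h3 : Zb.card * 4 ≤ Fintype.card V := by
      have : (q + 2) * (Zb.card * 4) ≤ (q + 2) * Fintype.card V := by
        calc _ = Zb.card * (4 * (q + 2)) := by ring
          _ ≤ _ := h2.trans hsum
      exact Nat.le_of_mul_le_mul_left this (by omega)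
    omega
  let ind : Finset V → Prop := fun S => S ⊆ Z' ∧ ∀ v ∉ U, (T v ∩ S).card ≤ 1
  obtain ⟨S, hS, hSmax⟩ := exists_max_image (univ.filter ind) card ⟨∅, by simp [ind]⟩
  replace hS : ind S := (mem_filter.1 hS).2
  replace hSmax : ∀ S', ind S' → S'.card ≤ S.card := fun S' h' => hSmax S' (by simp [h'])
  have hcover : Z' ⊆ S ∪ S.biUnion (fun s => (Uᶜ.filter (fun v => s ∈ T v)).biUnion T) := by
    intro z hz
    rw [mem_union]
    by_cases hzS : z ∈ S
    · exact Or.inl hzS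
    right
    have h1 : ¬ ind (insert z S) := by
      intro h'
      have := hSmax _ h'
      rw [card_insert_of_notMem hzS] at this
      omega
    have h2 : insert z S ⊆ Z' := by
      intro y hy
      rw [mem_insert] at hy
      rcases hy with rfl | hy
      · exact hz
      · exact hS.1 hy
    have h3 : ∃ v ∉ U, 1 < (T v ∩ insert z S).card := by
      by_contra hc
      push Not at hc
      exact h1 ⟨h2, hc⟩
    obtain ⟨v, hv, hvc⟩ := h3
    have hzT : z ∈ T v := by
      by_contra hzT
      have : T v ∩ insert z S = T v ∩ S := by
        ext y; simp only [mem_inter, mem_insert]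
        constructor
        · rintro ⟨a, rfl | b⟩
          · exact absurd a hzT
          · exact ⟨a, b⟩
        · rintro ⟨a, b⟩; exact ⟨a, Or.inr b⟩
      rw [this] at hvc
      have := hS.2 v hv
      omega
    obtain ⟨s, hs, hsz⟩ := exists_mem_ne hvc z
    rw [mem_inter, mem_insert] at hs
    have hsS : s ∈ S := by
      rcases hs.2 with h' | h'
      · exact absurd h' hsz
      · exact h'
    exact mem_biUnion.2 ⟨s, hsS, mem_biUnion.2 ⟨v, by simp [hv, hs.1], hzT⟩⟩
  have hcard : Z'.card ≤ S.card + S.card * (4 * (q + 2) * (q + 2)) := by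
    refine (card_le_card hcover).trans ((card_union_le _ _).trans (Nat.add_le_add_left ?_ _))
    refine card_biUnion_le_card_mul _ _ _ fun s hs => ?_
    refine (card_biUnion_le_card_mul _ _ (q + 2) ?_).trans (Nat.mul_le_mul_right _ ?_)
    · intro v hv
      have := (mem_filter.1 hv).1
      exact (hTc v (by simpa using this)).le
    · exact (mem_filter.1 (hS.1 hs)).2
  have hSZ : ∀ s ∈ S, s ∈ Z := fun s hs => (mem_filter.1 (hS.1 hs)).1
  have hcl : M * S.card < Fintype.card V := by
    apply h.closed_small
    · intro v hv
      by_cases hvU : v ∈ U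
      · have : N v \ S = N v := by
          rw [Finset.sdiff_eq_self_iff_disjoint, disjoint_left]
          intro y hy hyS
          exact hZN y (hSZ y hyS) v hvU hy
        rw [this]
        exact h.hmin v
      · have h1 : T v \ S ⊆ N v \ S := sdiff_subset_sdiff (hTN v) subset_rfl
        have h2 := card_le_card h1
        have h3 : (T v \ S).card + (T v ∩ S).card = (T v).card := card_sdiff_add_card_inter _ _
        have h4 := hS.2 v hvU
        have h5 := hTc v hvU
        omega
    · by_contra hall
      push Not at hall
      have hv : Nonempty V := Fintype.card_pos_iff.1 (by have := h.hn; omega)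
      obtain ⟨v⟩ := hv
      have hvU := hZU v (hSZ v (hall v))
      have h1 : T v ∩ S = T v := inter_eq_left.2 fun y _ => hall y
      have h2 := hS.2 v hvU
      rw [h1, hTc v hvU] at h2
      omega
  have hM := h.hM1
  have hq := h.hq
  have h1 : 10000 * (q + 1) ^ 2 * S.card < Fintype.card V :=
    lt_of_le_of_lt (Nat.mul_le_mul_right _ hM) hcl
  have h2 : 1 + 4 * (q + 2) * (q + 2) ≤ 10 * (q + 1) ^ 2 := by nlinarith
  have h3 : S.card + S.card * (4 * (q + 2) * (q + 2)) ≤ S.card * (10 * (q + 1) ^ 2) := by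
    calc _ = S.card * (1 + 4 * (q + 2) * (q + 2)) := by ring
      _ ≤ _ := Nat.mul_le_mul_left _ h2
  nlinarith

def InN (N : V → Finset V) (f : V → ℕ) (v : V) : Finset V := (N v).filter (fun u => f u < f v)
def OutN (N : V → Finset V) (f : V → ℕ) (v : V) : Finset V := (N v).filter (fun u => f v < f u)

theorem colour_graph {N : V → Finset V} (hN : Sym N) (q : ℕ) (hmin : ∀ v, q + 1 ≤ (N v).card)
    (f : V → ℕ) (hf : Function.Injective f)
    (W : Finset V) (F : Finset (Finset V)) (hdisj : ∀ A ∈ F, ∀ B ∈ F, A ≠ B → Disjoint A B)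
    (hFW : ∀ A ∈ F, ∀ a ∈ A, a ∉ W)
    (v0 xx : Finset V → V)
    (hv0 : ∀ A ∈ F, v0 A ∈ A) (hv0min : ∀ A ∈ F, ∀ a ∈ A, f (v0 A) ≤ f a)
    (hxW : ∀ A ∈ F, xx A ∈ W) (hxN : ∀ A ∈ F, xx A ∈ N (v0 A))
    (hxf : ∀ A ∈ F, f (xx A) < f (v0 A))
    (hAin : ∀ A ∈ F, ∀ a ∈ A, ∀ z ∈ N a, z ∉ A → f z < f a → a = v0 A ∧ z = xx A)
    (hcl : ∀ A ∈ F, ∀ w ∉ A, q + 1 ≤ (N w \ A).card)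
    (T : V → Finset V) (hT : ∀ w ∈ W, T w ⊆ InN N f w)
    (hTc : ∀ w ∈ W, (T w).card + (OutN N f w).card = q + 2)
    (hout : ∀ w ∈ W, (OutN N f w).card ≤ q)
    (D : Finset V) (hDW : D ⊆ W)
    (hD1 : ∀ v ∉ W, (∀ A ∈ F, v ∉ A) → ∀ z ∈ N v, f z < f v → z ∈ W → z ∈ D)
    (hD2 : ∀ v ∉ W, ∀ A ∈ F, v ∉ A → ∀ z ∈ N v, z ∉ A)
    (hD3 : ∀ w ∈ W, (OutN N f w).card < q → ∀ u ∈ T w, (u ∈ W → u ∈ D) ∧ ∀ A ∈ F, u ∉ A) :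
    ∃ (O : Finset V) (R : Fin (q + 3) → Finset V), O.card ≤ D.card ∧
      (∀ c, ∀ v ∉ R c, q + 1 ≤ (N v \ R c).card) ∧
      (∀ c, ∀ v ∉ W, (∀ A ∈ F, v ∉ A) → v ∉ R c) ∧
      (∀ A ∈ F, v0 A ∈ O ∨ ∃ c, A ⊆ R c) := by
  classical
  have huniq : ∀ A ∈ F, ∀ B ∈ F, ∀ v, v ∈ A → v ∈ B → A = B := by
    intro A hA B hB v h1 h2
    by_contra hne
    exact disjoint_left.1 (hdisj A hA B hB hne) h1 h2
  let mem : V → Finset V := fun v => if h : ∃ A ∈ F, v ∈ A then h.choose else ∅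
  have hmem : ∀ A ∈ F, ∀ v ∈ A, mem v = A := by
    intro A hA v hv
    have h : ∃ A ∈ F, v ∈ A := ⟨A, hA, hv⟩
    simp only [mem, dif_pos h]
    exact huniq _ h.choose_spec.1 A hA v h.choose_spec.2 hv
  let rho : V → V := fun v => if ∃ A ∈ F, v ∈ A then v0 (mem v) else v
  have rho1 : ∀ A ∈ F, ∀ v ∈ A, rho v = v0 A := by
    intro A hA v hv
    have h : ∃ A ∈ F, v ∈ A := ⟨A, hA, hv⟩
    simp only [rho, if_pos h, hmem A hA v hv]
  have rho2 : ∀ v, (∀ A ∈ F, v ∉ A) → rho v = v := by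
    intro v hv
    have h : ¬ ∃ A ∈ F, v ∈ A := by push Not; exact hv
    simp only [rho, if_neg h]
  have rhole : ∀ v, f (rho v) ≤ f v := by
    intro v
    by_cases h : ∃ A ∈ F, v ∈ A
    · obtain ⟨A, hA, hv⟩ := h
      rw [rho1 A hA v hv]
      exact hv0min A hA v hv
    · push Not at h
      rw [rho2 v h]
  have hWno : ∀ w ∈ W, ∀ A ∈ F, w ∉ A := fun w hw A hA hwA => hFW A hA w hwA hw
  have rhoW : ∀ w ∈ W, rho w = w := fun w hw => rho2 w (hWno w hw)
  let isW : V → Prop := fun u => u ∈ W ∧ (OutN N f u).card = q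
  let isA : V → Prop := fun u => ∃ A ∈ F, u = v0 A
  let x : V → V := fun u => xx (mem u)
  have hxe : ∀ A ∈ F, x (v0 A) = xx A := by
    intro A hA
    simp only [x, hmem A hA _ (hv0 A hA)]
  have hisAW : ∀ u, isA u → u ∉ W := by
    rintro u ⟨A, hA, rfl⟩
    exact hFW A hA _ (hv0 A hA)
  let In' : V → Finset V := fun u => (InN N f u).image rho
  have hInlt : ∀ u, isW u → ∀ v ∈ In' u, f v < f u := by
    intro u _ v hv
    obtain ⟨z, hz, rfl⟩ := mem_image.1 hv
    have := (mem_filter.1 hz).2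
    have := rhole z
    omega
  have hsplit : ∀ v, (InN N f v).card + (OutN N f v).card = (N v).card := by
    intro v
    have : OutN N f v = (N v).filter (fun u => ¬ f u < f v) := by
      apply filter_congr
      intro u hu
      have : f u ≠ f v := fun h => hN.irr v (by rw [hf h] at hu; exact hu)
      omega
    rw [this]
    exact card_filter_add_card_filter_not _
  have hIn2 : ∀ u, isW u → ∀ z, ∃ v ∈ In' u, v ≠ z := by
    intro u hu z
    by_contra hcon
    push Not at hcon
    have hz : ∀ v ∈ InN N f u, rho v = z := fun v hv => hcon _ (mem_image_of_mem _ hv)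
    have h2 : 1 < (InN N f u).card := by
      have h1 := card_le_card (hT u hu.1)
      have h2 := hTc u hu.1
      have := hu.2
      omega
    by_cases hex : ∃ v ∈ InN N f u, ∃ A ∈ F, v ∈ A
    · obtain ⟨v, hv, A, hA, hvA⟩ := hex
      have e1 : z = v0 A := by rw [← hz v hv, rho1 A hA v hvA]
      have hsub : InN N f u ⊆ A := by
        intro w hw
        have e2 := hz w hw
        by_cases hwF : ∃ B ∈ F, w ∈ B
        · obtain ⟨B, hB, hwB⟩ := hwF
          rw [rho1 B hB w hwB, e1] at e2
          have := huniq B hB A hA (v0 B) (hv0 B hB) (by rw [e2]; exact hv0 A hA)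
          rw [← this]; exact hwB
        · push Not at hwF
          rw [rho2 w hwF, e1] at e2
          rw [e2]; exact hv0 A hA
      have h3 := hcl A hA u (hWno u hu.1 A hA)
      have h4 : N u \ A ⊆ OutN N f u := by
        intro w hw
        rw [mem_sdiff] at hw
        refine mem_filter.2 ⟨hw.1, ?_⟩
        by_contra hlt
        have : f w ≠ f u := fun h => hN.irr u (by rw [hf h] at hw; exact hw.1)
        exact hw.2 (hsub (mem_filter.2 ⟨hw.1, by omega⟩))
      have h5 := card_le_card h4
      have := hu.2
      omega
    · push Not at hex
      obtain ⟨a, ha, haz⟩ := exists_mem_ne h2 z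
      have := hz a ha
      rw [rho2 a (hex a ha)] at this
      exact haz this
  have hx : ∀ u, isA u → f (x u) < f u ∧ ¬ isA (x u) := by
    rintro u ⟨A, hA, rfl⟩
    rw [hxe A hA]
    exact ⟨hxf A hA, fun h => hisAW _ h (hxW A hA)⟩
  let av : V → Finset V := fun u => (T (x u)).image rho ∪
    (OutN N f (x u)).filter (fun v => isA v ∧ x v = x u ∧ f v < f u)
  have hav : ∀ u, isA u → (∀ v ∈ av u, f v < f u) ∧ (av u).card ≤ q + 1 := by
    intro u hu
    have hfx := (hx u hu).1
    obtain ⟨A, hA, rfl⟩ := id hu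
    have hxw : x (v0 A) ∈ W := by rw [hxe A hA]; exact hxW A hA
    constructor
    · intro v hv
      rcases mem_union.1 hv with hv | hv
      · obtain ⟨z, hz, rfl⟩ := mem_image.1 hv
        have h1 := (mem_filter.1 (hT _ hxw hz)).2
        have := rhole z
        omega
      · exact (mem_filter.1 hv).2.2.2
    · have h1 := card_union_le ((T (x (v0 A))).image rho) ((OutN N f (x (v0 A))).filter
        (fun v => isA v ∧ x v = x (v0 A) ∧ f v < f (v0 A)))
      have h2 : ((T (x (v0 A))).image rho).card ≤ (T (x (v0 A))).card := card_image_le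
      have hin : v0 A ∈ OutN N f (x (v0 A)) := by
        refine mem_filter.2 ⟨hN.symm _ _ ?_, hfx⟩
        rw [hxe A hA]; exact hxN A hA
      have h3 : ((OutN N f (x (v0 A))).filter
        (fun v => isA v ∧ x v = x (v0 A) ∧ f v < f (v0 A))).card ≤
          ((OutN N f (x (v0 A))).erase (v0 A)).card := by
        apply card_le_card
        intro v hv
        rw [mem_filter] at hv
        refine mem_erase.2 ⟨?_, hv.1⟩
        rintro rfl
        have := hv.2.2.2
        omega
      rw [card_erase_of_mem hin] at h3
      have h4 := hTc _ hxw
      have h5 := card_pos.2 ⟨_, hin⟩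
      simp only [av]
      omega
  -- demands
  let od : V → V → V × V := fun a b => if f a < f b then (a, b) else (b, a)
  have hpk : ∀ w, ∃ a b, isW w → a ∈ In' w ∧ b ∈ In' w ∧ a ≠ b := by
    intro w
    by_cases hw : isW w
    · obtain ⟨a, ha, _⟩ := hIn2 w hw w
      obtain ⟨b, hb, hba⟩ := hIn2 w hw a
      exact ⟨a, b, fun _ => ⟨ha, hb, hba.symm⟩⟩
    · exact ⟨w, w, fun h => absurd h hw⟩
  choose pa pb hpab using hpk
  let P : Finset (V × V) := (D.filter isW).image (fun w => od (pa w) (pb w))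
  let B := univ.sup f + 1
  have hB : ∀ u, f u < B := fun u => Nat.lt_succ_of_le (le_sup (f := f) (mem_univ u))
  have hP : ∀ p ∈ P, f p.1 < f p.2 ∧ f p.2 < B := by
    intro p hp
    obtain ⟨w, hw, rfl⟩ := mem_image.1 hp
    refine ⟨?_, hB _⟩
    have hw2 := hpab w (mem_filter.1 hw).2
    have : f (pa w) ≠ f (pb w) := fun h => hw2.2.2 (hf h)
    simp only [od]
    split_ifs with h
    · exact h
    · simp only; omega
  obtain ⟨O, col, hO1, hO2, hcol, hPcol⟩ := colour_aux f hf isW isA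
    (fun u hu hA => hisAW u hA hu.1) In' hInlt hIn2 x hx (q + 1) av hav B P hP
  have c0 : ∀ u, ¬ isW u → ¬ isA u → col u = none := fun u => (hcol u (hB u)).1
  have cW : ∀ u, isW u → ∀ c, col u = some c ↔ ∀ v ∈ In' u, col v = some c :=
    fun u => (hcol u (hB u)).2.1
  have cA := fun u => (hcol u (hB u)).2.2
  have cD : ∀ w ∈ D, col w = none := by
    intro w hw
    by_cases hW : isW w
    · by_contra hne
      obtain ⟨c, hc⟩ := Option.ne_none_iff_exists'.1 hne
      have h1 := (cW w hW c).1 hc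
      have h2 := hpab w hW
      have h3 := hPcol (od (pa w) (pb w)) (mem_image.2 ⟨w, by simp [hw, hW], rfl⟩) c
      apply h3
      simp only [od]
      split_ifs
      · exact ⟨h1 _ h2.1, h1 _ h2.2.1⟩
      · exact ⟨h1 _ h2.2.1, h1 _ h2.1⟩
    · exact c0 w hW (fun hA => hisAW w hA (hDW hw))
  let R : Fin (q + 3) → Finset V := fun c => univ.filter (fun v => col (rho v) = some c)
  have hR : ∀ c v, v ∈ R c ↔ col (rho v) = some c := by intro c v; simp [R]
  have hunc : ∀ c, ∀ v ∉ W, (∀ A ∈ F, v ∉ A) → v ∉ R c := by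
    intro c v hv hvA
    rw [hR, rho2 v hvA, c0 v (fun h => hv h.1)]
    · simp
    · rintro ⟨A, hA, rfl⟩
      exact hvA A hA (hv0 A hA)
  have F1 : ∀ c, ∀ z ∈ W, z ∈ R c → isW z ∧ ∀ v ∈ InN N f z, v ∈ R c := by
    intro c z hz hzR
    rw [hR, rhoW z hz] at hzR
    have hWz : isW z := by
      by_contra hcon
      rw [c0 z hcon (fun h => hisAW z h hz)] at hzR
      simp at hzR
    refine ⟨hWz, fun v hv => ?_⟩
    rw [hR]
    exact (cW z hWz c).1 hzR _ (mem_image_of_mem _ hv)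
  refine ⟨O, R, ?_, ?_, hunc, ?_⟩
  · refine hO1.trans ((card_image_le).trans (card_le_card (filter_subset _ _)))
  · intro c v hv
    by_cases hvW : v ∈ W
    · have hvcol : col v ≠ some c := by rw [hR, rhoW v hvW] at hv; exact hv
      have hOR : ∀ z ∈ OutN N f v, z ∈ R c → col z = some c ∧ col v = none ∧ isA z ∧ x z = v ∧
          (∀ u ∈ av z, col u ≠ some c) := by
        intro z hz hzR
        rw [OutN, mem_filter] at hz
        have hvz : v ∈ N z := hN.symm _ _ hz.1
        by_cases hzW : z ∈ W
        · exact absurd ((F1 c z hzW hzR).2 v (mem_filter.2 ⟨hvz, hz.2⟩)) hv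
        by_cases hzF : ∃ A ∈ F, z ∈ A
        swap
        · push Not at hzF
          exact absurd hzR (hunc c z hzW hzF)
        obtain ⟨A, hA, hzA⟩ := hzF
        obtain ⟨e1, e2⟩ := hAin A hA z hzA v hvz (hWno v hvW A hA) hz.2
        have hisA : isA z := ⟨A, hA, e1⟩
        have hxz : x z = v := by rw [e1, hxe A hA, e2]
        have hcz : col z = some c := by
          rw [hR, rho1 A hA z hzA, ← e1] at hzR; exact hzR
        have hzO : z ∉ O := by
          intro hzO
          have := (hO2 z hzO).2.2.1
          rw [hcz] at this; simp at this
        obtain ⟨c', hc', hc2⟩ := cA z hisA hzO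
        have : c' = c := by rw [hcz] at hc'; exact (Option.some_injective _ hc').symm
        subst this
        rw [hxz] at hc2
        rcases hc2 with hc2 | hc2
        · exact absurd hc2 hvcol
        · exact ⟨hcz, hc2.1, hisA, hxz, hc2.2⟩
      have hIOd : ∀ S ⊆ InN N f v, Disjoint S (OutN N f v) := by
        intro S hS
        rw [disjoint_left]
        intro a ha hb
        have h1 := (mem_filter.1 (hS ha)).2
        have h2 := (mem_filter.1 hb).2
        omega
      by_cases hz : ∃ z ∈ OutN N f v, z ∈ R c
      · obtain ⟨z, hzO, hzR⟩ := hz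
        obtain ⟨a1, a2, a3, a4, a5⟩ := hOR z hzO hzR
        have honly : ∀ z' ∈ OutN N f v, z' ∈ R c → z' = z := by
          intro z' hzO' hzR'
          obtain ⟨b1, b2, b3, b4, b5⟩ := hOR z' hzO' hzR'
          by_contra hne
          have hfne : f z' ≠ f z := fun h => hne (hf h)
          rcases Nat.lt_or_ge (f z') (f z) with hlt | hge
          · refine a5 z' (mem_union_right _ (mem_filter.2 ⟨?_, b3, ?_, hlt⟩)) b1
            · rw [a4]; exact hzO'
            · rw [a4, b4]
          · refine b5 z (mem_union_right _ (mem_filter.2 ⟨?_, a3, ?_, by omega⟩)) a1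
            · rw [b4]; exact hzO
            · rw [a4, b4]
        have hsub : T v ∪ (OutN N f v).erase z ⊆ N v \ R c := by
          intro u hu
          rcases mem_union.1 hu with hu | hu
          · refine mem_sdiff.2 ⟨(mem_filter.1 (hT v hvW hu)).1, ?_⟩
            rw [hR]
            refine a5 _ (mem_union_left _ (mem_image_of_mem _ ?_))
            rw [a4]; exact hu
          · rw [mem_erase] at hu
            exact mem_sdiff.2 ⟨(mem_filter.1 hu.2).1, fun h => hu.1 (honly u hu.2 h)⟩
        have h1 := card_le_card hsub
        rw [card_union_of_disjoint ((hIOd _ (hT v hvW)).mono_right (erase_subset _ _)),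
          card_erase_of_mem hzO] at h1
        have h2 := hTc v hvW
        have h3 := card_pos.2 ⟨_, hzO⟩
        omega
      · push Not at hz
        by_cases hW : isW v
        · have : ∃ u ∈ InN N f v, u ∉ R c := by
            by_contra hcon
            push Not at hcon
            apply hvcol
            rw [cW v hW c]
            intro y hy
            obtain ⟨u, hu, rfl⟩ := mem_image.1 hy
            exact (hR c u).1 (hcon u hu)
          obtain ⟨u, hu, huR⟩ := this
          have hsub : {u} ∪ OutN N f v ⊆ N v \ R c := by
            intro y hy
            rcases mem_union.1 hy with hy | hy
            · rw [mem_singleton] at hy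
              subst hy
              exact mem_sdiff.2 ⟨(mem_filter.1 hu).1, huR⟩
            · exact mem_sdiff.2 ⟨(mem_filter.1 hy).1, hz y hy⟩
          have h1 := card_le_card hsub
          rw [card_union_of_disjoint (hIOd _ (by simpa using hu)), card_singleton, hW.2] at h1
          omega
        · have hlt : (OutN N f v).card < q := by
            have h1 := hout v hvW
            have h2 : (OutN N f v).card ≠ q := fun h => hW ⟨hvW, h⟩
            omega
          have hsub : T v ∪ OutN N f v ⊆ N v \ R c := by
            intro y hy
            rcases mem_union.1 hy with hy | hy
            · refine mem_sdiff.2 ⟨(mem_filter.1 (hT v hvW hy)).1, ?_⟩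
              obtain ⟨g1, g2⟩ := hD3 v hvW hlt y hy
              by_cases hyW : y ∈ W
              · rw [hR, rhoW y hyW, cD y (g1 hyW)]
                simp
              · exact hunc c y hyW g2
            · exact mem_sdiff.2 ⟨(mem_filter.1 hy).1, hz y hy⟩
          have h1 := card_le_card hsub
          rw [card_union_of_disjoint (hIOd _ (hT v hvW))] at h1
          have h2 := hTc v hvW
          omega
    · have : N v \ R c = N v := by
        rw [Finset.sdiff_eq_self_iff_disjoint, disjoint_left]
        intro z hz hzR
        have hvz : v ∈ N z := hN.symm _ _ hz
        have hne : f z ≠ f v := fun h => hN.irr v (by rw [hf h] at hz; exact hz)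
        by_cases hzW : z ∈ W
        · have hlt : f z < f v := by
            by_contra hge
            exact hv ((F1 c z hzW hzR).2 v (mem_filter.2 ⟨hvz, by omega⟩))
          by_cases hvF : ∃ A ∈ F, v ∈ A
          · obtain ⟨A, hA, hvA⟩ := hvF
            obtain ⟨e1, e2⟩ := hAin A hA v hvA z hz (hWno z hzW A hA) hlt
            have hisA : isA v := ⟨A, hA, e1⟩
            have hxz : x v = z := by rw [e1, hxe A hA, e2]
            have hcz : col z = some c := by rw [hR, rhoW z hzW] at hzR; exact hzR
            have hvO : v ∉ O := by
              intro hvO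
              have := (hO2 v hvO).2.2.2
              rw [hxz, hcz] at this
              simp at this
            obtain ⟨c', hc', hc2⟩ := cA v hisA hvO
            rw [hxz, hcz] at hc2
            rcases hc2 with hc2 | hc2
            · apply hv
              rw [hR, rho1 A hA v hvA, ← e1, hc', hc2]
            · simp at hc2
          · push Not at hvF
            have h1 := hD1 v hvW hvF z hz hlt hzW
            rw [hR, rhoW z hzW, cD z h1] at hzR
            simp at hzR
        · by_cases hzF : ∃ A ∈ F, z ∈ A
          swap
          · push Not at hzF
            exact hunc c z hzW hzF hzR
          obtain ⟨A, hA, hzA⟩ := hzF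
          by_cases hvA : v ∈ A
          · apply hv
            rw [hR, rho1 A hA v hvA, ← rho1 A hA z hzA]
            exact (hR c z).1 hzR
          · exact hD2 v hvW A hA hvA z hz hzA
      rw [this]
      exact hmin v
  · intro A hA
    by_cases hO : v0 A ∈ O
    · exact Or.inl hO
    · right
      obtain ⟨c, hc, _⟩ := cA (v0 A) ⟨A, hA, rfl⟩ hO
      refine ⟨c, fun a ha => ?_⟩
      rw [hR, rho1 A hA a ha]
      exact hc

theorem in_out_sum {N : V → Finset V} (hN : Sym N) (f : V → ℕ) (A B : Finset V) :
    ∑ a ∈ A, (OutN N f a ∩ B).card = ∑ b ∈ B, (InN N f b ∩ A).card := by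
  have h1 : ∀ a, (OutN N f a ∩ B).card = ∑ b ∈ B, if b ∈ N a ∧ f a < f b then 1 else 0 := by
    intro a
    rw [← sum_filter, sum_const, smul_eq_mul, mul_one]
    congr 1
    ext b; simp only [OutN, mem_inter, mem_filter]; tauto
  have h2 : ∀ b, (InN N f b ∩ A).card = ∑ a ∈ A, if b ∈ N a ∧ f a < f b then 1 else 0 := by
    intro b
    rw [← sum_filter, sum_const, smul_eq_mul, mul_one]
    congr 1
    ext a; simp only [InN, mem_inter, mem_filter]
    have : a ∈ N b ↔ b ∈ N a := ⟨hN.symm _ _, hN.symm _ _⟩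
    tauto
  simp only [h1, h2]
  exact sum_comm

theorem in_out_inter {N : V → Finset V} (hN : Sym N) {f : V → ℕ} (hf : Function.Injective f)
    (v : V) (B : Finset V) :
    (N v ∩ B).card = (InN N f v ∩ B).card + (OutN N f v ∩ B).card := by
  have h : OutN N f v ∩ B = (N v ∩ B).filter (fun u => ¬ f u < f v) := by
    ext u
    simp only [OutN, mem_inter, mem_filter]
    have : u ∈ N v → f u ≠ f v := fun hu h => hN.irr v (by rw [hf h] at hu; exact hu)
    constructor
    · rintro ⟨⟨a, b⟩, c⟩; exact ⟨⟨a, c⟩, by omega⟩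
    · rintro ⟨⟨a, b⟩, c⟩
      have := this a
      exact ⟨⟨a, by omega⟩, b⟩
  have h' : InN N f v ∩ B = (N v ∩ B).filter (fun u => f u < f v) := by
    ext u
    simp only [InN, mem_inter, mem_filter]
    tauto
  rw [h, h']
  exact (card_filter_add_card_filter_not _).symm

theorem ee_out {N : V → Finset V} (hN : Sym N) {f : V → ℕ} (hf : Function.Injective f)
    (A : Finset V) : ee N A A = 2 * ∑ a ∈ A, (OutN N f a ∩ A).card := by
  unfold ee
  rw [sum_congr rfl (fun a _ => in_out_inter hN hf a A), sum_add_distrib, ← in_out_sum hN f A A]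
  ring

theorem eb_out {N : V → Finset V} (hN : Sym N) {f : V → ℕ} (hf : Function.Injective f)
    (A : Finset V) : ee N A A + 2 * ee N A Aᶜ =
      2 * ∑ a ∈ A, (OutN N f a).card + 2 * ∑ a ∈ A, (InN N f a \ A).card := by
  have h1 : ee N A Aᶜ = ∑ a ∈ A, (InN N f a \ A).card + ∑ a ∈ A, (OutN N f a \ A).card := by
    unfold ee
    rw [sum_congr rfl (fun a _ => in_out_inter hN hf a Aᶜ), sum_add_distrib]
    simp only [sdiff_eq_inter_compl]
  have h2 : ∑ a ∈ A, (OutN N f a).card =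
      ∑ a ∈ A, (OutN N f a ∩ A).card + ∑ a ∈ A, (OutN N f a \ A).card := by
    rw [← sum_add_distrib]
    refine sum_congr rfl fun a _ => ?_
    rw [add_comm, card_sdiff_add_card_inter]
  rw [ee_out hN hf, h1, h2]
  ring

theorem eb_family {N : V → Finset V} (hN : Sym N) (q : ℕ) : ∀ (J : Finset (Finset V)),
    (∀ A ∈ J, ∀ B ∈ J, A ≠ B → Disjoint A B) → (∀ A ∈ J, Exc N q A) →
    ee N (J.biUnion id) (J.biUnion id) + 2 * ee N (J.biUnion id) (J.biUnion id)ᶜ ≤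
      2 * q * (J.biUnion id).card + 2 * J.card := by
  classical
  intro J
  induction J using Finset.induction_on with
  | empty => intro _ _; simp [ee]
  | insert A J hA ih =>
    intro hd he
    have hi := ih (fun B hB C hC => hd B (mem_insert_of_mem hB) C (mem_insert_of_mem hC))
      (fun B hB => he B (mem_insert_of_mem hB))
    have hdis : Disjoint A (J.biUnion id) := by
      rw [disjoint_biUnion_right]
      intro B hB
      exact hd A (mem_insert_self _ _) B (mem_insert_of_mem hB) (fun h => hA (h ▸ hB))
    have hu := exc_union hN hdis
    have heA := he A (mem_insert_self _ _)
    unfold Exc at heA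
    rw [biUnion_insert, id, card_insert_of_notMem hA, card_union_of_disjoint hdis]
    nlinarith

theorem fam_size {M n j : ℕ} (F : Finset (Finset V)) (hs : ∀ A ∈ F, M * A.card < n)
    (hJ : ∀ K ⊆ F, K.card < j → M * (K.biUnion id).card < n) (hj : 1 ≤ j) (r : ℕ) :
    ∀ (p : ℕ) (K : Finset (Finset V)), K ⊆ F → K.card ≤ p * (j - 1) + r →
      M * (K.biUnion id).card ≤ (p + r) * n := by
  classical
  intro p
  induction p with
  | zero =>
    intro K hK hc
    have h1 : (K.biUnion id).card ≤ ∑ A ∈ K, A.card := card_biUnion_le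
    calc M * (K.biUnion id).card ≤ M * ∑ A ∈ K, A.card := Nat.mul_le_mul_left _ h1
      _ = ∑ A ∈ K, M * A.card := mul_sum _ _ _
      _ ≤ ∑ A ∈ K, n := sum_le_sum fun A hA => (hs A (hK hA)).le
      _ = K.card * n := by simp
      _ ≤ (0 + r) * n := Nat.mul_le_mul_right _ (by omega)
  | succ p ih =>
    intro K hK hc
    by_cases hlt : K.card < j
    · have h1 := hJ K hK hlt
      nlinarith
    · obtain ⟨L, hL, hLc⟩ := exists_subset_card_eq (show j - 1 ≤ K.card by omega)
      have h1 := hJ L (hL.trans hK) (by omega)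
      have h2 := ih (K \ L) (sdiff_subset.trans hK) (by
        rw [card_sdiff_of_subset hL]
        rw [add_mul, one_mul] at hc
        omega)
      have h3 : K.biUnion id ⊆ L.biUnion id ∪ (K \ L).biUnion id := by
        rw [← union_biUnion, union_sdiff_of_subset hL]
      have h4 := (card_le_card h3).trans (card_union_le _ _)
      calc M * (K.biUnion id).card ≤ M * ((L.biUnion id).card + ((K \ L).biUnion id).card) :=
            Nat.mul_le_mul_left _ h4
        _ = M * (L.biUnion id).card + M * ((K \ L).biUnion id).card := by ring
        _ ≤ n + (p + r) * n := Nat.add_le_add h1.le h2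
        _ = (p + 1 + r) * n := by ring

theorem Ctx.case_two {N : V → Finset V} {q t M : ℕ} (h : Ctx N q t M) {F : Finset (Finset V)}
    (hF : Fam N q F)
    (hne : ∀ A ∈ F, ∀ B ∈ F, A ≠ B → ∀ a ∈ A, ∀ b ∈ B, b ∉ N a)
    (hcl : ∀ A ∈ F, ∀ w ∉ A, q + 1 ≤ (N w \ A).card)
    (hbig : Fintype.card V ≤ 3 * (q + 1) * (F.biUnion id).card) : False := by
  classical
  set n := Fintype.card V with hn
  set U := F.biUnion id with hU
  have hnpos : 0 < n := by have := h.hn; omega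
  have hq := h.hq
  have hM1 := h.hM1
  have hN := h.sym
  have huniq : ∀ A ∈ F, ∀ B ∈ F, ∀ v, v ∈ A → v ∈ B → A = B := by
    intro A hA B hB v h1 h2
    by_contra hne
    exact disjoint_left.1 (hF.disj A hA B hB hne) h1 h2
  have hmemU : ∀ v, v ∈ U ↔ ∃ A ∈ F, v ∈ A := by intro v; simp [hU]
  have hUno : ¬ HasCore N q U := by
    intro hc
    have h1 := h.hasCore_small hc
    nlinarith
  -- minimal subfamily
  obtain ⟨J, hJ, hJmin⟩ := exists_min_image
    (univ.filter (fun J : Finset (Finset V) => J ⊆ F ∧ ¬ HasCore N q (J.biUnion id))) card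
    ⟨F, by simp only [mem_filter, mem_univ, true_and]; exact ⟨subset_rfl, hUno⟩⟩
  obtain ⟨hJF, hJno⟩ := (mem_filter.1 hJ).2
  have hJsm : ∀ K ⊆ F, K.card < J.card → M * (K.biUnion id).card < n := by
    intro K hK hlt
    apply h.hasCore_small
    by_contra hc
    have := hJmin K (by simp only [mem_filter, mem_univ, true_and]; exact ⟨hK, hc⟩)
    omega
  have hJne : J.Nonempty := by
    rw [nonempty_iff_ne_empty]
    rintro rfl
    apply hJno
    refine ⟨univ, ⟨?_, fun v _ => by simpa using h.hmin v⟩, by simp⟩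
    exact card_pos.1 (by rw [card_univ]; exact hnpos)
  have hj1 : 1 ≤ J.card := card_pos.2 hJne
  set Y := J.biUnion id with hY
  have hmemY : ∀ v, v ∈ Y ↔ ∃ A ∈ J, v ∈ A := by intro v; simp [hY]
  obtain ⟨f, hf, hfY, hfo⟩ := ordering (N := N) q _ Yᶜ rfl
    (fun K hK hc => hJno ⟨K, hc, hK⟩)
  replace hfY : ∀ y ∈ Y, ∀ z ∉ Y, f y < f z := fun y hy z hz => hfY y (by simpa using hy) z
    (by simpa using hz)
  replace hfo : ∀ v ∉ Y, (OutN N f v).card ≤ q := fun v hv => hfo v (by simpa using hv)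
  let s0 : V → ℕ := fun v => q - (OutN N f v).card
  have hs0 : ∀ v ∉ Y, (OutN N f v).card + s0 v = q := by
    intro v hv
    have := hfo v hv
    simp only [s0]; omega
  obtain ⟨S, hSdef⟩ : ∃ S, S = ∑ v ∈ Yᶜ, s0 v := ⟨_, rfl⟩
  have hS : S ≤ J.card + t := by
    have h1 := eb_family hN q J (fun A hA B hB => hF.disj A (hJF hA) B (hJF hB))
      (fun A hA => hF.exc A (hJF hA))
    have h2 : ee N Yᶜ Yᶜ ≤ 2 * ∑ v ∈ Yᶜ, (OutN N f v).card := by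
      rw [ee_out hN hf]
      exact Nat.mul_le_mul_left _ (sum_le_sum fun v _ => card_le_card inter_subset_left)
    have h3 : ∑ v ∈ Yᶜ, (OutN N f v).card + S = q * Yᶜ.card := by
      rw [hSdef, ← sum_add_distrib, sum_congr rfl (fun v hv => hs0 v (by simpa using hv))]
      simp [mul_comm]
    have h4 := h.he
    rw [ee_univ hN Y] at h4
    have h5 : Y.card + Yᶜ.card = Fintype.card V := card_add_card_compl Y
    rw [← h5] at h4
    rw [← hY] at h1
    nlinarith
  have hW : ∀ w, w ∉ U → w ∉ Y := by
    intro w hw hwY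
    obtain ⟨A, hA, hwA⟩ := (hmemY w).1 hwY
    exact hw ((hmemU w).2 ⟨A, hJF hA, hwA⟩)
  have hAY : ∀ A ∈ F \ J, ∀ a ∈ A, a ∉ Y := by
    intro A hA a ha haY
    obtain ⟨B, hB, haB⟩ := (hmemY a).1 haY
    rw [mem_sdiff] at hA
    have := huniq A hA.1 B (hJF hB) a ha haB
    exact hA.2 (this ▸ hB)
  have hAin : ∀ A ∈ F \ J, ∑ a ∈ A, (InN N f a \ A).card ≤ 1 + ∑ a ∈ A, s0 a := by
    intro A hA
    have h1 := hF.exc A (mem_sdiff.1 hA).1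
    unfold Exc at h1
    rw [eb_out hN hf] at h1
    have h3 : ∑ a ∈ A, (OutN N f a).card + ∑ a ∈ A, s0 a = q * A.card := by
      rw [← sum_add_distrib, sum_congr rfl (fun v hv => hs0 v (hAY A hA v hv))]
      simp [mul_comm]
    nlinarith
  have hsplit : ∀ v, (InN N f v).card + (OutN N f v).card = (N v).card := by
    intro v
    have := in_out_inter hN hf v univ
    simpa using this.symm
  let good := (F \ J).filter (fun A => ∑ a ∈ A, s0 a = 0)
  let bad := (F \ J).filter (fun A => ¬ ∑ a ∈ A, s0 a = 0)
  -- structure of good members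
  have hgood : ∀ A, ∃ v x, A ∈ good → v ∈ A ∧ (∀ a ∈ A, f v ≤ f a) ∧ x ∉ U ∧ x ∈ N v ∧
      f x < f v ∧ (∀ a ∈ A, ∀ z ∈ N a, z ∉ A → f z < f a → a = v ∧ z = x) := by
    intro A
    have hVne : Nonempty V := Fintype.card_pos_iff.1 hnpos
    by_cases hA : A ∈ good
    swap
    · exact ⟨hVne.some, hVne.some, fun h => absurd h hA⟩
    obtain ⟨hAJ, hA0⟩ := mem_filter.1 hA
    have hAF : A ∈ F := (mem_sdiff.1 hAJ).1
    have hsum := hAin A hAJ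
    rw [hA0] at hsum
    obtain ⟨v, hv, hvmin⟩ := exists_min_image A f (hF.ne A hAF)
    have hvin : InN N f v \ A = InN N f v := by
      rw [Finset.sdiff_eq_self_iff_disjoint, disjoint_left]
      intro z hz hzA
      have h1 := (mem_filter.1 hz).2
      have h2 := hvmin z hzA
      omega
    have hpos : 1 ≤ (InN N f v).card := by
      have h1 := hsplit v
      have h2 := h.hmin v
      have h3 := hfo v (hAY A hAJ v hv)
      omega
    have hrest := add_sum_erase A (fun a => (InN N f a \ A).card) hv
    simp only [hvin] at hrest
    have hone : (InN N f v).card = 1 := by omega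
    have hzero : ∑ a ∈ A.erase v, (InN N f a \ A).card = 0 := by omega
    rw [sum_eq_zero_iff] at hzero
    obtain ⟨x, hx⟩ := card_eq_one.1 hone
    have hxin : x ∈ InN N f v := by rw [hx]; simp
    have hxin2 := mem_filter.1 hxin
    have hxA : x ∉ A := by
      rw [← hvin] at hxin
      exact (mem_sdiff.1 hxin).2
    refine ⟨v, x, fun _ => ⟨hv, hvmin, ?_, hxin2.1, hxin2.2, ?_⟩⟩
    · intro hxU
      obtain ⟨B, hB, hxB⟩ := (hmemU x).1 hxU
      exact hne A hAF B hB (fun h => hxA (h ▸ hxB)) v hv x hxB hxin2.1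
    · intro a ha z hz hzA hlt
      have hzin : z ∈ InN N f a := mem_filter.2 ⟨hz, hlt⟩
      have hav : a = v := by
        by_contra hav
        have h0 := hzero a (mem_erase.2 ⟨hav, ha⟩)
        rw [card_eq_zero] at h0
        have : z ∈ InN N f a \ A := mem_sdiff.2 ⟨hzin, hzA⟩
        rw [h0] at this
        simp at this
      subst hav
      rw [hx, mem_singleton] at hzin
      exact ⟨rfl, hzin⟩
  choose v0 xx hg using hgood
  have hT : ∀ w, ∃ T ⊆ InN N f w, w ∉ U → T.card = s0 w + 2 := by
    intro w
    by_cases hw : w ∈ U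
    · exact ⟨∅, by simp, fun h => absurd hw h⟩
    · have h1 : s0 w + 2 ≤ (InN N f w).card := by
        have h1 := h.hmin w
        have h2 : (N w).card ≠ q + 1 := by
          intro h'
          obtain ⟨A, hA, hvA⟩ := hF.cov w h'
          exact hw ((hmemU w).2 ⟨A, hA, hvA⟩)
        have h3 := hs0 w (hW w hw)
        have h4 := hsplit w
        omega
      obtain ⟨T, hT1, hT2⟩ := exists_subset_card_eq h1
      exact ⟨T, hT1, fun _ => hT2⟩
  choose T hTin hTc using hT
  let E := Uᶜ.filter (fun w => 1 ≤ s0 w)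
  let DU := E.biUnion T ∪ bad.biUnion (fun A => A.biUnion (fun a => InN N f a \ A))
  have hES : ∑ w ∈ E, s0 w + ∑ A ∈ bad, ∑ a ∈ A, s0 a ≤ S := by
    have h1 : ∑ A ∈ bad, ∑ a ∈ A, s0 a = ∑ a ∈ bad.biUnion id, s0 a := by
      rw [sum_biUnion]
      · rfl
      · intro A hA B hB hAB
        exact hF.disj A (mem_sdiff.1 (mem_filter.1 hA).1).1 B
          (mem_sdiff.1 (mem_filter.1 hB).1).1 hAB
    have hd : Disjoint E (bad.biUnion id) := by
      rw [disjoint_left]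
      intro w hw hwb
      obtain ⟨A, hA, hwA⟩ := mem_biUnion.1 hwb
      have := (mem_filter.1 hw).1
      rw [mem_compl] at this
      exact this ((hmemU w).2 ⟨A, (mem_sdiff.1 (mem_filter.1 hA).1).1, hwA⟩)
    rw [h1, ← sum_union hd, hSdef]
    apply sum_le_sum_of_subset
    intro w hw
    rw [mem_compl]
    rcases mem_union.1 hw with hw | hw
    · have := (mem_filter.1 hw).1
      rw [mem_compl] at this
      exact hW w this
    · obtain ⟨A, hA, hwA⟩ := mem_biUnion.1 hw
      exact hAY A (mem_filter.1 hA).1 w hwA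
  have hbadc : bad.card ≤ ∑ A ∈ bad, ∑ a ∈ A, s0 a := by
    rw [card_eq_sum_ones]
    refine sum_le_sum fun A hA => ?_
    have := (mem_filter.1 hA).2
    omega
  have hDUc : DU.card ≤ 3 * S := by
    have h1 : (E.biUnion T).card ≤ 3 * ∑ w ∈ E, s0 w := by
      rw [mul_sum]
      refine card_biUnion_le.trans (sum_le_sum fun w hw => ?_)
      have hw2 := mem_filter.1 hw
      rw [mem_compl] at hw2
      rw [hTc w hw2.1]
      omega
    have h2 : (bad.biUnion (fun A => A.biUnion (fun a => InN N f a \ A))).card ≤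
        2 * ∑ A ∈ bad, ∑ a ∈ A, s0 a := by
      rw [mul_sum]
      refine card_biUnion_le.trans (sum_le_sum fun A hA => ?_)
      have hA2 := mem_filter.1 hA
      refine card_biUnion_le.trans ((hAin A hA2.1).trans ?_)
      omega
    have h3 := card_union_le (E.biUnion T)
      (bad.biUnion (fun A => A.biUnion (fun a => InN N f a \ A)))
    simp only [DU]
    omega
  let Dem := good.filter (fun A => ∃ a ∈ A, a ∈ DU)
  let Ff := good.filter (fun A => ¬ ∃ a ∈ A, a ∈ DU)
  have hgF : ∀ A ∈ good, A ∈ F := fun A hA => (mem_sdiff.1 (mem_filter.1 hA).1).1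
  have hFfg : ∀ A ∈ Ff, A ∈ good := fun A hA => (mem_filter.1 hA).1
  have hFfF : ∀ A ∈ Ff, A ∈ F := fun A hA => hgF A (hFfg A hA)
  have hDemc : Dem.card ≤ DU.card := by
    have : ∀ A, ∃ a, A ∈ Dem → a ∈ A ∧ a ∈ DU := by
      intro A
      by_cases hA : A ∈ Dem
      · obtain ⟨a, h1, h2⟩ := (mem_filter.1 hA).2
        exact ⟨a, fun _ => ⟨h1, h2⟩⟩
      · exact ⟨v0 A, fun h => absurd h hA⟩
    choose g hgm using this
    refine card_le_card_of_injOn g (fun A hA => (hgm A hA).2) ?_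
    intro A hA B hB hAB
    refine huniq A (hgF A (mem_filter.1 hA).1) B (hgF B (mem_filter.1 hB).1) (g A) (hgm A hA).1 ?_
    rw [hAB]; exact (hgm B hB).1
  let D := DU.filter (fun w => w ∈ Uᶜ) ∪ Dem.image xx
  have hDc : D.card ≤ 6 * S := by
    have h1 := card_union_le (DU.filter (fun w => w ∈ Uᶜ)) (Dem.image xx)
    have h2 : (DU.filter (fun w => w ∈ Uᶜ)).card ≤ DU.card := card_le_card (filter_subset _ _)
    have h3 : (Dem.image xx).card ≤ Dem.card := card_image_le
    simp only [D]
    omega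
  obtain ⟨O, R, hOc, hRcl, hRno, hRA⟩ := colour_graph hN q h.hmin f hf Uᶜ Ff
    (fun A hA B hB => hF.disj A (hFfF A hA) B (hFfF B hB))
    (fun A hA a ha => by
      rw [mem_compl, not_not]; exact (hmemU a).2 ⟨A, hFfF A hA, ha⟩)
    v0 xx (fun A hA => (hg A (hFfg A hA)).1) (fun A hA => (hg A (hFfg A hA)).2.1)
    (fun A hA => by rw [mem_compl]; exact (hg A (hFfg A hA)).2.2.1)
    (fun A hA => (hg A (hFfg A hA)).2.2.2.1)
    (fun A hA => (hg A (hFfg A hA)).2.2.2.2.1)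
    (fun A hA => (hg A (hFfg A hA)).2.2.2.2.2)
    (fun A hA => hcl A (hFfF A hA)) T (fun w _ => hTin w)
    (fun w hw => by
      rw [mem_compl] at hw
      have h1 := hTc w hw
      have h2 := hs0 w (hW w hw)
      omega)
    (fun w hw => by
      rw [mem_compl] at hw
      exact hfo w (hW w hw))
    D (by
      intro w hw
      rcases mem_union.1 hw with hw | hw
      · exact (mem_filter.1 hw).2
      · obtain ⟨A, hA, rfl⟩ := mem_image.1 hw
        rw [mem_compl]; exact (hg A (mem_filter.1 hA).1).2.2.1)
    (by
      intro v hv hvF z hz hlt hzW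
      rw [mem_compl, not_not] at hv
      obtain ⟨A, hA, hvA⟩ := (hmemU v).1 hv
      have hzU := mem_compl.1 hzW
      have hzA : z ∉ A := fun hzA => hzU ((hmemU z).2 ⟨A, hA, hzA⟩)
      by_cases hAJ : A ∈ J
      · have := hfY v ((hmemY v).2 ⟨A, hAJ, hvA⟩) z (hW z hzU)
        omega
      have hAFJ : A ∈ F \ J := mem_sdiff.2 ⟨hA, hAJ⟩
      by_cases hA0 : ∑ a ∈ A, s0 a = 0
      · have hAg : A ∈ good := mem_filter.2 ⟨hAFJ, hA0⟩
        have hADem : A ∈ Dem := by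
          refine mem_filter.2 ⟨hAg, ?_⟩
          by_contra hcon
          exact hvF A (mem_filter.2 ⟨hAg, hcon⟩) hvA
        have := ((hg A hAg).2.2.2.2.2 v hvA z hz hzA hlt).2
        exact mem_union_right _ (mem_image.2 ⟨A, hADem, this.symm⟩)
      · have hAb : A ∈ bad := mem_filter.2 ⟨hAFJ, hA0⟩
        refine mem_union_left _ (mem_filter.2 ⟨mem_union_right _ (mem_biUnion.2 ⟨A, hAb,
          mem_biUnion.2 ⟨v, hvA, mem_sdiff.2 ⟨mem_filter.2 ⟨hz, hlt⟩, hzA⟩⟩⟩), hzW⟩))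
    (by
      intro v hv A hA hvA z hz hzA
      rw [mem_compl, not_not] at hv
      obtain ⟨B, hB, hvB⟩ := (hmemU v).1 hv
      exact hne B hB A (hFfF A hA) (fun h => hvA (h ▸ hvB)) v hvB z hzA hz)
    (by
      intro w hw hlt u hu
      have hwU := mem_compl.1 hw
      have huDU : u ∈ DU := by
        refine mem_union_left _ (mem_biUnion.2 ⟨w, mem_filter.2 ⟨hw, ?_⟩, hu⟩)
        have := hs0 w (hW w hwU)
        omega
      refine ⟨fun huW => mem_union_left _ (mem_filter.2 ⟨huDU, huW⟩), fun A hA huA => ?_⟩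
      exact (mem_filter.1 hA).2 ⟨u, huA, huDU⟩)
  have hRsm : ∀ c, M * (R c).card < n := by
    intro c
    apply h.closed_small (hRcl c)
    obtain ⟨A, hA⟩ := hJne
    obtain ⟨y, hy⟩ := hF.ne A (hJF hA)
    refine ⟨y, hRno c y ?_ ?_⟩
    · rw [mem_compl, not_not]; exact (hmemU y).2 ⟨A, hJF hA, hy⟩
    · intro B hB hyB
      exact hAY B (mem_filter.1 (hFfg B hB)).1 y hyB ((hmemY y).2 ⟨A, hA, hy⟩)
  let FO := Ff.filter (fun A => v0 A ∈ O)
  have hFOc : FO.card ≤ O.card := by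
    refine card_le_card_of_injOn v0 (fun A hA => (mem_filter.1 hA).2) ?_
    intro A hA B hB hAB
    have hA' := (mem_filter.1 hA).1
    have hB' := (mem_filter.1 hB).1
    refine huniq A (hFfF A hA') B (hFfF B hB') (v0 A) (hg A (hFfg A hA')).1 ?_
    rw [hAB]; exact (hg B (hFfg B hB')).1
  let Un := J ∪ bad ∪ Dem ∪ FO
  have hUnF : Un ⊆ F := by
    intro A hA
    rcases mem_union.1 hA with hA | hA
    · rcases mem_union.1 hA with hA | hA
      · rcases mem_union.1 hA with hA | hA
        · exact hJF hA
        · exact (mem_sdiff.1 (mem_filter.1 hA).1).1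
      · exact hgF A (mem_filter.1 hA).1
    · exact hFfF A (mem_filter.1 hA).1
  have hUnc : Un.card ≤ 11 * (J.card - 1) + (11 + 10 * t) := by
    have h1 := card_union_le (J ∪ bad ∪ Dem) FO
    have h2 := card_union_le (J ∪ bad) Dem
    have h3 := card_union_le J bad
    simp only [Un]
    omega
  have hsm : ∀ A ∈ F, M * A.card < n := fun A hA => h.exc_small (hF.exc A hA) (hF.sz A hA)
  have hUnM := fam_size F hsm hJsm hj1 (11 + 10 * t) 11 Un hUnF hUnc
  have hcov : U ⊆ Un.biUnion id ∪ univ.biUnion R := by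
    intro v hv
    obtain ⟨A, hA, hvA⟩ := (hmemU v).1 hv
    by_cases hAU : A ∈ Un
    · exact mem_union_left _ (mem_biUnion.2 ⟨A, hAU, hvA⟩)
    · apply mem_union_right
      simp only [Un, mem_union, not_or] at hAU
      obtain ⟨⟨⟨n1, n2⟩, n3⟩, n4⟩ := hAU
      have hAFJ : A ∈ F \ J := mem_sdiff.2 ⟨hA, n1⟩
      have hAg : A ∈ good := by
        refine mem_filter.2 ⟨hAFJ, ?_⟩
        by_contra hcon
        exact n2 (mem_filter.2 ⟨hAFJ, hcon⟩)
      have hAf : A ∈ Ff := by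
        refine mem_filter.2 ⟨hAg, ?_⟩
        intro hcon
        exact n3 (mem_filter.2 ⟨hAg, hcon⟩)
      rcases hRA A hAf with hO | ⟨c, hc⟩
      · exact absurd (mem_filter.2 ⟨hAf, hO⟩) n4
      · exact mem_biUnion.2 ⟨c, mem_univ _, hc hvA⟩
  have hRM : M * (univ.biUnion R).card ≤ (q + 3) * n := by
    have h1 : (univ.biUnion R).card ≤ ∑ c, (R c).card := card_biUnion_le
    calc M * (univ.biUnion R).card ≤ M * ∑ c, (R c).card := Nat.mul_le_mul_left _ h1
      _ = ∑ c, M * (R c).card := mul_sum _ _ _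
      _ ≤ ∑ _c : Fin (q + 3), n := sum_le_sum fun c _ => (hRsm c).le
      _ = (q + 3) * n := by simp
  have hUc := (card_le_card hcov).trans (card_union_le _ _)
  generalize (Un.biUnion id).card = a at *
  generalize (univ.biUnion R).card = b at *
  have ht1 := h.ht1
  have f1 : 100 * ((q + 1) * a) ≤ 32 * n := by
    have g1 : 100 * (q + 1) * t * a ≤ (11 + (11 + 10 * t)) * n :=
      (Nat.mul_le_mul_right _ h.hM2).trans hUnM
    have g2 : (11 + (11 + 10 * t)) * n ≤ (32 * t) * n := Nat.mul_le_mul_right _ (by omega)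
    have g3 : t * (100 * ((q + 1) * a)) ≤ t * (32 * n) := by
      calc _ = 100 * (q + 1) * t * a := by ring
        _ ≤ _ := g1.trans g2
        _ = _ := by ring
    exact Nat.le_of_mul_le_mul_left g3 (by omega)
  have f2 : 10000 * ((q + 1) * b) ≤ 2 * n := by
    have g1 : 10000 * (q + 1) ^ 2 * b ≤ (q + 3) * n :=
      (Nat.mul_le_mul_right _ hM1).trans hRM
    have g2 : (q + 3) * n ≤ (2 * (q + 1)) * n := Nat.mul_le_mul_right _ (by omega)
    have g3 : (q + 1) * (10000 * ((q + 1) * b)) ≤ (q + 1) * (2 * n) := by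
      calc _ = 10000 * (q + 1) ^ 2 * b := by ring
        _ ≤ _ := g1.trans g2
        _ = _ := by ring
    exact Nat.le_of_mul_le_mul_left g3 (by omega)
  have f3 : n ≤ 3 * ((q + 1) * a) + 3 * ((q + 1) * b) := by
    calc n ≤ 3 * (q + 1) * U.card := hbig
      _ ≤ 3 * (q + 1) * (a + b) := Nat.mul_le_mul_left _ hUc
      _ = _ := by ring
  omega

theorem Ctx.false {N : V → Finset V} {q t M : ℕ} (h : Ctx N q t M) : False := by
  obtain ⟨F, hF, hne, hcl⟩ := h.exists_family
  rcases Nat.lt_or_ge (3 * (q + 1) * (F.biUnion id).card) (Fintype.card V) with hlt | hge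
  · exact h.case_one hF hlt
  · exact h.case_two hF hne hcl hge

theorem reduction (N : V → Finset V) (hN : Sym N) (q t M : ℕ) (hq : 2 ≤ q) (ht1 : 1 ≤ t)
    (ht : 2 * t + 4 ≤ q * (q + 1)) (hn : q ≤ Fintype.card V)
    (he : 2 * q * Fintype.card V ≤ ee N univ univ + 2 * t)
    (hM1 : 10000 * (q + 1) ^ 2 ≤ M) (hM2 : 100 * (q + 1) * t ≤ M) :
    ∃ K X : Finset V, K ⊆ X ∧ IsCore N q K ∧ X.card ≤ M * (X.card - K.card) := by
  classical
  obtain ⟨X, hX, hXmin⟩ := exists_min_image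
    (univ.filter (fun X : Finset V => q ≤ X.card ∧ 2 * q * X.card ≤ ee N X X + 2 * t)) card
    ⟨univ, by simp only [mem_filter, mem_univ, true_and, card_univ]; exact ⟨hn, he⟩⟩
  obtain ⟨hXq, hXe⟩ := (mem_filter.1 hX).2
  replace hXmin : ∀ X' : Finset V, q ≤ X'.card → 2 * q * X'.card ≤ ee N X' X' + 2 * t →
      X.card ≤ X'.card := fun X' h1 h2 => hXmin X' (by
        simp only [mem_filter, mem_univ, true_and]; exact ⟨h1, h2⟩)
  have htriv : ee N X X + X.card ≤ X.card * X.card := by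
    have : ∀ a ∈ X, (N a ∩ X).card + 1 ≤ X.card := by
      intro a ha
      have : N a ∩ X ⊆ X.erase a := by
        intro x hx
        rw [mem_inter] at hx
        exact mem_erase.2 ⟨fun h => hN.irr a (h ▸ hx.1), hx.2⟩
      have := card_le_card this
      rw [card_erase_of_mem ha] at this
      have := card_pos.2 ⟨a, ha⟩
      omega
    have h := sum_le_sum this
    rw [sum_add_distrib] at h
    simpa [ee] using h
  have hX2 : q + 2 ≤ X.card := by
    by_contra hcon
    have : X.card = q ∨ X.card = q + 1 := by omega
    rcases this with h | h <;> rw [h] at hXe htriv <;> nlinarith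
  have hXdeg : ∀ v ∈ X, q + 1 ≤ (N v ∩ X).card := by
    intro v hv
    by_contra hcon
    have h1 := ee_erase hN X v hv
    have h2 : X.card = (X.erase v).card + 1 := by rw [card_erase_of_mem hv]; omega
    have h3 := hXmin (X.erase v) (by omega) (by rw [h2] at hXe; nlinarith)
    omega
  by_contra hno
  push Not at hno
  let N' : {x // x ∈ X} → Finset {x // x ∈ X} := fun x => univ.filter (fun y => y.1 ∈ N x.1)
  have hmap : ∀ (x : {x // x ∈ X}) (K : Finset {x // x ∈ X}),
      (N' x ∩ K).card = (N x.1 ∩ K.map (Function.Embedding.subtype _)).card := by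
    intro x K
    rw [← card_map (Function.Embedding.subtype _)]
    congr 1
    ext y
    simp only [N', mem_map, mem_inter, mem_filter, mem_univ, true_and,
      Function.Embedding.subtype_apply]
    constructor
    · rintro ⟨a, ⟨h1, h2⟩, rfl⟩; exact ⟨h1, a, h2, rfl⟩
    · rintro ⟨h1, a, h2, rfl⟩; exact ⟨a, ⟨h1, h2⟩, rfl⟩
  have huniv : (univ : Finset {x // x ∈ X}).map (Function.Embedding.subtype _) = X := by
    ext y; simp
  have hcardX : Fintype.card {x // x ∈ X} = X.card := Fintype.card_coe X
  have heX : ee N' univ univ = ee N X X := by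
    unfold ee
    simp only [hmap, huniv]
    exact sum_coe_sort X (fun a => (N a ∩ X).card)
  have hctx : Ctx N' q t M := by
    refine ⟨⟨?_, ?_⟩, hq, ht1, ht, ?_, ?_, ?_, hM1, hM2, ?_⟩
    · intro u v huv
      simp only [N', mem_filter, mem_univ, true_and] at huv ⊢
      exact hN.symm _ _ huv
    · intro v hv
      simp only [N', mem_filter, mem_univ, true_and] at hv
      exact hN.irr _ hv
    · rw [hcardX, heX]; exact hXe
    · intro v
      have h1 := hmap v univ
      rw [inter_univ, huniv] at h1
      rw [h1]; exact hXdeg v.1 v.2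
    · rw [hcardX]; exact hX2
    · intro K hK
      have h1 := hno (K.map (Function.Embedding.subtype _)) X (by
        intro y hy
        obtain ⟨a, _, rfl⟩ := mem_map.1 hy
        exact a.2) (by
        refine ⟨hK.1.map, ?_⟩
        intro v hv
        obtain ⟨a, ha, rfl⟩ := mem_map.1 hv
        have := hK.2 a ha
        rw [hmap] at this
        exact this)
      rw [card_map] at h1
      rw [card_compl, hcardX]
      exact h1
  exact hctx.false

end CoreProof

/-- **Main theorem.** Let `k ≥ 2` and `1 ≤ t ≤ (k-2)(k+1)/2 - 1`. Every finite simple graph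
on `n ≥ k-1` vertices with at least `(k-1)n - t` edges contains a non-empty subgraph on at most
`(1 - 1/max(10⁴k², 100kt))·n` vertices in which every vertex has degree at least `k`. -/
theorem min_degree_k_subgraph_of_many_edges {V : Type*} [Fintype V] [DecidableEq V]
    (k t n : ℕ) (hk : 2 ≤ k) (ht1 : 1 ≤ t) (ht2 : t ≤ (k - 2) * (k + 1) / 2 - 1)
    (G : SimpleGraph V) [DecidableRel G.Adj]
    (hn : Fintype.card V = n) (hnk : k - 1 ≤ n)
    (he : (k - 1) * n ≤ G.edgeFinset.card + t) :
    ∃ s : Finset V, s.Nonempty ∧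
      (s.card : ℝ) ≤ (1 - 1 / ((max (10 ^ 4 * k ^ 2) (100 * k * t) : ℕ) : ℝ)) * (n : ℝ) ∧
      ∀ v ∈ s, k ≤ (s.filter (fun u => G.Adj v u)).card := by
  obtain ⟨q, rfl⟩ : ∃ q, k = q + 1 := ⟨k - 1, by omega⟩
  simp only [Nat.add_sub_cancel] at hnk he
  set M := max (10 ^ 4 * (q + 1) ^ 2) (100 * (q + 1) * t) with hM
  have hM1 : 10000 * (q + 1) ^ 2 ≤ M := le_max_left _ _
  have hM2 : 100 * (q + 1) * t ≤ M := le_max_right _ _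
  have ht : 2 * t + 4 ≤ q * (q + 1) := by
    obtain ⟨p, rfl⟩ : ∃ p, q = p + 1 := ⟨q - 1, by omega⟩
    have e : p + 1 + 1 - 2 = p := by omega
    rw [e] at ht2
    have h1 : 2 * (t + 1) ≤ p * (p + 1 + 1 + 1) := by omega
    nlinarith
  have hq : 2 ≤ q := by
    by_contra hc
    have : q = 1 := by omega
    subst this
    omega
  let N : V → Finset V := fun v => G.neighborFinset v
  have hN : CoreProof.Sym N := by
    refine ⟨?_, ?_⟩
    · intro u v h
      simp only [N, SimpleGraph.mem_neighborFinset] at h ⊢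
      exact h.symm
    · intro v h
      simp only [N, SimpleGraph.mem_neighborFinset] at h
      exact G.loopless.irrefl v h
  have hee : CoreProof.ee N Finset.univ Finset.univ = 2 * G.edgeFinset.card := by
    rw [← G.sum_degrees_eq_twice_card_edges]
    simp [CoreProof.ee, N]
  obtain ⟨K, X, hKX, hK, hc⟩ := CoreProof.reduction N hN q t M hq ht1 ht (by omega)
    (by rw [hee, hn, mul_assoc]; omega) hM1 hM2
  refine ⟨K, hK.1, ?_, ?_⟩
  · have hXn : X.card ≤ n := by rw [← hn]; exact Finset.card_le_univ X
    have hKX' := Finset.card_le_card hKX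
    have hMpos : 1 ≤ M := by nlinarith
    have hcR : (X.card : ℝ) ≤ (M : ℝ) * ((X.card : ℝ) - (K.card : ℝ)) := by
      rw [← Nat.cast_sub hKX']
      exact_mod_cast hc
    have hMR : (1 : ℝ) ≤ (M : ℝ) := by exact_mod_cast hMpos
    have hXnR : (X.card : ℝ) ≤ (n : ℝ) := by exact_mod_cast hXn
    have h1 : (X.card : ℝ) / (M : ℝ) ≤ (X.card : ℝ) - (K.card : ℝ) := by
      rw [div_le_iff₀ (by linarith)]
      linarith
    have h2 : (0 : ℝ) ≤ 1 - 1 / (M : ℝ) := by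
      rw [sub_nonneg, div_le_one (by linarith)]
      exact hMR
    calc (K.card : ℝ) ≤ (1 - 1 / (M : ℝ)) * (X.card : ℝ) := by
          rw [sub_mul, one_mul, one_div_mul_eq_div]; linarith
      _ ≤ (1 - 1 / (M : ℝ)) * (n : ℝ) := mul_le_mul_of_nonneg_left hXnR h2
  · intro v hv
    have h1 := hK.2 v hv
    have h2 : K.filter (fun u => G.Adj v u) = N v ∩ K := by
      ext u
      simp only [N, Finset.mem_filter, Finset.mem_inter, SimpleGraph.mem_neighborFinset]
      tauto
    rw [h2]; exact h1
end

section
/- Let k ≥ 2. Every finite simple graph on n ≥ k-1 vertices with at least (k-1)(n-k+2) + C(k-2,2) edges (where C(k-2,2) is the binomial coefficient (k-2 choose 2)) contains a non-empty subgraph with minimum degree at least k. -/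
theorem degsum_erase_aux {V : Type*} [DecidableEq V] (G : SimpleGraph V) [DecidableRel G.Adj]
    (s : Finset V) (v : V) (hv : v ∈ s) :
    ∑ a ∈ s, (s.filter (fun u => G.Adj a u)).card =
      ∑ a ∈ s.erase v, ((s.erase v).filter (fun u => G.Adj a u)).card
        + 2 * (s.filter (fun u => G.Adj v u)).card := by
  simp only [Finset.card_filter]
  have h1 : ∀ a, ∑ u ∈ s, (if G.Adj a u then 1 else 0) =
      (∑ u ∈ s.erase v, if G.Adj a u then 1 else 0) + if G.Adj a v then 1 else 0 :=
    fun a => (Finset.sum_erase_add s _ hv).symm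
  rw [← Finset.sum_erase_add s _ hv, Finset.sum_congr rfl (fun a _ => h1 a),
    Finset.sum_add_distrib]
  have h2 : (∑ a ∈ s.erase v, if G.Adj a v then 1 else 0) =
      ∑ u ∈ s, if G.Adj v u then 1 else 0 := by
    rw [h1 v]
    simp [G.adj_comm]
  rw [h2]
  ring

theorem degsum_le_aux {V : Type*} [DecidableEq V] (G : SimpleGraph V) [DecidableRel G.Adj]
    (m : ℕ) (h : ∀ s : Finset V, s.Nonempty →
      ∃ v ∈ s, (s.filter (fun u => G.Adj v u)).card ≤ m + 1) (j : ℕ) :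
    ∀ s : Finset V, s.card = m + 1 + j →
      ∑ a ∈ s, (s.filter (fun u => G.Adj a u)).card ≤ 2 * (m + 1) * j + (m + 1) * m := by
  induction j with
  | zero =>
    intro s hs
    have : ∀ a ∈ s, (s.filter (fun u => G.Adj a u)).card ≤ m := by
      intro a ha
      have h1 : s.filter (fun u => G.Adj a u) ⊆ s.erase a := by
        intro u hu
        rw [Finset.mem_filter] at hu
        exact Finset.mem_erase.2 ⟨hu.2.ne', hu.1⟩
      have h2 := Finset.card_le_card h1
      rw [Finset.card_erase_of_mem ha] at h2
      omega
    have h3 := Finset.sum_le_card_nsmul s _ m this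
    rw [hs] at h3
    simpa using h3
  | succ j ih =>
    intro s hs
    obtain ⟨v, hv, hd⟩ := h s (Finset.card_pos.1 (by omega))
    have := ih (s.erase v) (by rw [Finset.card_erase_of_mem hv]; omega)
    rw [degsum_erase_aux G s v hv]
    nlinarith

/-- **Fact 1 (Erdős–Faudree–Rousseau–Schelp).** Let `k ≥ 2`. Every finite simple graph on
`n ≥ k-1` vertices with at least `(k-1)(n-k+2) + C(k-2,2)` edges contains a non-empty
subgraph with minimum degree at least `k`. -/
theorem min_degree_k_subgraph_of_edge_count {V : Type*} [Fintype V] [DecidableEq V]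
    (k n : ℕ) (hk : 2 ≤ k)
    (G : SimpleGraph V) [DecidableRel G.Adj]
    (hn : Fintype.card V = n) (hnk : k - 1 ≤ n)
    (he : (k - 1) * (n + 2 - k) + Nat.choose (k - 2) 2 ≤ G.edgeFinset.card) :
    ∃ s : Finset V, s.Nonempty ∧ ∀ v ∈ s, k ≤ (s.filter (fun u => G.Adj v u)).card := by
  by_contra hcon
  push Not at hcon
  obtain ⟨m, rfl⟩ : ∃ m, k = m + 2 := ⟨k - 2, by omega⟩
  obtain ⟨j, rfl⟩ : ∃ j, n = m + 1 + j := ⟨n - (m + 1), by omega⟩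
  have h1 := degsum_le_aux G m (fun s hs => by
    obtain ⟨v, hv, hd⟩ := hcon s hs
    exact ⟨v, hv, by omega⟩) j Finset.univ (by simpa using hn)
  have h2 : ∑ a : V, (Finset.univ.filter (fun u => G.Adj a u)).card
      = 2 * G.edgeFinset.card := by
    rw [← G.sum_degrees_eq_twice_card_edges]
    refine Finset.sum_congr rfl fun a _ => ?_
    rw [← G.card_neighborFinset_eq_degree, G.neighborFinset_eq_filter]
  rw [h2] at h1
  have e1 : m + 2 - 1 = m + 1 := by omega
  have e2 : m + 1 + j + 2 - (m + 2) = j + 1 := by omega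
  have e3 : m + 2 - 2 = m := by omega
  rw [e1, e2, e3] at he
  have h4 : 2 * m.choose 2 + m = m * m := by
    clear * -
    induction m with
    | zero => rfl
    | succ m ih =>
      rw [Nat.choose_succ_succ' m 1, Nat.choose_one_right]
      nlinarith
  nlinarith
end

section
/- Let k ≥ 3. Then every finite simple graph on n ≥ k-1 vertices with at least (k-1)(n-k+2) + C(k-2,2) + 1 edges (where C(k-2,2) is the binomial coefficient (k-2 choose 2)) contains a non-empty subgraph on at most (1 - 1/(10^4·k^3))·n vertices with minimum degree at least k. -/
set_option linter.unusedSectionVars false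
set_option linter.unusedVariables false

namespace EFRS
section Abstract
variable {N : Type*} [Fintype N] [DecidableEq N]

/-- Total weight from a node to a set. -/
def ws (w : N → N → ℕ) (p : N) (A : Finset N) : ℕ := ∑ q ∈ A, w p q

/-- Doubled excess. -/
def XX (w : N → N → ℕ) (c : N → ℕ) (A : Finset N) : ℤ :=
  2 * ∑ p ∈ A, (c p : ℤ) - ∑ p ∈ A, (ws w p A : ℤ)

/-- Closed sets of the bootstrap process. -/
def Clo (w : N → N → ℕ) (c : N → ℕ) (A : Finset N) : Prop :=
  ∀ p, p ∉ A → ws w p A < c p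

theorem ws_insert (w : N → N → ℕ) (p q : N) (A : Finset N) (h : p ∉ A) :
    ws w q (insert p A) = w q p + ws w q A := by
  simp [ws, Finset.sum_insert h]

theorem ws_mono (w : N → N → ℕ) (p : N) {A B : Finset N} (h : A ⊆ B) : ws w p A ≤ ws w p B :=
  Finset.sum_le_sum_of_subset h

theorem ws_sdiff (w : N → N → ℕ) (p : N) {A B : Finset N} (h : A ⊆ B) :
    ws w p (B \ A) + ws w p A = ws w p B := Finset.sum_sdiff h

theorem ws_eq_zero (w : N → N → ℕ) (p : N) (A : Finset N) :
    ws w p A = 0 ↔ ∀ q ∈ A, w p q = 0 := by simp [ws]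

theorem card_le_ws (w : N → N → ℕ) (p : N) (A : Finset N) :
    (A.filter (fun q => 1 ≤ w p q)).card ≤ ws w p A := by
  rw [Finset.card_eq_sum_ones, ws, Finset.sum_filter]
  apply Finset.sum_le_sum
  intro q _
  split_ifs <;> omega

theorem XX_insert (w : N → N → ℕ) (c : N → ℕ) (hs : ∀ p q, w p q = w q p) (h0 : ∀ p, w p p = 0)
    (p : N) (A : Finset N) (h : p ∉ A) :
    XX w c (insert p A) = XX w c A + 2 * (c p : ℤ) - 2 * (ws w p A : ℤ) := by
  have e : ∑ q ∈ A, (ws w q (insert p A) : ℤ) = ws w p A + ∑ q ∈ A, (ws w q A : ℤ) := by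
    have : ∀ q ∈ A, (ws w q (insert p A) : ℤ) = (w p q : ℤ) + ws w q A := by
      intro q _
      rw [ws_insert w p q A h, hs q p]; push_cast; ring
    rw [Finset.sum_congr rfl this, Finset.sum_add_distrib]
    simp [ws]
  unfold XX
  rw [Finset.sum_insert h, Finset.sum_insert h, e, ws_insert w p p A h, h0]
  push_cast; ring

theorem XX_union_le (w : N → N → ℕ) (c : N → ℕ) (hs : ∀ p q, w p q = w q p)
    (h0 : ∀ p, w p p = 0) (A B : Finset N) (h : Disjoint A B) :
    XX w c (A ∪ B) ≤ XX w c A + XX w c B := by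
  induction B using Finset.induction_on with
  | empty => simp [XX]
  | insert p B hp ih =>
    rw [Finset.disjoint_insert_right] at h
    have h1 : p ∉ A ∪ B := by simp [hp, h.1]
    rw [Finset.union_insert, XX_insert w c hs h0 _ _ h1, XX_insert w c hs h0 _ _ hp]
    have := ih h.2
    have := ws_mono w p (Finset.subset_union_right (s₁ := A) (s₂ := B))
    omega

theorem XX_biUnion_le (w : N → N → ℕ) (c : N → ℕ) (hs : ∀ p q, w p q = w q p)
    (h0 : ∀ p, w p p = 0) {L : ℕ} (F : Fin L → Finset N)
    (hd : ∀ a b, a ≠ b → Disjoint (F a) (F b)) (S : Finset (Fin L)) :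
    XX w c (S.biUnion F) ≤ ∑ a ∈ S, XX w c (F a) := by
  induction S using Finset.induction_on with
  | empty => simp [XX]
  | insert a S ha ih =>
    rw [Finset.biUnion_insert, Finset.sum_insert ha]
    refine (XX_union_le w c hs h0 _ _ ?_).trans (by linarith)
    rw [Finset.disjoint_biUnion_right]
    intro b hb
    exact hd a b (by rintro rfl; exact ha hb)

theorem XX_items (w : N → N → ℕ) (c : N → ℕ) (Z : Finset N) (hc : ∀ i ∈ Z, c i = 1) :
    XX w c Z ≤ 2 * (Z.card : ℤ) := by
  unfold XX
  have : ∑ p ∈ Z, (c p : ℤ) = Z.card := by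
    rw [Finset.sum_congr rfl (fun i hi => by rw [hc i hi])]; simp
  rw [this]
  have : 0 ≤ ∑ p ∈ Z, (ws w p Z : ℤ) := Finset.sum_nonneg (fun _ _ => by positivity)
  linarith

/-- Labels. -/
abbrev Lab (L : ℕ) (N : Type*) := Option (Fin L) × Option N

/-- The set generated by `F a` and `i`. -/
def MM {L : ℕ} (Y : Finset N) (lab : N → Lab L N) (a : Fin L) (i : N) : Finset N :=
  Y.filter (fun v => lab v = (some a, none) ∨ lab v = (none, some i) ∨ lab v = (some a, some i))

structure Inv {L : ℕ} (w : N → N → ℕ) (c : N → ℕ) (F : Fin L → Finset N) (Z : Finset N)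
    (k g : ℕ) (Y : Finset N) (lab : N → Lab L N) (B : Finset (Fin L × N)) : Prop where
  seedF : ∀ a v, (v ∈ Y ∧ lab v = (some a, none)) ↔ v ∈ F a
  seedZ : ∀ i v, (v ∈ Y ∧ lab v = (none, some i)) ↔ (v = i ∧ i ∈ Z)
  sep : ∀ a i v, v ∈ Y → lab v = (some a, some i) → ∀ b, b ≠ a → ∀ u ∈ F b, w v u = 0
  ex : ∀ a, ∀ i ∈ Z, XX w c (MM Y lab a i) ≤ XX w c (F a) + 2
  cnt : (B.card : ℤ) ≤ k * (2 * (g : ℤ) + 2 * (Z.card : ℤ) - XX w c Y)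
  good : ∀ a, ∀ i ∈ Z, (a, i) ∉ B → ∀ v ∈ Y, v ∉ MM Y lab a i → ws w v (MM Y lab a i) < c v

variable {L : ℕ} {w : N → N → ℕ} {c : N → ℕ} {F : Fin L → Finset N} {Z : Finset N}
    {k g : ℕ} {Y : Finset N} {lab : N → Lab L N} {B : Finset (Fin L × N)}

theorem mem_MM {a : Fin L} {i v : N} : v ∈ MM Y lab a i ↔ v ∈ Y ∧
    (lab v = (some a, none) ∨ lab v = (none, some i) ∨ lab v = (some a, some i)) := by
  simp [MM]

/-- From weight at least `c p` into `M a i`, there is a neighbour whose first label is `a`. -/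
theorem exists_fst (h : Inv w c F Z k g Y lab B) (hi1 : ∀ i ∈ Z, ∀ p, p ≠ i → w p i < c p)
    {p : N} (hp : p ∉ Y) {a : Fin L} {i : N} (hi : i ∈ Z) (hw : c p ≤ ws w p (MM Y lab a i)) :
    ∃ v ∈ Y, 1 ≤ w p v ∧ (lab v = (some a, none) ∨ lab v = (some a, some i)) := by
  by_contra hcon
  push Not at hcon
  have hiY : i ∈ Y := ((h.seedZ i i).2 ⟨rfl, hi⟩).1
  have hpi : p ≠ i := by rintro rfl; exact hp hiY
  have : ws w p (MM Y lab a i) ≤ ws w p {i} := by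
    unfold ws
    apply Finset.sum_le_sum_of_ne_zero
    intro x hx hne
    rw [mem_MM] at hx
    have := hcon x hx.1 (by omega)
    rcases hx.2 with h1 | h1 | h1
    · exact absurd h1 this.1
    · simpa using ((h.seedZ i x).1 ⟨hx.1, h1⟩).1
    · exact absurd h1 this.2
  have h2 := hi1 i hi p hpi
  simp [ws] at this hw
  omega

theorem exists_snd (h : Inv w c F Z k g Y lab B) (hF : ∀ a, Clo w c (F a))
    {p : N} (hp : p ∉ Y) {a : Fin L} {i : N} (hw : c p ≤ ws w p (MM Y lab a i)) :
    ∃ v ∈ Y, 1 ≤ w p v ∧ (lab v = (none, some i) ∨ lab v = (some a, some i)) := by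
  by_contra hcon
  push Not at hcon
  have hpF : p ∉ F a := fun hh => hp ((h.seedF a p).2 hh).1
  have : ws w p (MM Y lab a i) ≤ ws w p (F a) := by
    unfold ws
    apply Finset.sum_le_sum_of_ne_zero
    intro x hx hne
    rw [mem_MM] at hx
    have := hcon x hx.1 (by omega)
    rcases hx.2 with h1 | h1 | h1
    · exact (h.seedF a x).1 ⟨hx.1, h1⟩
    · exact absurd h1 this.1
    · exact absurd h1 this.2
  have h2 := hF a p hpF
  omega

/-- An item sees directly a node with full label. -/
theorem exists_both (h : Inv w c F Z k g Y lab B) (hi1 : ∀ i ∈ Z, ∀ p, p ≠ i → w p i < c p)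
    (hF : ∀ a, Clo w c (F a))
    {p : N} (hp : p ∉ Y) {a : Fin L} {i : N} (hi : i ∈ Z) (hw : c p ≤ ws w p (MM Y lab a i))
    (hcp : c p = 1) :
    ∃ v ∈ Y, 1 ≤ w p v ∧ lab v = (some a, some i) := by
  obtain ⟨v, hv, hwv, h1 | h1⟩ := exists_fst h hi1 hp hi hw
  · exfalso
    have hpF : p ∉ F a := fun hh => hp ((h.seedF a p).2 hh).1
    have h2 := hF a p hpF
    have h3 : ws w p (F a) = 0 := by omega
    have := (ws_eq_zero w p _).1 h3 v ((h.seedF a v).1 ⟨hv, h1⟩)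
    omega
  · exact ⟨v, hv, hwv, h1⟩

theorem uniq (h : Inv w c F Z k g Y lab B) (hi1 : ∀ i ∈ Z, ∀ p, p ≠ i → w p i < c p)
    (hF : ∀ a, Clo w c (F a)) {p : N} (hp : p ∉ Y)
    {a a' : Fin L} {i i' : N} (hi : i ∈ Z)
    (hw : c p ≤ ws w p (MM Y lab a i))
    (h2 : ∀ v ∈ Y, v ∉ MM Y lab a' i' → w p v = 0) : a = a' ∧ i = i' := by
  constructor
  · obtain ⟨v, hv, hwv, hl⟩ := exists_fst h hi1 hp hi hw
    by_contra hne
    have := h2 v hv (by rw [mem_MM]; rcases hl with hl | hl <;> simp [hl, hne])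
    omega
  · obtain ⟨v, hv, hwv, hl⟩ := exists_snd h hF hp hw
    by_contra hne
    have := h2 v hv (by rw [mem_MM]; rcases hl with hl | hl <;> simp [hl, hne])
    omega

/-- The newly violated pairs. -/
def newB (w : N → N → ℕ) (c : N → ℕ) (Z Y : Finset N) (lab : N → Lab L N) (p : N) :
    Finset (Fin L × N) :=
  (Finset.univ ×ˢ Z).filter (fun x => c p ≤ ws w p (MM Y lab x.1 x.2) ∧
    1 ≤ ws w p (Y \ MM Y lab x.1 x.2))

theorem newB_card (h : Inv w c F Z k g Y lab B) (hi1 : ∀ i ∈ Z, ∀ p, p ≠ i → w p i < c p)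
    (hF : ∀ a, Clo w c (F a)) {p : N} (hp : p ∉ Y) (hk : 1 ≤ k)
    (hδ : c p = 1 ∨ ws w p Finset.univ + 1 ≤ c p + k) (hpY : c p ≤ ws w p Y) :
    (newB w c Z Y lab p).card + 2 * k * c p ≤ 2 * k * ws w p Y := by
  obtain ⟨δ, hδe⟩ := Nat.exists_eq_add_of_le hpY
  rw [hδe, Nat.mul_add, add_comm]
  refine Nat.add_le_add_left ?_ _
  rcases (newB w c Z Y lab p).eq_empty_or_nonempty with he | ⟨⟨a0, i0⟩, hb⟩
  · simp [he]
  have hb' := hb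
  simp only [newB, Finset.mem_filter, Finset.mem_product, Finset.mem_univ, true_and] at hb'
  obtain ⟨hi0, hw0, ho⟩ := hb'
  set M0 := MM Y lab a0 i0 with hM0
  have hsub : M0 ⊆ Y := Finset.filter_subset _ _
  have hsum := ws_sdiff w p hsub
  set T := (Y \ M0).filter (fun q => 1 ≤ w p q) with hT
  have hTc : T.card ≤ δ := (card_le_ws w p _).trans (by omega)
  have hδ1 : 1 ≤ δ := by omega
  rcases hδ with hc1 | hd
  · have hc2 : (newB w c Z Y lab p).card ≤ 1 + δ := by
      have : ((newB w c Z Y lab p).image (fun x => ((some x.1, some x.2) : Lab L N))) ⊆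
          insert (some a0, some i0) (T.image lab) := by
        intro y hy
        rw [Finset.mem_image] at hy
        obtain ⟨⟨a, i⟩, hx, rfl⟩ := hy
        simp only [newB, Finset.mem_filter, Finset.mem_product, Finset.mem_univ, true_and] at hx
        obtain ⟨v, hv, hwv, hl⟩ := exists_both h hi1 hF hp hx.1 hx.2.1 hc1
        rw [Finset.mem_insert]
        by_cases hai : a = a0 ∧ i = i0
        · left; simp [hai]
        · right
          rw [Finset.mem_image]
          refine ⟨v, ?_, hl⟩
          rw [hT, Finset.mem_filter, Finset.mem_sdiff, hM0, mem_MM]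
          refine ⟨⟨hv, ?_⟩, hwv⟩
          rw [hl]; simp; intro _ h1 h2; exact hai ⟨h1, h2⟩
      have h3 := Finset.card_le_card this
      rw [Finset.card_image_of_injective _ (by
        rintro ⟨a, b⟩ ⟨a', b'⟩ hh; simpa using hh)] at h3
      have h4 := Finset.card_insert_le ((some a0, some i0) : Lab L N) (T.image lab)
      have h5 := Finset.card_image_le (s := T) (f := lab)
      omega
    nlinarith
  · have hdk : δ + 1 ≤ k := by
      have := ws_mono w p (Finset.subset_univ Y)
      omega
    have hc2 : (newB w c Z Y lab p).card ≤ (1 + δ) * (1 + δ) := by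
      have : ((newB w c Z Y lab p).image (fun x => ((some x.1, some x.2) : Lab L N))) ⊆
          (insert (some a0) (T.image (fun v => (lab v).1))) ×ˢ
          (insert (some i0) (T.image (fun v => (lab v).2))) := by
        intro y hy
        rw [Finset.mem_image] at hy
        obtain ⟨⟨a, i⟩, hx, rfl⟩ := hy
        simp only [newB, Finset.mem_filter, Finset.mem_product, Finset.mem_univ, true_and] at hx
        rw [Finset.mem_product, Finset.mem_insert, Finset.mem_insert]
        constructor
        · by_cases hai : a = a0
          · left; simp [hai]
          · right
            obtain ⟨v, hv, hwv, hl⟩ := exists_fst h hi1 hp hx.1 hx.2.1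
            rw [Finset.mem_image]
            refine ⟨v, ?_, by rcases hl with hl | hl <;> simp [hl]⟩
            rw [hT, Finset.mem_filter, Finset.mem_sdiff, hM0, mem_MM]
            refine ⟨⟨hv, ?_⟩, hwv⟩
            rcases hl with hl | hl <;> simp [hl, hai]
        · by_cases hai : i = i0
          · left; simp [hai]
          · right
            obtain ⟨v, hv, hwv, hl⟩ := exists_snd h hF hp hx.2.1
            rw [Finset.mem_image]
            refine ⟨v, ?_, by rcases hl with hl | hl <;> simp [hl]⟩
            rw [hT, Finset.mem_filter, Finset.mem_sdiff, hM0, mem_MM]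
            refine ⟨⟨hv, ?_⟩, hwv⟩
            rcases hl with hl | hl <;> simp [hl, hai]
      have h3 := Finset.card_le_card this
      rw [Finset.card_image_of_injective _ (by
        rintro ⟨a, b⟩ ⟨a', b'⟩ hh; simpa using hh), Finset.card_product] at h3
      refine h3.trans (Nat.mul_le_mul ?_ ?_)
      · have h4 := Finset.card_insert_le (some a0) (T.image (fun v => (lab v).1))
        have h5 := Finset.card_image_le (s := T) (f := fun v => (lab v).1)
        omega
      · have h4 := Finset.card_insert_le (some i0) (T.image (fun v => (lab v).2))
        have h5 := Finset.card_image_le (s := T) (f := fun v => (lab v).2)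
        omega
    nlinarith

end Abstract
end EFRS

namespace EFRS
section Abstract2
variable {N : Type*} [Fintype N] [DecidableEq N]
variable {L : ℕ} {w : N → N → ℕ} {c : N → ℕ} {F : Fin L → Finset N} {Z : Finset N}
    {k g : ℕ} {Y : Finset N} {lab : N → Lab L N} {B : Finset (Fin L × N)}

theorem MM_new_full {p : N} (hp : p ∉ Y) (a : Fin L) (i : N) :
    MM (insert p Y) (Function.update lab p (some a, some i)) a i = insert p (MM Y lab a i) := by
  ext v
  rw [Finset.mem_insert, mem_MM, mem_MM, Finset.mem_insert]
  by_cases hv : v = p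
  · subst hv; simp
  · simp [hv]

theorem MM_new_other {p : N} (hp : p ∉ Y) (a : Fin L) (i : N) (l : Lab L N)
    (hl : l ≠ (some a, some i)) (h2 : l = (none, none) ∨ ∃ b j, l = (some b, some j)) :
    MM (insert p Y) (Function.update lab p l) a i = MM Y lab a i := by
  ext v
  rw [mem_MM, mem_MM, Finset.mem_insert]
  by_cases hv : v = p
  · subst hv
    rcases h2 with rfl | ⟨b, j, rfl⟩
    · simp [hp]
    · simp at hl; simp [hp]; exact hl
  · simp [hv]

theorem inv_step_gen (h : Inv w c F Z k g Y lab B) (hs : ∀ p q, w p q = w q p)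
    (h0 : ∀ p, w p p = 0) (hc : ∀ p, 1 ≤ c p)
    (hi1 : ∀ i ∈ Z, ∀ p, p ≠ i → w p i < c p)
    (hF : ∀ a, Clo w c (F a)) {p : N} (hp : p ∉ Y) (hk : 1 ≤ k)
    (hδ : c p = 1 ∨ ws w p Finset.univ + 1 ≤ c p + k) (hpY : c p ≤ ws w p Y) (l : Lab L N)
    (hl : (l = (none, none) ∧ ∀ a, ∀ i ∈ Z, ¬ (∀ v ∈ Y, v ∉ MM Y lab a i → w p v = 0)) ∨
      ∃ a i, i ∈ Z ∧ l = (some a, some i) ∧ (∀ v ∈ Y, v ∉ MM Y lab a i → w p v = 0)) :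
    Inv w c F Z k g (insert p Y) (Function.update lab p l) (B ∪ newB w c Z Y lab p) := by
  have hl2 : l = (none, none) ∨ ∃ b j, l = (some b, some j) := by
    rcases hl with ⟨h1, _⟩ | ⟨a, i, _, h1, _⟩
    · exact Or.inl h1
    · exact Or.inr ⟨a, i, h1⟩
  have hMsub : ∀ a i, MM Y lab a i ⊆ Y := fun a i => Finset.filter_subset _ _
  have hpM : ∀ a i, p ∉ MM Y lab a i := fun a i hh => hp (hMsub a i hh)
  have hzero : ∀ a i, (∀ v ∈ Y, v ∉ MM Y lab a i → w p v = 0) →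
      ws w p (MM Y lab a i) = ws w p Y := by
    intro a i hh
    rw [← ws_sdiff w p (hMsub a i), (ws_eq_zero w p (Y \ MM Y lab a i)).2, zero_add]
    intro q hq
    rw [Finset.mem_sdiff] at hq
    exact hh q hq.1 hq.2
  have hne : ∀ v ∈ Y, v ≠ p := fun v hv e => hp (e ▸ hv)
  refine ⟨?_, ?_, ?_, ?_, ?_, ?_⟩
  · intro a v
    rw [← h.seedF a v, Finset.mem_insert]
    by_cases hv : v = p
    · subst hv
      rcases hl2 with rfl | ⟨b, j, rfl⟩ <;> simp [hp]
    · simp [hv]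
  · intro i v
    rw [← h.seedZ i v, Finset.mem_insert]
    by_cases hv : v = p
    · subst hv
      rcases hl2 with rfl | ⟨b, j, rfl⟩ <;> simp [hp]
    · simp [hv]
  · intro a i v hv hlv b hb u hu
    by_cases hvp : v = p
    · subst hvp
      simp only [Function.update_self] at hlv
      subst hlv
      rcases hl with ⟨h1, _⟩ | ⟨a', i', _, h1, h2⟩
      · simp at h1
      · simp only [Prod.mk.injEq, Option.some.injEq] at h1
        obtain ⟨rfl, rfl⟩ := h1
        obtain ⟨hu1, hu2⟩ := (h.seedF b u).2 hu
        refine h2 u hu1 ?_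
        rw [mem_MM, hu2]; simp [hb]
    · rw [Function.update_of_ne hvp] at hlv
      exact h.sep a i v (by simpa [hvp] using hv) hlv b hb u hu
  · intro a i hi
    by_cases hla : l = (some a, some i)
    · subst hla
      rw [MM_new_full hp, XX_insert w c hs h0 _ _ (hpM a i)]
      rcases hl with ⟨h1, _⟩ | ⟨a', i', _, h1, h2⟩
      · simp at h1
      · simp only [Prod.mk.injEq, Option.some.injEq] at h1
        obtain ⟨rfl, rfl⟩ := h1
        rw [hzero a i h2]
        have := h.ex a i hi
        have : (c p : ℤ) ≤ ws w p Y := by exact_mod_cast hpY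
        linarith
    · rw [MM_new_other hp a i l hla hl2]
      exact h.ex a i hi
  · rw [XX_insert w c hs h0 _ _ hp]
    have h1 := newB_card (Z := Z) h hi1 hF hp hk hδ hpY
    have h2 := Finset.card_union_le B (newB w c Z Y lab p)
    have h3 := h.cnt
    zify at h1 h2
    nlinarith
  · intro a i hi hB v hv hvM
    rw [Finset.mem_union, not_or] at hB
    by_cases hla : l = (some a, some i)
    · subst hla
      rw [MM_new_full hp] at hvM ⊢
      rw [Finset.mem_insert, not_or] at hvM
      have hvY : v ∈ Y := by simpa [hvM.1] using hv
      rw [ws_insert _ _ _ _ (hpM a i)]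
      rcases hl with ⟨h1, _⟩ | ⟨a', i', _, h1, h2⟩
      · simp at h1
      · simp only [Prod.mk.injEq, Option.some.injEq] at h1
        obtain ⟨rfl, rfl⟩ := h1
        rw [hs v p, h2 v hvY hvM.2, zero_add]
        exact h.good a i hi hB.1 v hvY hvM.2
    · rw [MM_new_other hp a i l hla hl2] at hvM ⊢
      by_cases hvp : v = p
      · subst hvp
        by_contra hcon
        push Not at hcon
        have h3 : ∀ u ∈ Y, u ∉ MM Y lab a i → w v u = 0 := by
          have := hB.2
          simp only [newB, Finset.mem_filter, Finset.mem_product, Finset.mem_univ, true_and,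
            not_and] at this
          have h4 : ws w v (Y \ MM Y lab a i) = 0 := by
            have := this hi hcon; omega
          intro u hu huM
          exact (ws_eq_zero w v _).1 h4 u (by simp [hu, huM])
        rcases hl with ⟨h1, h2⟩ | ⟨a', i', _, h1, h2⟩
        · exact h2 a i hi h3
        · obtain ⟨rfl, rfl⟩ := uniq h hi1 hF hp hi hcon h2
          exact hla h1
      · exact h.good a i hi hB.1 v (by simpa [hvp] using hv) hvM

theorem inv_step (h : Inv w c F Z k g Y lab B) (hs : ∀ p q, w p q = w q p)
    (h0 : ∀ p, w p p = 0) (hc : ∀ p, 1 ≤ c p)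
    (hi1 : ∀ i ∈ Z, ∀ p, p ≠ i → w p i < c p)
    (hF : ∀ a, Clo w c (F a)) {p : N} (hp : p ∉ Y) (hk : 1 ≤ k)
    (hδ : c p = 1 ∨ ws w p Finset.univ + 1 ≤ c p + k) (hpY : c p ≤ ws w p Y) :
    ∃ lab' B', Inv w c F Z k g (insert p Y) lab' B' := by
  by_cases hx : ∃ a i, i ∈ Z ∧ (∀ v ∈ Y, v ∉ MM Y lab a i → w p v = 0)
  · obtain ⟨a, i, hi, h2⟩ := hx
    exact ⟨_, _, inv_step_gen h hs h0 hc hi1 hF hp hk hδ hpY (some a, some i)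
      (Or.inr ⟨a, i, hi, rfl, h2⟩)⟩
  · refine ⟨_, _, inv_step_gen h hs h0 hc hi1 hF hp hk hδ hpY (none, none)
      (Or.inl ⟨rfl, ?_⟩)⟩
    intro a i hi h2
    exact hx ⟨a, i, hi, h2⟩

theorem inv_init (hs : ∀ p q, w p q = w q p)
    (h0 : ∀ p, w p p = 0)
    (hi1 : ∀ i ∈ Z, ∀ p, p ≠ i → w p i < c p) (hcZ : ∀ i ∈ Z, c i = 1)
    (hF : ∀ a, Clo w c (F a)) (hd : ∀ a b, a ≠ b → Disjoint (F a) (F b))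
    (hw : ∀ a b, a ≠ b → ∀ u ∈ F a, ∀ v ∈ F b, w u v = 0)
    (hZF : ∀ i ∈ Z, ∀ a, i ∉ F a) (hg : ∑ a, XX w c (F a) ≤ 2 * (g : ℤ)) :
    ∃ Y lab, Inv w c F Z k g Y lab (∅ : Finset (Fin L × N)) := by
  classical
  let Φ := Finset.univ.biUnion F
  have hΦ : ∀ v, v ∈ Φ ↔ ∃ a, v ∈ F a := by intro v; simp [Φ]
  have hΦZ : Disjoint Φ Z := by
    rw [Finset.disjoint_left]
    intro v hv hz
    obtain ⟨a, ha⟩ := (hΦ v).1 hv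
    exact hZF v hz a ha
  let lab : N → Lab L N := fun v =>
    if hv : ∃ a, v ∈ F a then (some hv.choose, none) else (none, some v)
  have huniq : ∀ v a b, v ∈ F a → v ∈ F b → a = b := by
    intro v a b ha hb
    by_contra hne
    exact Finset.disjoint_left.1 (hd a b hne) ha hb
  have hl1 : ∀ v a, v ∈ F a → lab v = (some a, none) := by
    intro v a ha
    have hv : ∃ a, v ∈ F a := ⟨a, ha⟩
    simp only [lab, dif_pos hv]
    rw [huniq v _ a hv.choose_spec ha]
  have hl2 : ∀ v, (¬ ∃ a, v ∈ F a) → lab v = (none, some v) := by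
    intro v hv
    simp only [lab, dif_neg hv]
  have hZl : ∀ i ∈ Z, lab i = (none, some i) := by
    intro i hi
    exact hl2 i (by rintro ⟨a, ha⟩; exact hZF i hi a ha)
  have hMM : ∀ a, ∀ i ∈ Z, MM (Φ ∪ Z) lab a i = insert i (F a) := by
    intro a i hi
    ext v
    rw [mem_MM, Finset.mem_insert, Finset.mem_union, hΦ]
    by_cases hv : ∃ b, v ∈ F b
    · obtain ⟨b, hb⟩ := hv
      rw [hl1 v b hb]
      simp
      constructor
      · rintro ⟨_, rfl⟩; exact Or.inr hb
      · rintro (rfl | h)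
        · exact absurd hb (hZF _ hi b)
        · exact ⟨Or.inl ⟨b, hb⟩, huniq v b a hb h⟩
    · rw [hl2 v hv]
      simp [hv]
      constructor
      · rintro ⟨_, rfl⟩; exact Or.inl rfl
      · rintro (rfl | h)
        · exact ⟨hi, rfl⟩
        · exact absurd ⟨a, h⟩ hv
  refine ⟨Φ ∪ Z, lab, ?_, ?_, ?_, ?_, ?_, ?_⟩
  · intro a v
    constructor
    · rintro ⟨hv, hlv⟩
      by_cases hh : ∃ b, v ∈ F b
      · obtain ⟨b, hb⟩ := hh
        rw [hl1 v b hb] at hlv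
        simp at hlv; exact hlv ▸ hb
      · rw [hl2 v hh] at hlv; simp at hlv
    · intro hv
      exact ⟨Finset.mem_union_left _ ((hΦ v).2 ⟨a, hv⟩), hl1 v a hv⟩
  · intro i v
    constructor
    · rintro ⟨hv, hlv⟩
      by_cases hh : ∃ b, v ∈ F b
      · obtain ⟨b, hb⟩ := hh
        rw [hl1 v b hb] at hlv
        simp at hlv
      · rw [hl2 v hh] at hlv; simp at hlv
        subst hlv
        refine ⟨rfl, ?_⟩
        rw [Finset.mem_union, hΦ] at hv
        exact hv.resolve_left hh
    · rintro ⟨rfl, hi⟩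
      exact ⟨Finset.mem_union_right _ hi, hZl v hi⟩
  · intro a i v _ hlv
    by_cases hh : ∃ b, v ∈ F b
    · obtain ⟨b, hb⟩ := hh
      rw [hl1 v b hb] at hlv
      simp at hlv
    · rw [hl2 v hh] at hlv; simp at hlv
  · intro a i hi
    rw [hMM a i hi, XX_insert w c hs h0 _ _ (hZF i hi a), hcZ i hi]
    push_cast
    have : (0:ℤ) ≤ ws w i (F a) := by positivity
    linarith
  · have h1 := XX_union_le w c hs h0 Φ Z hΦZ
    have h2 := XX_biUnion_le w c hs h0 F hd Finset.univ
    have h3 := XX_items w c Z hcZ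
    have : (0:ℤ) ≤ 2 * (g : ℤ) + 2 * (Z.card : ℤ) - XX w c (Φ ∪ Z) := by linarith
    simp only [Finset.card_empty]
    positivity
  · intro a i hi _ v hv hvM
    rw [hMM a i hi] at hvM ⊢
    rw [Finset.mem_insert, not_or] at hvM
    rw [ws_insert _ _ _ _ (hZF i hi a)]
    by_cases hh : ∃ b, v ∈ F b
    · obtain ⟨b, hb⟩ := hh
      have hba : b ≠ a := by rintro rfl; exact hvM.2 hb
      have : ws w v (F a) = 0 := (ws_eq_zero _ _ _).2 (fun q hq => hw b a hba v hb q hq)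
      rw [this, add_zero]
      exact hi1 i hi v hvM.1
    · rw [Finset.mem_union, hΦ] at hv
      have hvZ := hv.resolve_left hh
      have h1 := hF a v hvM.2
      have h2 := hi1 i hi v hvM.1
      rw [hcZ v hvZ] at h1 h2 ⊢
      omega

end Abstract2
end EFRS

namespace EFRS
section Abstract3
variable {N : Type*} [Fintype N] [DecidableEq N]
variable {L : ℕ} {w : N → N → ℕ} {c : N → ℕ} {F : Fin L → Finset N} {Z I J : Finset N}
    {k t : ℕ}

structure Conf (w : N → N → ℕ) (c : N → ℕ) (I J : Finset N) (F : Fin L → Finset N) : Prop where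
  clo : ∀ a, Clo w c (F a)
  disj : ∀ a b, a ≠ b → Disjoint (F a) (F b)
  sep : ∀ a b, a ≠ b → ∀ u ∈ F a, ∀ v ∈ F b, w u v = 0
  exs : ∑ a, XX w c (F a) ≤ 2 * (J.card : ℤ)
  JI : J ⊆ I
  JF : ∀ j ∈ J, ∃ a, j ∈ F a
  miss : ∀ a, ∃ i ∈ I, i ∉ F a

theorem conf_init (hc : ∀ p, 1 ≤ c p) (hI : I.Nonempty) :
    Conf w c I ∅ (fun _ : Fin L => (∅ : Finset N)) := by
  refine ⟨?_, by simp, by simp, by simp [XX], by simp, by simp, ?_⟩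
  · intro a p _
    have := hc p
    simp [ws]; omega
  · intro a
    obtain ⟨i, hi⟩ := hI
    exact ⟨i, hi, by simp⟩

theorem conf_step {F : Fin (4 * k) → Finset N} (h : Conf w c I J F)
    (hs : ∀ p q, w p q = w q p)
    (h0 : ∀ p, w p p = 0) (hc : ∀ p, 1 ≤ c p)
    (hi1 : ∀ i ∈ I, ∀ p, p ≠ i → w p i < c p) (hcI : ∀ i ∈ I, c i = 1) (hk : 1 ≤ k) (ht : 1 ≤ t)
    (hδ : ∀ p, c p = 1 ∨ ws w p Finset.univ + 1 ≤ c p + k)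
    (hX : ∀ A, -(2 * (t : ℤ)) ≤ XX w c A)
    (hZI : Z ⊆ I) (hZF : ∀ i ∈ Z, ∀ a, i ∉ F a) (hZc : J.card + t < Z.card) :
    ∃ (F' : Fin (4 * k) → Finset N) (i : N), i ∈ Z ∧ Conf w c I (insert i J) F' ∧
      ∀ a, F a ⊆ F' a := by
  classical
  have hi1Z : ∀ i ∈ Z, ∀ p, p ≠ i → w p i < c p := fun i hi => hi1 i (hZI hi)
  have hcZ : ∀ i ∈ Z, c i = 1 := fun i hi => hcI i (hZI hi)
  let S := (Finset.univ : Finset (Finset N)).filter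
    (fun Y => ∃ lab B, Inv w c F Z k J.card Y lab B)
  have hS : S.Nonempty := by
    obtain ⟨Y, lab, hY⟩ := inv_init (k := k) hs h0 hi1Z hcZ h.clo h.disj h.sep hZF h.exs
    exact ⟨Y, by simp only [S, Finset.mem_filter, Finset.mem_univ, true_and]; exact ⟨_, _, hY⟩⟩
  obtain ⟨Y, hYS, hmax⟩ := S.exists_max_image Finset.card hS
  simp only [S, Finset.mem_filter, Finset.mem_univ, true_and] at hYS hmax
  obtain ⟨lab, B, hY⟩ := hYS
  have hYc : Clo w c Y := by
    intro p hp
    by_contra hcon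
    push Not at hcon
    obtain ⟨lab', B', hh⟩ := inv_step hY hs h0 hc hi1Z h.clo hp hk (hδ p) hcon
    have := hmax _ ⟨lab', B', hh⟩
    rw [Finset.card_insert_of_notMem hp] at this
    omega
  have hB : ∃ x ∈ (Finset.univ : Finset (Fin (4 * k))) ×ˢ Z, x ∉ B := by
    by_contra hcon
    push Not at hcon
    have h1 := Finset.card_le_card (show (Finset.univ : Finset (Fin (4 * k))) ×ˢ Z ⊆ B from hcon)
    rw [Finset.card_product, Finset.card_univ, Fintype.card_fin] at h1
    have h2 := hY.cnt
    have h3 := hX Y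
    zify at h1 hZc hk
    nlinarith
  obtain ⟨⟨a, i⟩, hai, haB⟩ := hB
  have hi : i ∈ Z := (Finset.mem_product.1 hai).2
  set M := MM Y lab a i with hM
  have hFM : F a ⊆ M := by
    intro v hv
    have := (hY.seedF a v).2 hv
    rw [hM, mem_MM]; exact ⟨this.1, Or.inl this.2⟩
  have hiM : i ∈ M := by
    have := (hY.seedZ i i).2 ⟨rfl, hi⟩
    rw [hM, mem_MM]; exact ⟨this.1, Or.inr (Or.inl this.2)⟩
  have hMc : Clo w c M := by
    intro v hv
    by_cases hvY : v ∈ Y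
    · exact hY.good a i hi haB v hvY hv
    · exact lt_of_le_of_lt (ws_mono w v (Finset.filter_subset _ _)) (hYc v hvY)
  have hMd : ∀ b, b ≠ a → Disjoint M (F b) := by
    intro b hb
    rw [Finset.disjoint_left]
    intro v hv hvb
    have h1 := (hY.seedF b v).2 hvb
    rw [hM, mem_MM, h1.2] at hv
    simp [hb] at hv
  have hMs : ∀ b, b ≠ a → ∀ u ∈ M, ∀ v ∈ F b, w u v = 0 := by
    intro b hb u hu v hv
    rw [hM, mem_MM] at hu
    obtain ⟨huY, h1 | h1 | h1⟩ := hu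
    · exact h.sep a b hb.symm u ((hY.seedF a u).1 ⟨huY, h1⟩) v hv
    · have h2 := ((hY.seedZ i u).1 ⟨huY, h1⟩).1
      subst h2
      have h3 := h.clo b u (hZF u hi b)
      rw [hcZ u hi] at h3
      exact (ws_eq_zero w u _).1 (by omega) v hv
    · exact hY.sep a i u huY h1 b hb v hv
  refine ⟨Function.update F a M, i, hi, ⟨?_, ?_, ?_, ?_, ?_, ?_, ?_⟩, ?_⟩
  · intro b
    by_cases hb : b = a
    · subst hb; simpa using hMc
    · simpa [hb] using h.clo b
  · intro b b' hbb
    by_cases hb : b = a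
    · subst hb
      simpa [hbb.symm] using hMd b' hbb.symm
    · by_cases hb' : b' = a
      · subst hb'
        simpa [hb] using (hMd b hb).symm
      · simpa [hb, hb'] using h.disj b b' hbb
  · intro b b' hbb
    by_cases hb : b = a
    · subst hb
      simpa [hbb.symm] using hMs b' hbb.symm
    · by_cases hb' : b' = a
      · subst hb'
        simp only [Function.update_of_ne hb, Function.update_self]
        intro u hu v hv
        rw [hs]; exact hMs b hb v hv u hu
      · simpa [hb, hb'] using h.sep b b' hbb
  · have hiJ : i ∉ J := by
      intro hj
      obtain ⟨b, hb⟩ := h.JF i hj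
      exact hZF i hi b hb
    rw [Finset.card_insert_of_notMem hiJ]
    have h1 := h.exs
    rw [← Finset.add_sum_erase _ _ (Finset.mem_univ a)] at h1 ⊢
    have h2 : ∑ b ∈ Finset.univ.erase a, XX w c (Function.update F a M b) =
        ∑ b ∈ Finset.univ.erase a, XX w c (F b) := by
      apply Finset.sum_congr rfl
      intro b hb
      rw [Function.update_of_ne (Finset.ne_of_mem_erase hb)]
    rw [h2, Function.update_self]
    have h3 := hY.ex a i hi
    push_cast
    linarith
  · exact Finset.insert_subset (hZI hi) h.JI
  · intro j hj
    rw [Finset.mem_insert] at hj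
    rcases hj with rfl | hj
    · exact ⟨a, by simpa using hiM⟩
    · obtain ⟨b, hb⟩ := h.JF j hj
      refine ⟨b, ?_⟩
      by_cases hba : b = a
      · subst hba; simpa using hFM hb
      · simpa [hba] using hb
  · intro b
    by_cases hba : b = a
    · subst hba
      obtain ⟨j, hj, hji⟩ := Finset.exists_mem_ne (show 1 < Z.card by omega) i
      refine ⟨j, hZI hj, ?_⟩
      have h1 := ((hY.seedZ j j).2 ⟨rfl, hj⟩).2
      simp only [Function.update_self]
      rw [hM, mem_MM, h1]
      simp [hji]
    · simpa [hba] using h.miss b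
  · intro b
    by_cases hba : b = a
    · subst hba; simpa using hFM
    · simp [hba]

/-- Layer invariant. -/
def Layer (s : N → ℕ) (t : ℕ) (I J : Finset N) (F : Fin L → Finset N) (σ : ℕ) : Prop :=
  (I.filter (fun i => (∀ a, i ∉ F a) ∧ σ < s i)).card ≤ (J.filter (fun j => σ < s j)).card + t

theorem layer_exists (hs : ∀ p q, w p q = w q p)
    (h0 : ∀ p, w p p = 0) (hc : ∀ p, 1 ≤ c p)
    (hi1 : ∀ i ∈ I, ∀ p, p ≠ i → w p i < c p) (hcI : ∀ i ∈ I, c i = 1) (hk : 1 ≤ k) (ht : 1 ≤ t)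
    (hδ : ∀ p, c p = 1 ∨ ws w p Finset.univ + 1 ≤ c p + k)
    (hX : ∀ A, -(2 * (t : ℤ)) ≤ XX w c A) (hI : I.Nonempty) (s : N → ℕ) (E : ℕ)
    (hE : ∀ i ∈ I, s i ≤ E) (m : ℕ) (hm : m ≤ E) :
    ∃ (F : Fin (4 * k) → Finset N) (J : Finset N), Conf w c I J F ∧
      (∀ j ∈ J, E - m < s j) ∧ ∀ σ, E - m ≤ σ → Layer s t I J F σ := by
  classical
  induction m with
  | zero =>
    refine ⟨_, ∅, conf_init hc hI, by simp, ?_⟩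
    intro σ hσ
    unfold Layer
    rw [Finset.filter_eq_empty_iff.2]
    · simp
    · intro i hi hh
      have := hE i hi
      omega
  | succ m ih =>
    obtain ⟨F0, J0, hC0, hJ0, hL0⟩ := ih (by omega)
    let S := (Finset.univ : Finset (Finset N)).filter
      (fun J => ∃ F : Fin (4 * k) → Finset N, Conf w c I J F ∧ (∀ j ∈ J, E - (m + 1) < s j) ∧
        ∀ σ, E - m ≤ σ → Layer s t I J F σ)
    have hS : S.Nonempty := by
      refine ⟨J0, ?_⟩
      simp only [S, Finset.mem_filter, Finset.mem_univ, true_and]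
      exact ⟨F0, hC0, fun j hj => by have := hJ0 j hj; omega, hL0⟩
    obtain ⟨J, hJS, hmax⟩ := S.exists_max_image Finset.card hS
    simp only [S, Finset.mem_filter, Finset.mem_univ, true_and] at hJS hmax
    obtain ⟨F, hC, hJ, hLy⟩ := hJS
    refine ⟨F, J, hC, hJ, ?_⟩
    intro σ hσ
    by_cases hσ2 : E - m ≤ σ
    · exact hLy σ hσ2
    have hσe : σ = E - (m + 1) := by omega
    subst hσe
    by_contra hcon
    unfold Layer at hcon
    push Not at hcon
    rw [Finset.filter_true_of_mem hJ] at hcon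
    obtain ⟨F', i, hiZ, hC', hFF⟩ := conf_step hC hs h0 hc hi1 hcI hk ht hδ hX
      (Finset.filter_subset _ _) (fun i hi => ((Finset.mem_filter.1 hi).2).1) hcon
    rw [Finset.mem_filter] at hiZ
    have hiJ : i ∉ J := by
      intro hj
      obtain ⟨b, hb⟩ := hC.JF i hj
      exact hiZ.2.1 b hb
    have := hmax (insert i J) ⟨F', hC', ?_, ?_⟩
    · rw [Finset.card_insert_of_notMem hiJ] at this; omega
    · intro j hj
      rw [Finset.mem_insert] at hj
      rcases hj with rfl | hj
      · exact hiZ.2.2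
      · exact hJ j hj
    · intro σ hσ
      have h1 := hLy σ hσ
      unfold Layer at h1 ⊢
      have h2 : (J.filter (fun j => σ < s j)).card ≤
          ((insert i J).filter (fun j => σ < s j)).card := by
        apply Finset.card_le_card
        apply Finset.filter_subset_filter
        exact Finset.subset_insert _ _
      have h3 : (I.filter (fun i => (∀ a, i ∉ F' a) ∧ σ < s i)).card ≤
          (I.filter (fun i => (∀ a, i ∉ F a) ∧ σ < s i)).card := by
        apply Finset.card_le_card
        intro x hx
        rw [Finset.mem_filter] at hx ⊢
        exact ⟨hx.1, fun a ha => hx.2.1 a (hFF a ha), hx.2.2⟩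
      omega

theorem layer_cake (s : N → ℕ) (E : ℕ) (A : Finset N) (hE : ∀ i ∈ A, s i ≤ E) :
    ∑ i ∈ A, s i = ∑ σ ∈ Finset.range E, (A.filter (fun i => σ < s i)).card := by
  have : ∀ i ∈ A, s i = ∑ σ ∈ Finset.range E, if σ < s i then 1 else 0 := by
    intro i hi
    rw [← Finset.card_filter]
    have : (Finset.range E).filter (fun σ => σ < s i) = Finset.range (s i) := by
      ext x
      have := hE i hi
      simp; omega
    rw [this, Finset.card_range]
  rw [Finset.sum_congr rfl this, Finset.sum_comm]
  simp only [Finset.card_filter]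

theorem abstract_main (hs : ∀ p q, w p q = w q p)
    (h0 : ∀ p, w p p = 0) (hc : ∀ p, 1 ≤ c p)
    (hi1 : ∀ i ∈ I, ∀ p, p ≠ i → w p i < c p) (hcI : ∀ i ∈ I, c i = 1) (hk : 1 ≤ k) (ht : 1 ≤ t)
    (hδ : ∀ p, c p = 1 ∨ ws w p Finset.univ + 1 ≤ c p + k)
    (hX : ∀ A, -(2 * (t : ℤ)) ≤ XX w c A) (s : N → ℕ) (E : ℕ)
    (hE : ∀ i ∈ I, s i ≤ E)
    (hA : ∀ A, Clo w c A → (∃ i ∈ I, i ∉ A) → ∑ p ∈ A, s p ≤ E) :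
    ∑ i ∈ I, s i ≤ (8 * k + t) * E := by
  classical
  rcases I.eq_empty_or_nonempty with rfl | hI
  · simp
  obtain ⟨F, J, hC, _, hLy⟩ := layer_exists hs h0 hc hi1 hcI hk ht hδ hX hI s E hE E le_rfl
  have hF : ∀ A : Finset N, (∀ i ∈ A, ∃ a, i ∈ F a) → ∑ i ∈ A, s i ≤ 4 * k * E := by
    intro A h
    have h1 : A ⊆ Finset.univ.biUnion F := by
      intro i hi
      simpa using h i hi
    refine (Finset.sum_le_sum_of_subset h1).trans ?_
    rw [Finset.sum_biUnion (fun a _ b _ hab => hC.disj a b hab)]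
    calc ∑ a, ∑ i ∈ F a, s i ≤ ∑ a : Fin (4 * k), E :=
          Finset.sum_le_sum (fun a _ => hA _ (hC.clo a) (hC.miss a))
      _ = 4 * k * E := by simp
  have h1 : ∑ i ∈ I.filter (fun i => ∃ a, i ∈ F a), s i ≤ 4 * k * E :=
    hF _ (fun i hi => (Finset.mem_filter.1 hi).2)
  have h2 := hF J hC.JF
  have h3 : ∑ i ∈ I.filter (fun i => ¬ ∃ a, i ∈ F a), s i ≤ ∑ j ∈ J, s j + E * t := by
    rw [layer_cake s E _ (fun i hi => hE i (Finset.mem_filter.1 hi).1),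
      layer_cake s E J (fun i hi => hE i (hC.JI hi))]
    have : E * t = ∑ σ ∈ Finset.range E, t := by simp
    rw [this, ← Finset.sum_add_distrib]
    apply Finset.sum_le_sum
    intro σ _
    have := hLy σ (by omega)
    unfold Layer at this
    rw [Finset.filter_filter]
    simpa only [not_exists] using this
  rw [← Finset.sum_filter_add_sum_filter_not I (fun i => ∃ a, i ∈ F a)]
  nlinarith

end Abstract3
end EFRS

namespace EFRS
section Vertex
variable {V : Type*} [Fintype V] [DecidableEq V] {w : V → V → ℕ} {c : V → ℕ} {k t : ℕ}

/-- Sum of inner degrees. -/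
def DD (w : V → V → ℕ) (A : Finset V) : ℕ := ∑ v ∈ A, ws w v A

/-- Doubled surplus of edges. -/
def hh (w : V → V → ℕ) (k : ℕ) (A : Finset V) : ℤ :=
  (DD w A : ℤ) - 2 * ((k : ℤ) - 1) * (A.card : ℤ)

theorem ws_erase (h0 : ∀ p, w p p = 0) (p : V) (A : Finset V) :
    ws w p (A.erase p) = ws w p A := by
  unfold ws
  by_cases hp : p ∈ A
  · rw [← Finset.add_sum_erase _ _ hp, h0, zero_add]
  · rw [Finset.erase_eq_of_notMem hp]

theorem DD_insert (hs : ∀ p q, w p q = w q p) (h0 : ∀ p, w p p = 0)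
    (p : V) (A : Finset V) (h : p ∉ A) :
    DD w (insert p A) = DD w A + 2 * ws w p A := by
  have := XX_insert w (fun _ => 0) hs h0 p A h
  unfold XX at this
  unfold DD
  push_cast at this
  zify
  simp at this
  linarith

theorem DD_even (hs : ∀ p q, w p q = w q p) (h0 : ∀ p, w p p = 0) (A : Finset V) :
    ∃ m, DD w A = 2 * m := by
  induction A using Finset.induction_on with
  | empty => exact ⟨0, by simp [DD]⟩
  | insert p A hp ih =>
    obtain ⟨m, hm⟩ := ih
    exact ⟨m + ws w p A, by rw [DD_insert hs h0 p A hp, hm]; ring⟩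

theorem hh_erase (hs : ∀ p q, w p q = w q p) (h0 : ∀ p, w p p = 0)
    (p : V) (A : Finset V) (h : p ∈ A) :
    hh w k (A.erase p) = hh w k A - 2 * (ws w p A : ℤ) + 2 * ((k : ℤ) - 1) := by
  have h1 := DD_insert hs h0 p (A.erase p) (Finset.notMem_erase p A)
  rw [Finset.insert_erase h, ws_erase h0] at h1
  have h2 := Finset.card_erase_add_one h
  unfold hh
  rw [h1, ← h2]
  push_cast
  ring

theorem ws_le_card (h1 : ∀ p q, w p q ≤ 1) (p : V) (A : Finset V) : ws w p A ≤ A.card := by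
  unfold ws
  calc ∑ q ∈ A, w p q ≤ ∑ q ∈ A, 1 := Finset.sum_le_sum (fun q _ => h1 p q)
    _ = A.card := by simp

theorem DD_le (h0 : ∀ p, w p p = 0) (h1 : ∀ p q, w p q ≤ 1) (A : Finset V) :
    DD w A ≤ A.card * (A.card - 1) := by
  unfold DD
  calc ∑ v ∈ A, ws w v A ≤ ∑ v ∈ A, (A.card - 1) := by
        apply Finset.sum_le_sum
        intro v hv
        rw [← ws_erase h0, ← Finset.card_erase_of_mem hv]
        exact ws_le_card h1 _ _
    _ = _ := by simp

theorem fact0 (hs : ∀ p q, w p q = w q p) (h0 : ∀ p, w p p = 0) (h1 : ∀ p q, w p q ≤ 1)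
    (ht : 2 * t + k + 4 = k * k) (hk : 3 ≤ k) (m : ℕ) :
    ∀ A : Finset V, A.card = m → k - 1 ≤ A.card → -(2 * (t : ℤ)) - 2 ≤ hh w k A →
    ∃ s, s ⊆ A ∧ s.Nonempty ∧ (∀ v ∈ s, k ≤ ws w v s) ∧ hh w k A ≤ hh w k s := by
  induction m with
  | zero => intro A h2 h3; omega
  | succ m ih =>
    intro A hm hA hhA
    by_cases hd : ∀ v ∈ A, k ≤ ws w v A
    · exact ⟨A, subset_rfl, Finset.card_pos.1 (by omega), hd, le_rfl⟩
    push Not at hd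
    obtain ⟨v, hv, hvd⟩ := hd
    have h2 := hh_erase (k := k) hs h0 v A hv
    have h3 := Finset.card_erase_add_one hv
    by_cases hc : A.card = k - 1
    · exfalso
      have h4 := DD_le h0 h1 A
      rw [hc] at h4
      unfold hh at hhA
      rw [hc] at hhA
      obtain ⟨j, rfl⟩ : ∃ j, k = j + 3 := ⟨k - 3, by omega⟩
      simp at h4 hhA
      zify at h4 ht
      nlinarith
    · obtain ⟨s, hs1, hs2, hs3, hs4⟩ := ih (A.erase v) (by omega) (by omega) (by omega)
      exact ⟨s, hs1.trans (Finset.erase_subset _ _), hs2, hs3, by omega⟩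

theorem XX_eq (hs : ∀ p q, w p q = w q p) (h0 : ∀ p, w p p = 0)
    (hcd : ∀ v, ws w v Finset.univ + 1 = c v + k) (S : Finset V) :
    XX w c S = hh w k Finset.univ - hh w k Sᶜ := by
  induction S using Finset.induction_on with
  | empty => simp [XX]
  | insert p S hp ih =>
    rw [XX_insert w c hs h0 p S hp, ih, Finset.compl_insert,
      hh_erase hs h0 p _ (Finset.mem_compl.2 hp)]
    have h2 := hcd p
    have h3 := ws_sdiff w p (Finset.subset_univ S)
    rw [← Finset.compl_eq_univ_sdiff] at h3
    zify at h2 h3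
    linarith

theorem XX_union_eq (hs : ∀ p q, w p q = w q p)
    (h0 : ∀ p, w p p = 0) (A B : Finset V) (h : Disjoint A B) :
    XX w c (A ∪ B) = XX w c A + XX w c B - 2 * ∑ p ∈ B, (ws w p A : ℤ) := by
  induction B using Finset.induction_on with
  | empty => simp [XX]
  | insert p B hp ih =>
    rw [Finset.disjoint_insert_right] at h
    have h1 : p ∉ A ∪ B := by simp [hp, h.1]
    rw [Finset.union_insert, XX_insert w c hs h0 _ _ h1, XX_insert w c hs h0 _ _ hp,
      Finset.sum_insert hp, ih h.2]
    have : ws w p (A ∪ B) = ws w p A + ws w p B := Finset.sum_union h.2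
    rw [this]; push_cast; ring

theorem XX_submod (hs : ∀ p q, w p q = w q p)
    (h0 : ∀ p, w p p = 0) (S T : Finset V) :
    XX w c (S ∪ T) ≤ XX w c S + XX w c T - XX w c (S ∩ T) := by
  have h1 := XX_union_eq (c := c) hs h0 S (T \ S) Finset.disjoint_sdiff
  have h2 := XX_union_eq (c := c) hs h0 (S ∩ T) (T \ S)
    (Finset.disjoint_sdiff.mono_left Finset.inter_subset_left)
  rw [Finset.union_sdiff_self_eq_union] at h1
  have e : S ∩ T ∪ T \ S = T := by
    ext x; simp; tauto
  rw [e] at h2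
  have h3 : ∑ p ∈ T \ S, (ws w p (S ∩ T) : ℤ) ≤ ∑ p ∈ T \ S, (ws w p S : ℤ) := by
    apply Finset.sum_le_sum
    intro p _
    exact_mod_cast ws_mono w p Finset.inter_subset_left
  linarith

/-- All basic facts about the vertex system that are used later. -/
structure Sys (w : V → V → ℕ) (c : V → ℕ) (k t K : ℕ) : Prop where
  hs : ∀ p q, w p q = w q p
  h0 : ∀ p, w p p = 0
  h1 : ∀ p q, w p q ≤ 1
  hk : 3 ≤ k
  ht : 2 * t + k + 4 = k * k
  hK : K = 10 ^ 4 * k ^ 3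
  hn : k + 2 ≤ Fintype.card V
  hc : ∀ v, 1 ≤ c v
  hcd : ∀ v, ws w v Finset.univ + 1 = c v + k
  hD : DD w Finset.univ ≤ 2 * k * Fintype.card V
  P1 : ∀ S : Finset V, S.Nonempty → k - 1 ≤ Sᶜ.card → 2 ≤ XX w c S
  PX : ∀ S, -(2 * (t : ℤ)) ≤ XX w c S
  PC : ∀ C, Clo w c C → C ≠ Finset.univ → K * C.card < Fintype.card V
  LT : ∀ S : Finset V, S.Nonempty → XX w c S ≤ 2 → k - 1 ≤ Sᶜ.card →
    ∃ C, S ⊆ C ∧ Clo w c C ∧ XX w c C ≤ 2 ∧ K * C.card < Fintype.card V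

theorem sys_of_min (hs : ∀ p q, w p q = w q p) (h0 : ∀ p, w p p = 0) (h1 : ∀ p q, w p q ≤ 1)
    (hk : 3 ≤ k) (ht : 2 * t + k + 4 = k * k) {K : ℕ} (hK : K = 10 ^ 4 * k ^ 3)
    (hn : k - 1 ≤ Fintype.card V) (hU : -(2 * (t : ℤ)) ≤ hh w k Finset.univ)
    (hmin : ∀ A : Finset V, A ≠ Finset.univ → k - 1 ≤ A.card → hh w k A ≤ -(2 * (t : ℤ)) - 2)
    (NC : ∀ s : Finset V, s.Nonempty → (∀ v ∈ s, k ≤ ws w v s) → K * sᶜ.card < Fintype.card V) :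
    ∃ c : V → ℕ, Sys w c k t K := by
  have hn2 : k + 2 ≤ Fintype.card V := by
    by_contra hcon
    have h2 := DD_le h0 h1 (Finset.univ : Finset V)
    rw [Finset.card_univ] at h2
    unfold hh at hU
    rw [Finset.card_univ] at hU
    set n := Fintype.card V
    have h3 : n = k - 1 ∨ n = k ∨ n = k + 1 := by omega
    have h4 : ((DD w (Finset.univ : Finset V) : ℕ) : ℤ) ≤ (n : ℤ) * ((n : ℤ) - 1) := by
      have : ((n - 1 : ℕ) : ℤ) = (n : ℤ) - 1 := by omega
      rw [← this]; exact_mod_cast h2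
    zify at ht
    rcases h3 with h3 | h3 | h3
    · have : (n : ℤ) = k - 1 := by omega
      rw [this] at h4 hU
      nlinarith
    · have : (n : ℤ) = k := by omega
      rw [this] at h4 hU
      nlinarith
    · have : (n : ℤ) = k + 1 := by omega
      rw [this] at h4 hU
      nlinarith
  have hdeg : ∀ v : V, 2 * (k : ℤ) + hh w k Finset.univ + 2 * t ≤ 2 * (ws w v Finset.univ : ℤ) := by
    intro v
    have h2 := hh_erase (k := k) hs h0 v Finset.univ (Finset.mem_univ v)
    have h3 := Finset.card_erase_add_one (Finset.mem_univ v)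
    rw [Finset.card_univ] at h3
    have h4 := hmin (Finset.univ.erase v) (by
      intro h; have := Finset.mem_univ v; rw [← h] at this; simp at this) (by omega)
    linarith
  have hdeg2 : ∀ v, k ≤ ws w v Finset.univ := by
    intro v
    have := hdeg v
    omega
  obtain ⟨c, hcd⟩ : ∃ c : V → ℕ, ∀ v, ws w v Finset.univ + 1 = c v + k :=
    ⟨fun v => ws w v Finset.univ + 1 - k, fun v => by have := hdeg2 v; simp only []; omega⟩
  have hXe := XX_eq (c := c) hs h0 hcd
  have hc : ∀ v, 1 ≤ c v := by intro v; have := hdeg2 v; have := hcd v; omega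
  have hP1 : ∀ S : Finset V, S.Nonempty → k - 1 ≤ Sᶜ.card → 2 ≤ XX w c S := by
    intro S hS hSc
    rw [hXe S]
    have := hmin Sᶜ (by
      rw [Ne, Finset.compl_eq_univ_iff]; exact hS.ne_empty) hSc
    linarith
  refine ⟨c, hs, h0, h1, hk, ht, hK, hn2, hc, hcd, ?_, hP1, ?_, ?_, ?_⟩
  · by_contra hcon
    push Not at hcon
    have h2 : (Fintype.card V : ℤ) * (2 * (k : ℤ) + hh w k Finset.univ + 2 * t) ≤
        2 * (DD w (Finset.univ : Finset V) : ℤ) := by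
      unfold DD
      push_cast
      rw [Finset.mul_sum]
      calc (Fintype.card V : ℤ) * (2 * (k : ℤ) + hh w k Finset.univ + 2 * t) =
          ∑ v : V, (2 * (k : ℤ) + hh w k Finset.univ + 2 * t) := by simp
        _ ≤ _ := Finset.sum_le_sum (fun v _ => hdeg v)
    set n := Fintype.card V
    have h3 : hh w k (Finset.univ : Finset V) =
      (DD w (Finset.univ : Finset V) : ℤ) - 2 * ((k : ℤ) - 1) * (n : ℤ) := by
      unfold hh; rw [Finset.card_univ]
    set h := hh w k (Finset.univ : Finset V)
    have h4 : (DD w (Finset.univ : Finset V) : ℤ) = h + 2 * ((k : ℤ) - 1) * (n : ℤ) := by linarith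
    zify at hcon hn2 hk
    rw [h4] at h2 hcon
    have h5 : 2 * (n : ℤ) + 1 ≤ h := by nlinarith
    have h6 : h * ((n : ℤ) - 2) ≤ n * (2 * k - 4 - 2 * t) := by nlinarith
    have h7 : (2 * (n : ℤ) + 1) * ((n : ℤ) - 2) ≤ h * ((n : ℤ) - 2) :=
      mul_le_mul_of_nonneg_right h5 (by linarith)
    have h8 : (0 : ℤ) ≤ t := by positivity
    nlinarith
  · intro S
    rcases S.eq_empty_or_nonempty with rfl | hS
    · simp [XX]
    by_cases hSc : k - 1 ≤ Sᶜ.card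
    · have := hP1 S hS hSc; omega
    · rw [hXe S]
      have h2 := DD_le h0 h1 Sᶜ
      have h3 : Sᶜ.card * (Sᶜ.card - 1) ≤ Sᶜ.card * (k - 1) := Nat.mul_le_mul_left _ (by omega)
      have h4 : hh w k Sᶜ ≤ 0 := by
        unfold hh
        have h5 : (DD w Sᶜ : ℤ) ≤ Sᶜ.card * ((k : ℤ) - 1) := by
          have : ((k - 1 : ℕ) : ℤ) = (k : ℤ) - 1 := by omega
          rw [← this]; exact_mod_cast h2.trans h3
        have h6 : (0 : ℤ) ≤ Sᶜ.card * ((k : ℤ) - 1) := mul_nonneg (by positivity) (by omega)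
        linarith
      linarith
  · intro C hC hCu
    have := NC Cᶜ (by
      rw [Finset.nonempty_iff_ne_empty, Ne, Finset.compl_eq_empty_iff]; exact hCu) (by
      intro v hv
      have h2 := hC v (Finset.mem_compl.1 hv)
      have h3 := ws_sdiff w v (Finset.subset_univ C)
      rw [← Finset.compl_eq_univ_sdiff] at h3
      have := hcd v
      omega)
    rwa [compl_compl] at this
  · intro S hS hX hSc
    have h2 := hXe S
    obtain ⟨s, hs1, hs2, hs3, hs4⟩ := fact0 hs h0 h1 ht hk _ Sᶜ rfl hSc (by omega)
    refine ⟨sᶜ, ?_, ?_, ?_, NC s hs2 hs3⟩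
    · intro x hx
      rw [Finset.mem_compl]
      intro hxs
      exact (Finset.mem_compl.1 (hs1 hxs)) hx
    · intro v hv
      rw [Finset.mem_compl, not_not] at hv
      have h3 := ws_sdiff w v (Finset.subset_univ s)
      rw [← Finset.compl_eq_univ_sdiff] at h3
      have h4 := hcd v
      have h5 := hs3 v hv
      omega
    · rw [hXe sᶜ, compl_compl]
      omega

end Vertex
end EFRS

namespace EFRS
section Tight
variable {V : Type*} [Fintype V] [DecidableEq V] {w : V → V → ℕ} {c : V → ℕ} {k t K : ℕ}

/-- Small nonempty sets of excess at most one. -/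
def Tight (w : V → V → ℕ) (c : V → ℕ) (K : ℕ) (S : Finset V) : Prop :=
  S.Nonempty ∧ XX w c S ≤ 2 ∧ K * S.card < Fintype.card V

/-- Maximal tight sets. -/
def MT (w : V → V → ℕ) (c : V → ℕ) (K : ℕ) (S : Finset V) : Prop :=
  Tight w c K S ∧ ∀ T, Tight w c K T → S ⊆ T → T = S

theorem tight_compl (h : Sys w c k t K) {S T : Finset V} (hS : Tight w c K S)
    (hT : Tight w c K T) : k - 1 ≤ (S ∪ T)ᶜ.card := by
  have h1 := hS.2.2
  have h2 := hT.2.2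
  have h3 := Finset.card_union_le S T
  rw [Finset.card_compl]
  have h4 := h.hn
  have hK : 4 ≤ K := by
    rw [h.hK]
    have : 1 ≤ k ^ 3 := Nat.one_le_pow _ _ (by have := h.hk; omega)
    omega
  have hk := h.hk
  have hKk : 10 * k ≤ K := by
    rw [h.hK]
    have : k ≤ k ^ 3 := Nat.le_self_pow (by norm_num) k
    omega
  have e1 : 10 * k * S.card < Fintype.card V := lt_of_le_of_lt (Nat.mul_le_mul_right _ hKk) h1
  have e2 : 10 * k * T.card < Fintype.card V := lt_of_le_of_lt (Nat.mul_le_mul_right _ hKk) h2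
  set n := Fintype.card V
  have e3 : 3 * S.card ≤ k * S.card := Nat.mul_le_mul_right _ hk
  have e4 : 3 * T.card ≤ k * T.card := Nat.mul_le_mul_right _ hk
  have e5 : 10 * k * S.card = 10 * (k * S.card) := by ring
  have e6 : 10 * k * T.card = 10 * (k * T.card) := by ring
  have e7 : 15 * (S.card + T.card) ≤ n := by omega
  by_cases h0 : S.card + T.card ≤ 3
  · omega
  · have hz : 10 * k * S.card + 10 * k * T.card = 10 * (k * (S.card + T.card)) := by ring
    have : k * 4 ≤ k * (S.card + T.card) := Nat.mul_le_mul_left _ (by omega)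
    omega

theorem mt_of_tight {S : Finset V} (hS : Tight w c K S) : ∃ M, MT w c K M ∧ S ⊆ M := by
  classical
  obtain ⟨M, hM, hmax⟩ := ((Finset.univ : Finset (Finset V)).filter
    (fun T => Tight w c K T ∧ S ⊆ T)).exists_max_image Finset.card ⟨S, by simp [hS]⟩
  simp only [Finset.mem_filter, Finset.mem_univ, true_and] at hM hmax
  refine ⟨M, ⟨hM.1, ?_⟩, hM.2⟩
  intro T hT hMT
  exact (Finset.eq_of_subset_of_card_le hMT (hmax T ⟨hT, hM.2.trans hMT⟩)).symm

theorem mt_of_union (h : Sys w c k t K) {S T : Finset V} (hS : MT w c K S)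
    (hT : MT w c K T) (hX : XX w c (S ∪ T) ≤ 2) : S = T := by
  obtain ⟨C, hC1, hC2, hC3, hC4⟩ := h.LT (S ∪ T) (hS.1.1.mono Finset.subset_union_left) hX
    (tight_compl h hS.1 hT.1)
  have hCt : Tight w c K C := ⟨(hS.1.1.mono Finset.subset_union_left).mono hC1, hC3, hC4⟩
  rw [← hS.2 C hCt (Finset.subset_union_left.trans hC1),
    ← hT.2 C hCt (Finset.subset_union_right.trans hC1)]

theorem mt_clo (h : Sys w c k t K) {S : Finset V} (hS : MT w c K S) : Clo w c S := by
  have h1 := tight_compl h hS.1 hS.1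
  rw [Finset.union_self] at h1
  obtain ⟨C, hC1, hC2, hC3, hC4⟩ := h.LT S hS.1.1 hS.1.2.1 h1
  rw [← hS.2 C ⟨hS.1.1.mono hC1, hC3, hC4⟩ hC1]
  exact hC2

theorem mt_XX (h : Sys w c k t K) {S : Finset V} (hS : MT w c K S) : XX w c S = 2 := by
  have h1 := tight_compl h hS.1 hS.1
  rw [Finset.union_self] at h1
  exact le_antisymm hS.1.2.1 (h.P1 S hS.1.1 h1)

theorem mt_eq (h : Sys w c k t K) {S T : Finset V} (hS : MT w c K S)
    (hT : MT w c K T) {v : V} (h1 : v ∈ S) (h2 : v ∈ T) : S = T := by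
  apply mt_of_union h hS hT
  have h3 := XX_submod (c := c) h.hs h.h0 S T
  have h4 := h.P1 (S ∩ T) ⟨v, by simp [h1, h2]⟩ ((tight_compl h hS.1 hT.1).trans
    (Finset.card_le_card (Finset.compl_subset_compl.2
      (Finset.inter_subset_left.trans Finset.subset_union_left))))
  rw [mt_XX h hS, mt_XX h hT] at h3
  linarith

theorem mt_sep (h : Sys w c k t K) {S T : Finset V} (hS : MT w c K S)
    (hT : MT w c K T) (hne : S ≠ T) {v : V} (h1 : v ∈ S) : ws w v T = 0 := by
  by_contra hcon
  apply hne
  apply mt_of_union h hS hT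
  have hd : Disjoint T S := by
    rw [Finset.disjoint_left]
    intro x hx hx2
    exact hne (mt_eq h hS hT hx2 hx)
  have h3 := XX_union_eq (c := c) h.hs h.h0 T S hd
  rw [Finset.union_comm, h3, mt_XX h hS, mt_XX h hT]
  have h4 : (ws w v T : ℤ) ≤ ∑ p ∈ S, (ws w p T : ℤ) :=
    Finset.single_le_sum (f := fun p => (ws w p T : ℤ)) (fun _ _ => by positivity) h1
  have : (1 : ℤ) ≤ ws w v T := by omega
  linarith

theorem mt_one (h : Sys w c k t K) {v : V} (hv : c v = 1) : ∃ S, MT w c K S ∧ v ∈ S := by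
  have hX : XX w c {v} = 2 := by simp [XX, ws, hv, h.h0]
  have h1 : k - 1 ≤ ({v} : Finset V)ᶜ.card := by
    rw [Finset.card_compl, Finset.card_singleton]
    have := h.hn; omega
  obtain ⟨C, hC1, hC2, hC3, hC4⟩ := h.LT {v} (by simp) hX.le h1
  have hv' : v ∈ C := hC1 (by simp)
  obtain ⟨M, hM, hCM⟩ := mt_of_tight (w := w) (c := c) (K := K) ⟨⟨v, hv'⟩, hC3, hC4⟩
  exact ⟨M, hM, hCM hv'⟩

end Tight

section Node
variable {V : Type*} [Fintype V] [DecidableEq V] {w : V → V → ℕ} {c : V → ℕ} {k t K : ℕ}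
variable {N : Type*} [Fintype N] [DecidableEq N] {c' : N → ℕ} {f : V → N}

/-- Preimage of a set of nodes. -/
def pre (f : V → N) (A : Finset N) : Finset V := Finset.univ.filter (fun v => f v ∈ A)

/-- Contracted weights. -/
def cw (w : V → V → ℕ) (f : V → N) (a b : N) : ℕ :=
  if a = b then 0 else ∑ u ∈ pre f {a}, ws w u (pre f {b})

theorem mem_pre {A : Finset N} {v : V} : v ∈ pre f A ↔ f v ∈ A := by simp [pre]

theorem cw_symm (hs : ∀ p q, w p q = w q p) (a b : N) : cw w f a b = cw w f b a := by
  unfold cw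
  by_cases h : a = b
  · simp [h]
  · rw [if_neg h, if_neg (Ne.symm h)]
    unfold ws
    rw [Finset.sum_comm]
    exact Finset.sum_congr rfl (fun x _ => Finset.sum_congr rfl (fun y _ => hs y x))

theorem pre_insert (a : N) (A : Finset N) : pre f (insert a A) = pre f A ∪ pre f {a} := by
  ext v; simp [mem_pre]; tauto

theorem pre_disj (a : N) (A : Finset N) (h : a ∉ A) : Disjoint (pre f A) (pre f {a}) := by
  rw [Finset.disjoint_left]
  intro v hv hv2
  rw [mem_pre] at hv hv2
  simp at hv2
  exact h (hv2 ▸ hv)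

theorem cws (a : N) (A : Finset N) (h : a ∉ A) :
    ws (cw w f) a A = ∑ u ∈ pre f {a}, ws w u (pre f A) := by
  induction A using Finset.induction_on with
  | empty => simp [ws, pre]
  | insert b A hb ih =>
    rw [Finset.mem_insert, not_or] at h
    rw [ws_insert _ _ _ _ hb, ih h.2, cw, if_neg h.1, ← Finset.sum_add_distrib]
    apply Finset.sum_congr rfl
    intro u _
    rw [pre_insert, add_comm]
    exact (Finset.sum_union (pre_disj b A hb)).symm

theorem cXX (hs : ∀ p q, w p q = w q p) (h0 : ∀ p, w p p = 0)
    (hc' : ∀ a, 2 * (c' a : ℤ) = XX w c (pre f {a})) (A : Finset N) :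
    XX (cw w f) c' A = XX w c (pre f A) := by
  induction A using Finset.induction_on with
  | empty => simp [XX, pre]
  | insert b A hb ih =>
    rw [XX_insert _ _ (cw_symm hs) (by simp [cw]) _ _ hb, ih, pre_insert,
      XX_union_eq hs h0 _ _ (pre_disj b A hb), cws _ _ hb, hc' b]
    push_cast; ring

theorem pre_card (A : Finset N) : ∑ a ∈ A, (pre f {a}).card = (pre f A).card := by
  induction A using Finset.induction_on with
  | empty => simp [pre]
  | insert b A hb ih =>
    rw [Finset.sum_insert hb, ih, pre_insert, Finset.card_union_of_disjoint (pre_disj b A hb),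
      add_comm]

theorem U_upper_node (h : Sys w c k t K) (hf : Function.Surjective f) (ht : 1 ≤ t)
    (hc' : ∀ a, 2 * (c' a : ℤ) = XX w c (pre f {a})) (I : Finset N)
    (hI : ∀ a ∈ I, MT w c K (pre f {a}))
    (hI2 : ∀ a, a ∉ I → ∃ v, pre f {a} = {v}) :
    (pre f I).card ≤ (8 * k + t) * ((Fintype.card V - 1) / K) := by
  have hKpos : 0 < K := by
    rw [h.hK]; have := h.hk; positivity
  have hle : ∀ m, K * m < Fintype.card V → m ≤ (Fintype.card V - 1) / K := by
    intro m hm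
    rw [Nat.le_div_iff_mul_le hKpos, mul_comm]; omega
  have hcI : ∀ a ∈ I, c' a = 1 := by
    intro a ha
    have := hc' a
    rw [mt_XX h (hI a ha)] at this
    omega
  have hcs : ∀ a v, pre f {a} = {v} → c' a = c v := by
    intro a v hv
    have := hc' a
    rw [hv] at this
    simp [XX, ws, h.h0] at this
    omega
  have hc1 : ∀ a, 1 ≤ c' a := by
    intro a
    by_cases ha : a ∈ I
    · rw [hcI a ha]
    · obtain ⟨v, hv⟩ := hI2 a ha
      rw [hcs a v hv]; exact h.hc v
  rw [← pre_card]
  refine abstract_main (w := cw w f) (c := c') (k := k) (t := t) (cw_symm h.hs)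
    (by simp [cw]) hc1 ?_ hcI (by have := h.hk; omega) ht ?_ ?_ _ _ ?_ ?_
  · intro i hi a hai
    by_cases ha : a ∈ I
    · rw [hcI a ha, cw, if_neg hai]
      rw [Finset.sum_eq_zero]
      · norm_num
      intro u hu
      refine mt_sep h (hI a ha) (hI i hi) ?_ hu
      intro he
      obtain ⟨v, rfl⟩ := hf a
      have : v ∈ pre f {f v} := by simp [mem_pre]
      rw [he, mem_pre] at this
      simp at this
      exact hai this
    · obtain ⟨v, hv⟩ := hI2 a ha
      rw [hcs a v hv, cw, if_neg hai, hv, Finset.sum_singleton]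
      apply mt_clo h (hI i hi)
      rw [mem_pre]
      have : v ∈ pre f {a} := by rw [hv]; simp
      rw [mem_pre] at this
      simp at this ⊢
      rw [this]; exact hai
  · intro a
    by_cases ha : a ∈ I
    · exact Or.inl (hcI a ha)
    · right
      obtain ⟨v, hv⟩ := hI2 a ha
      rw [hcs a v hv, ← h.hcd v, ← ws_erase (w := cw w f) (by simp [cw]) a, cws _ _ (by simp), hv,
        Finset.sum_singleton]
      exact Nat.add_le_add_right (ws_mono w v (Finset.subset_univ _)) 1
  · intro A
    rw [cXX h.hs h.h0 hc' A]
    exact h.PX _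
  · intro i hi
    exact hle _ (hI i hi).1.2.2
  · rintro A hA ⟨i, hi, hiA⟩
    rw [pre_card]
    apply hle
    apply h.PC
    · intro p hp
      rw [mem_pre] at hp
      have h1 := hA (f p) hp
      rw [cws _ _ hp] at h1
      by_cases ha : f p ∈ I
      · rw [hcI _ ha] at h1
        have h2 : ws w p (pre f A) ≤ ∑ u ∈ pre f {f p}, ws w u (pre f A) :=
          Finset.single_le_sum (f := fun u => ws w u (pre f A)) (fun _ _ => by positivity)
            (by simp [mem_pre])
        have := h.hc p
        omega
      · obtain ⟨v, hv⟩ := hI2 _ ha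
        have : p ∈ pre f {f p} := by simp [mem_pre]
        rw [hv] at this
        simp at this
        subst this
        rw [hcs _ _ hv, hv, Finset.sum_singleton] at h1
        exact h1
    · intro hu
      obtain ⟨v, rfl⟩ := hf i
      have : v ∈ pre f A := by rw [hu]; simp
      rw [mem_pre] at this
      exact hiA this

end Node

section Upper
variable {V : Type*} [Fintype V] [DecidableEq V] {w : V → V → ℕ} {c : V → ℕ} {k t K : ℕ}

open Classical in
/-- Vertices in maximal tight sets. -/
noncomputable def UU (w : V → V → ℕ) (c : V → ℕ) (K : ℕ) : Finset V :=
  Finset.univ.filter (fun v => ∃ S, MT w c K S ∧ v ∈ S)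

theorem mem_UU {v : V} : v ∈ UU w c K ↔ ∃ S, MT w c K S ∧ v ∈ S := by simp [UU]

theorem U_upper (h : Sys w c k t K) (ht : 1 ≤ t) :
    (UU w c K).card ≤ (8 * k + t) * ((Fintype.card V - 1) / K) := by
  classical
  have hex : ∀ v : V, ∃ S : Finset V, v ∈ S ∧
      ((MT w c K S) ∨ (S = {v} ∧ ¬ ∃ S, MT w c K S ∧ v ∈ S)) := by
    intro v
    by_cases hv : ∃ S, MT w c K S ∧ v ∈ S
    · obtain ⟨S, hS, hvS⟩ := hv
      exact ⟨S, hvS, Or.inl hS⟩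
    · exact ⟨{v}, by simp, Or.inr ⟨rfl, hv⟩⟩
  choose π hπ1 hπ2 using hex
  have hπ3 : ∀ u v, u ∈ π v ↔ π u = π v := by
    intro u v
    constructor
    · intro hu
      rcases hπ2 v with hv | ⟨hv, hv2⟩
      · rcases hπ2 u with hu' | ⟨hu', hu2⟩
        · exact mt_eq h hu' hv (hπ1 u) hu
        · exact absurd ⟨_, hv, hu⟩ hu2
      · rw [hv] at hu
        simp at hu
        rw [hu]
    · intro he
      rw [← he]; exact hπ1 u
  let f : V → {S // S ∈ Finset.univ.image π} := fun v => ⟨π v, by simp⟩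
  have hf : Function.Surjective f := by
    rintro ⟨S, hS⟩
    rw [Finset.mem_image] at hS
    obtain ⟨v, _, hv⟩ := hS
    exact ⟨v, Subtype.ext hv⟩
  have hpre : ∀ v, pre f {f v} = π v := by
    intro v
    ext u
    rw [mem_pre, Finset.mem_singleton, Subtype.ext_iff, hπ3 u v]
  have hcex : ∀ a, ∃ m : ℕ, 2 * (m : ℤ) = XX w c (pre f {a}) := by
    intro a
    obtain ⟨v, rfl⟩ := hf a
    rw [hpre v]
    rcases hπ2 v with hv | ⟨hv, _⟩
    · exact ⟨1, by rw [mt_XX h hv]; norm_num⟩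
    · exact ⟨c v, by rw [hv]; simp [XX, ws, h.h0]⟩
  choose c' hc' using hcex
  have := U_upper_node h hf ht hc' (Finset.univ.filter (fun a => MT w c K (pre f {a})))
    (fun a ha => (Finset.mem_filter.1 ha).2) (by
      intro a ha
      obtain ⟨v, rfl⟩ := hf a
      rw [Finset.mem_filter, hpre] at ha
      simp only [Finset.mem_univ, true_and] at ha
      rw [hpre]
      exact ⟨v, ((hπ2 v).resolve_left ha).1⟩)
  refine le_trans (Finset.card_le_card ?_) this
  intro v hv
  rw [mem_UU] at hv
  rw [mem_pre, Finset.mem_filter, hpre]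
  refine ⟨Finset.mem_univ _, ?_⟩
  exact (hπ2 v).resolve_right (fun hh => hh.2 hv)

end Upper
end EFRS

namespace EFRS
section Lower
variable {V : Type*} [Fintype V] [DecidableEq V] {w : V → V → ℕ} {c : V → ℕ} {k t K : ℕ}

theorem low_card (h : Sys w c k t K) :
    Fintype.card V ≤ 2 * (Finset.univ.filter (fun v => ws w v Finset.univ ≤ 4 * k)).card := by
  have h1 := h.hD
  have h2 : (4 * k + 1) * (Finset.univ.filter (fun v => ¬ ws w v Finset.univ ≤ 4 * k)).card ≤
      DD w Finset.univ := by
    unfold DD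
    calc (4 * k + 1) * (Finset.univ.filter (fun v => ¬ ws w v Finset.univ ≤ 4 * k)).card
        = ∑ v ∈ Finset.univ.filter (fun v => ¬ ws w v Finset.univ ≤ 4 * k), (4 * k + 1) := by
          simp [mul_comm]
      _ ≤ ∑ v ∈ Finset.univ.filter (fun v => ¬ ws w v Finset.univ ≤ 4 * k),
          ws w v Finset.univ := by
          apply Finset.sum_le_sum
          intro v hv
          have := (Finset.mem_filter.1 hv).2
          omega
      _ ≤ _ := Finset.sum_le_sum_of_subset (Finset.filter_subset _ _)
  have h3 := Finset.card_filter_add_card_filter_not (s := (Finset.univ : Finset V))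
    (fun v => ws w v Finset.univ ≤ 4 * k)
  rw [Finset.card_univ] at h3
  set a := (Finset.univ.filter (fun v => ws w v Finset.univ ≤ 4 * k)).card
  set b := (Finset.univ.filter (fun v => ¬ ws w v Finset.univ ≤ 4 * k)).card
  have hk := h.hk
  by_contra hcon
  rw [← h3] at h1 hcon
  have : a < b := by omega
  nlinarith

/-- Neighbours within a set. -/
def nb (w : V → V → ℕ) (p : V) (A : Finset V) : Finset V := A.filter (fun q => 1 ≤ w p q)

theorem U_lower (h : Sys w c k t K) : ∃ X : Finset V, K * X.card < Fintype.card V ∧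
    Fintype.card V ≤ 2 * k * (UU w c K).card + (8 * k * k + 2) * X.card := by
  classical
  set Low := Finset.univ.filter (fun v : V => ws w v Finset.univ ≤ 4 * k) with hLow
  have hlow := low_card h
  rw [← hLow] at hlow
  have hn := h.hn
  obtain ⟨X, hX, hmax⟩ := ((Finset.univ : Finset (Finset V)).filter
    (fun X => X ⊆ Low ∧ Clo w c X ∧ X ≠ Finset.univ)).exists_max_image Finset.card
    ⟨∅, by
      simp only [Finset.mem_filter, Finset.mem_univ, true_and]
      refine ⟨by simp, ?_, ?_⟩
      · intro p _
        have := h.hc p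
        simp [ws]; omega
      · intro he
        have := congrArg Finset.card he
        rw [Finset.card_univ] at this
        simp at this
        omega⟩
  simp only [Finset.mem_filter, Finset.mem_univ, true_and] at hX hmax
  obtain ⟨hXL, hXc, hXu⟩ := hX
  have hXK := h.PC X hXc hXu
  refine ⟨X, hXK, ?_⟩
  have hK : 2 ≤ K := by
    rw [h.hK]
    have : 1 ≤ k ^ 3 := Nat.one_le_pow _ _ (by have := h.hk; omega)
    omega
  let Q := (UU w c K ∪ X.biUnion (fun x => nb w x Finset.univ)).filter
    (fun p => p ∉ X ∧ ws w p X + 1 = c p)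
  have hcov : Low \ X ⊆ Q.biUnion (fun p => nb w p Xᶜ) := by
    intro z hz
    rw [Finset.mem_sdiff] at hz
    have hnot : ¬ Clo w c (insert z X) := by
      intro hcl
      have := hmax (insert z X) ⟨Finset.insert_subset hz.1 hXL, hcl, ?_⟩
      · rw [Finset.card_insert_of_notMem hz.2] at this; omega
      · intro he
        have := congrArg Finset.card he
        rw [Finset.card_insert_of_notMem hz.2, Finset.card_univ] at this
        have h2 : 2 * X.card ≤ K * X.card := Nat.mul_le_mul_right _ hK
        omega
    unfold Clo at hnot
    push Not at hnot
    obtain ⟨p, hp, hpc⟩ := hnot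
    rw [Finset.mem_insert, not_or] at hp
    rw [ws_insert _ _ _ _ hz.2] at hpc
    have h1 := hXc p hp.2
    have h2 := h.h1 p z
    rw [Finset.mem_biUnion]
    refine ⟨p, ?_, ?_⟩
    · simp only [Q, Finset.mem_filter]
      refine ⟨?_, hp.2, by omega⟩
      rw [Finset.mem_union]
      by_cases h0 : ws w p X = 0
      · left
        rw [mem_UU]
        exact mt_one h (by omega)
      · right
        rw [ws_eq_zero] at h0
        push Not at h0
        obtain ⟨x, hx, hxw⟩ := h0
        rw [Finset.mem_biUnion]
        refine ⟨x, hx, ?_⟩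
        rw [nb, Finset.mem_filter, h.hs x p]
        exact ⟨Finset.mem_univ _, by omega⟩
    · rw [nb, Finset.mem_filter, Finset.mem_compl]
      exact ⟨hz.2, by omega⟩
  have h1 : (Low \ X).card ≤ Q.card * k := by
    refine (Finset.card_le_card hcov).trans (Finset.card_biUnion_le_card_mul _ _ _ ?_)
    intro p hp
    have hp2 := (Finset.mem_filter.1 hp).2
    refine (card_le_ws w p Xᶜ).trans ?_
    have h3 := ws_sdiff w p (Finset.subset_univ X)
    rw [← Finset.compl_eq_univ_sdiff] at h3
    have := h.hcd p
    omega
  have h2 : Q.card ≤ (UU w c K).card + X.card * (4 * k) := by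
    refine (Finset.card_filter_le _ _).trans ((Finset.card_union_le _ _).trans ?_)
    refine Nat.add_le_add_left (Finset.card_biUnion_le_card_mul _ _ _ ?_) _
    intro x hx
    exact (card_le_ws w x _).trans (Finset.mem_filter.1 (hXL hx)).2
  have h3 : Low.card ≤ (Low \ X).card + X.card := by
    have := Finset.le_card_sdiff X Low
    omega
  have h4 : Q.card * k ≤ ((UU w c K).card + X.card * (4 * k)) * k := Nat.mul_le_mul_right _ h2
  nlinarith

theorem sys_false (h : Sys w c k t K) : False := by
  have hk := h.hk
  have ht := h.ht
  have ht1 : 1 ≤ t := by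
    have : 3 * k ≤ k * k := Nat.mul_le_mul_right _ hk
    omega
  obtain ⟨X, hX1, hX2⟩ := U_lower h
  have hU := U_upper h ht1
  have hKpos : 0 < K := by rw [h.hK]; positivity
  have hXE : X.card ≤ (Fintype.card V - 1) / K := by
    rw [Nat.le_div_iff_mul_le hKpos, mul_comm]; omega
  have hE : K * ((Fintype.card V - 1) / K) ≤ Fintype.card V - 1 := Nat.mul_div_le _ _
  set E := (Fintype.card V - 1) / K
  have hn := h.hn
  set n := Fintype.card V
  have h1 : n ≤ 2 * k * ((8 * k + t) * E) + (8 * k * k + 2) * E :=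
    hX2.trans (Nat.add_le_add (Nat.mul_le_mul_left _ hU) (Nat.mul_le_mul_left _ hXE))
  have h2 : 2 * k * ((8 * k + t) * E) + (8 * k * k + 2) * E =
      (24 * (k * k) + k * (2 * t) + 2) * E := by ring
  have h3 : 24 * (k * k) + k * (2 * t) + 2 ≤ K := by
    rw [h.hK]
    have e1 : k * (2 * t) ≤ k * (k * k) := Nat.mul_le_mul_left _ (by omega)
    have e2 : 1 * (k * k) ≤ k * (k * k) := Nat.mul_le_mul_right _ (by omega)
    have e3 : k ^ 3 = k * (k * k) := by ring
    have e4 : 3 * k ≤ k * k := Nat.mul_le_mul_right _ hk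
    rw [e3]
    omega
  have h4 := Nat.mul_le_mul_right E h3
  omega

end Lower

section Final
variable {V : Type*} [Fintype V] [DecidableEq V] {w : V → V → ℕ} {k t : ℕ}

theorem ws_map (W : Finset V) (p : W) (A : Finset W) :
    ws (fun a b : W => w a b) p A = ws w p (A.map (Function.Embedding.subtype _)) := by
  simp [ws]

theorem DD_map (W : Finset V) (A : Finset W) :
    DD (fun a b : W => w a b) A = DD w (A.map (Function.Embedding.subtype _)) := by
  simp [DD, ws_map]

theorem hh_map (W : Finset V) (A : Finset W) :
    hh (fun a b : W => w a b) k A = hh w k (A.map (Function.Embedding.subtype _)) := by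
  simp [hh, DD_map]

theorem main_nat (hs : ∀ p q, w p q = w q p) (h0 : ∀ p, w p p = 0) (h1 : ∀ p q, w p q ≤ 1)
    (hk : 3 ≤ k) (ht : 2 * t + k + 4 = k * k)
    (hn : k - 1 ≤ Fintype.card V) (hU : -(2 * (t : ℤ)) ≤ hh w k Finset.univ) :
    ∃ s : Finset V, s.Nonempty ∧ (∀ v ∈ s, k ≤ ws w v s) ∧
      10 ^ 4 * k ^ 3 * s.card + Fintype.card V ≤ 10 ^ 4 * k ^ 3 * Fintype.card V := by
  classical
  by_contra hcon
  push Not at hcon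
  obtain ⟨W, hW, hmin⟩ := ((Finset.univ : Finset (Finset V)).filter
    (fun A => k - 1 ≤ A.card ∧ -(2 * (t : ℤ)) ≤ hh w k A)).exists_min_image Finset.card
    ⟨Finset.univ, by simp [hU]; simpa using hn⟩
  simp only [Finset.mem_filter, Finset.mem_univ, true_and] at hW hmin
  have hmu : (Finset.univ : Finset W).map (Function.Embedding.subtype _) = W := by
    ext x; simp
  have hex := sys_of_min (V := W) (w := fun a b : W => w a b) (k := k) (t := t)
    (K := 10 ^ 4 * k ^ 3) (fun p q => hs p q) (fun p => h0 p) (fun p q => h1 p q) hk ht rfl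
    (by simpa using hW.1) (by rw [hh_map, hmu]; exact hW.2) ?_ ?_
  · obtain ⟨c, hsys⟩ := hex
    exact sys_false hsys
  · intro A hA hAc
    rw [hh_map]
    by_contra hlt
    push Not at hlt
    obtain ⟨m, hm⟩ := DD_even hs h0 (A.map (Function.Embedding.subtype _))
    have h3 : -(2 * (t : ℤ)) ≤ hh w k (A.map (Function.Embedding.subtype _)) := by
      unfold hh at hlt ⊢
      rw [hm, mul_assoc] at hlt ⊢
      push_cast at hlt ⊢
      omega
    have h2 := hmin _ ⟨by rw [Finset.card_map]; exact hAc, h3⟩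
    rw [Finset.card_map] at h2
    apply hA
    apply Finset.eq_univ_of_card
    have := Finset.card_le_univ A
    simp at this ⊢
    omega
  · intro s hs1 hs2
    have h3 := hcon (s.map (Function.Embedding.subtype _)) (by simpa using hs1) (by
      intro v hv
      rw [Finset.mem_map] at hv
      obtain ⟨u, hu, rfl⟩ := hv
      have := hs2 u hu
      rwa [ws_map] at this)
    rw [Finset.card_map] at h3
    have h4 := Finset.card_add_card_compl s
    simp only [Fintype.card_coe] at h4 ⊢
    have h5 : W.card ≤ Fintype.card V := Finset.card_le_univ W
    set K := 10 ^ 4 * k ^ 3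
    have hK : 1 ≤ K := by
      have : 0 < K := by positivity
      omega
    obtain ⟨r, hr⟩ := Nat.exists_eq_add_of_le h5
    rw [hr, ← h4] at h3
    have h6 : 1 * r ≤ K * r := Nat.mul_le_mul_right _ hK
    rw [← h4]
    nlinarith

end Final
end EFRS

/-- **Conjecture of Erdős, Faudree, Rousseau and Schelp (proved in the paper).** Let `k ≥ 3`.
Every finite simple graph on `n ≥ k-1` vertices with at least `(k-1)(n-k+2) + C(k-2,2) + 1`
edges contains a non-empty subgraph on at most `(1 - 1/(10⁴k³))·n` vertices with minimum
degree at least `k`. -/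
theorem erdos_faudree_rousseau_schelp_conjecture {V : Type*} [Fintype V] [DecidableEq V]
    (k n : ℕ) (hk : 3 ≤ k)
    (G : SimpleGraph V) [DecidableRel G.Adj]
    (hn : Fintype.card V = n) (hnk : k - 1 ≤ n)
    (he : (k - 1) * (n + 2 - k) + Nat.choose (k - 2) 2 + 1 ≤ G.edgeFinset.card) :
    ∃ s : Finset V, s.Nonempty ∧
      (s.card : ℝ) ≤ (1 - 1 / (10 ^ 4 * (k : ℝ) ^ 3)) * (n : ℝ) ∧
      ∀ v ∈ s, k ≤ (s.filter (fun u => G.Adj v u)).card := by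
  have hws : ∀ v (A : Finset V), EFRS.ws (fun a b => if G.Adj a b then 1 else 0) v A =
      (A.filter (fun u => G.Adj v u)).card := by
    intro v A
    simp [EFRS.ws]
  have hD : EFRS.DD (fun a b => if G.Adj a b then 1 else 0) (Finset.univ : Finset V) =
      2 * G.edgeFinset.card := by
    rw [← G.sum_degrees_eq_twice_card_edges]
    unfold EFRS.DD
    apply Finset.sum_congr rfl
    intro v _
    rw [hws, ← SimpleGraph.card_neighborFinset_eq_degree, SimpleGraph.neighborFinset_eq_filter]
  obtain ⟨j, rfl⟩ : ∃ j, k = j + 3 := ⟨k - 3, by omega⟩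
  obtain ⟨t, ht⟩ : ∃ t, 2 * t = j * j + 5 * j + 2 := by
    have : Even (j * j + 5 * j + 2) := by
      have := Nat.even_mul_succ_self j
      obtain ⟨r, hr⟩ := this
      exact ⟨r + 2 * j + 1, by nlinarith⟩
    obtain ⟨r, hr⟩ := this
    exact ⟨r, by omega⟩
  obtain ⟨s, hs1, hs2, hs3⟩ := EFRS.main_nat (w := fun a b => if G.Adj a b then 1 else 0)
    (k := j + 3) (t := t) (fun p q => by simp [G.adj_comm]) (fun p => by simp)
    (fun p q => by split_ifs <;> omega) hk (by nlinarith) (by omega) (by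
      unfold EFRS.hh
      rw [hD, Finset.card_univ, hn]
      have hch : 2 * Nat.choose (j + 3 - 2) 2 = (j + 1) * j := by
        have e : j + 3 - 2 = j + 1 := by omega
        rw [e, Nat.choose_two_right]
        have := Nat.even_mul_pred_self (j + 1)
        rw [Nat.mul_div_cancel' this.two_dvd]
        simp
      obtain ⟨m, rfl⟩ : ∃ m, n = j + 2 + m := ⟨n - (j + 2), by omega⟩
      have e1 : j + 3 - 1 = j + 2 := by omega
      have e2 : j + 2 + m + 2 - (j + 3) = m + 1 := by omega
      rw [e1, e2] at he
      zify at he hch ht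
      push_cast
      nlinarith)
  refine ⟨s, hs1, ?_, ?_⟩
  · rw [hn] at hs3
    have hK : (0 : ℝ) < 10 ^ 4 * ((j + 3 : ℕ) : ℝ) ^ 3 := by positivity
    have h3 : (10 ^ 4 * ((j + 3 : ℕ) : ℝ) ^ 3) * s.card + n ≤
        (10 ^ 4 * ((j + 3 : ℕ) : ℝ) ^ 3) * n := by exact_mod_cast hs3
    generalize (10 ^ 4 * ((j + 3 : ℕ) : ℝ) ^ 3) = K at hK h3
    rw [sub_mul, one_mul, one_div_mul_eq_div, le_sub_iff_add_le]
    rw [← mul_le_mul_iff_right₀ hK, mul_add, mul_div_cancel₀ _ hK.ne']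
    exact h3
  · intro v hv
    rw [← hws]
    exact hs2 v hv
end
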